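/- Let n ≥ 1 and let f be a continuous positive density on ℝ^{n+1} with f(x) → +∞ as |x| → +∞. Assume that the sequence ζ(m) = min{f(x) : m ≤ |x| ≤ m+2} / max{f(x)^{n/(n+1)} : m ≤ |x| ≤ m+2} tends to +∞ as m → ∞. Then for every V > 0 there exists a bounded open set Ω ⊆ ℝ^{n+1} which is an isoperimetric region of volume V; moreover, every isoperimetric region of volume V is a bounded subset of ℝ^{n+1}. -/

import Mathlib

open Filter MeasureTheory Set

/-- Weighted volume of a set `Ω ⊆ ℝ^{n+1}` with respect to the density `f`:
`vol(Ω) = ∫_Ω f dx` (Lebesgue measure). -/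
noncomputable def wvol {n : ℕ} (f : EuclideanSpace ℝ (Fin (n + 1)) → ℝ)
    (Ω : Set (EuclideanSpace ℝ (Fin (n + 1)))) : ENNReal :=
  ∫⁻ x in Ω, ENNReal.ofReal (f x)

/-- Weighted perimeter of a set `Ω ⊆ ℝ^{n+1}` with respect to the density `f`:
`P(Ω) = ∫_{∂Ω} f dH^n`, the integral of `f` over the topological boundary of `Ω`
with respect to the `n`-dimensional Hausdorff measure. -/
noncomputable def wper {n : ℕ} (f : EuclideanSpace ℝ (Fin (n + 1)) → ℝ)
    (Ω : Set (EuclideanSpace ℝ (Fin (n + 1)))) : ENNReal :=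
  ∫⁻ x in frontier Ω, ENNReal.ofReal (f x) ∂(μH[n])

/-- `Ω` is an isoperimetric region (minimizer) of weighted volume `V`:  it is open,
has weighted volume `V`, and its weighted perimeter is at most that of any open set of
the same weighted volume. -/
def IsIsopRegion {n : ℕ} (f : EuclideanSpace ℝ (Fin (n + 1)) → ℝ)
    (Ω : Set (EuclideanSpace ℝ (Fin (n + 1)))) (V : ENNReal) : Prop :=
  IsOpen Ω ∧ wvol f Ω = V ∧
    ∀ U : Set (EuclideanSpace ℝ (Fin (n + 1))), IsOpen U → wvol f U = V →
      wper f Ω ≤ wper f U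

open scoped ENNReal NNReal Topology
open Metric
open ENNReal (ofReal)

/-- The ambient space. -/
abbrev EX (n : ℕ) := EuclideanSpace ℝ (Fin (n + 1))

theorem HB {n : ℕ} (ν : OuterMeasure (EX n)) (c r : ℝ≥0∞) (hc0 : c ≠ 0) (hc : c ≠ ⊤) (hr : 0 < r)
    (h : ∀ s, ediam s ≤ r → ν s ≤ c * ediam s ^ n) (A : Set (EX n)) :
    ν A ≤ c * μH[n] A := by
  have h1 := OuterMeasure.le_mkMetric (c • fun r : ℝ≥0∞ => r ^ (n : ℝ)) ν r hr (by
    intro s hs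
    simpa using h s hs)
  rw [OuterMeasure.mkMetric_smul _ hc hc0] at h1
  have h2 := h1 A
  have h3 : (μH[(n : ℝ)] : Measure (EX n)) A = (OuterMeasure.mkMetric (fun r : ℝ≥0∞ => r ^ (n : ℝ)) : OuterMeasure (EX n)) A := by
    rw [OuterMeasure.coe_mkMetric]; rfl
  rw [h3]
  simpa using h2

/-- Volume of unit ball. -/
noncomputable def bvol (n : ℕ) : ℝ≥0∞ := volume (ball (0 : EX n) 1)

theorem bvol_ne_top (n : ℕ) : bvol n ≠ ⊤ := measure_ball_lt_top.ne
theorem bvol_ne_zero (n : ℕ) : bvol n ≠ 0 := (Metric.measure_ball_pos _ _ one_pos).ne'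

theorem vol_cball {n : ℕ} (x : EX n) {r : ℝ} (hr : 0 ≤ r) :
    volume (closedBall x r) = ofReal (r ^ (n + 1)) * bvol n := by
  have := Measure.addHaar_closedBall (volume : Measure (EX n)) x hr
  simpa [bvol] using this

theorem vol_ball {n : ℕ} (x : EX n) {r : ℝ} (hr : 0 ≤ r) :
    volume (ball x r) = ofReal (r ^ (n + 1)) * bvol n := by
  have := Measure.addHaar_ball (volume : Measure (EX n)) x hr
  simpa [bvol] using this

/-- The tube of segments in direction `v` hitting `A`. -/
def tube {n : ℕ} (v : EX n) (A : Set (EX n)) : Set (EX n) :=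
  {x | ∃ s ∈ Icc (0 : ℝ) 1, x + s • v ∈ A}

theorem tube_mono {n : ℕ} (v : EX n) {A B : Set (EX n)} (h : A ⊆ B) : tube v A ⊆ tube v B :=
  fun _ ⟨s, hs, hx⟩ => ⟨s, hs, h hx⟩

theorem tube_ball {n : ℕ} (v x : EX n) {d : ℝ} (hd : 0 < d) (hv : d ≤ ‖v‖) :
    volume (tube v (closedBall x d)) ≤
      ofReal (3 * 2 ^ (n + 1)) * bvol n * ofReal ‖v‖ * ofReal d ^ n := by
  set N : ℕ := ⌈‖v‖ / d⌉₊ with hN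
  have hN1 : ‖v‖ / d ≤ N := Nat.le_ceil _
  have hN0 : (0 : ℝ) < N := lt_of_lt_of_le (div_pos (hd.trans_le hv) hd) hN1
  have hN2 : (N : ℝ) < ‖v‖ / d + 1 := Nat.ceil_lt_add_one (by positivity)
  have hdv : ‖v‖ ≤ N * d := (div_le_iff₀ hd).1 hN1
  have hsub : tube v (closedBall x d) ⊆
      ⋃ j ∈ Finset.range (N + 1), closedBall (x - ((j : ℝ) / N) • v) (2 * d) := by
    rintro z ⟨s, ⟨hs0, hs1⟩, hz⟩
    have hj : (⌊s * N⌋₊ : ℝ) ≤ s * N := Nat.floor_le (by positivity)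
    have hj2 : s * N < ⌊s * N⌋₊ + 1 := Nat.lt_floor_add_one _
    simp only [mem_iUnion, Finset.mem_range]
    refine ⟨⌊s * N⌋₊, ?_, ?_⟩
    · have : (⌊s * N⌋₊ : ℝ) ≤ N := hj.trans (by nlinarith)
      have : ⌊s * N⌋₊ ≤ N := by exact_mod_cast this
      omega
    · rw [mem_closedBall_iff_norm] at hz ⊢
      set j : ℝ := (⌊s * N⌋₊ : ℝ)
      have e : z - (x - (j / N) • v) = (z + s • v - x) - (s - j / N) • v := by
        rw [sub_smul]; abel
      rw [e]
      refine (norm_sub_le _ _).trans ?_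
      rw [norm_smul]
      have h1 : |s - j / N| ≤ 1 / N := by
        have : s - j / N = (s * N - j) / N := by field_simp
        rw [this, abs_div, abs_of_pos hN0]
        gcongr
        rw [abs_le]; constructor <;> linarith
      have h2 : |s - j / N| * ‖v‖ ≤ d := by
        calc |s - j / N| * ‖v‖ ≤ 1 / N * (N * d) := by gcongr
          _ = d := by field_simp
      rw [Real.norm_eq_abs]
      linarith
  refine (measure_mono hsub).trans ((measure_biUnion_finset_le _ _).trans ?_)
  simp only [vol_cball _ (by positivity : 0 ≤ 2 * d), Finset.sum_const, Finset.card_range, nsmul_eq_mul]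
  have h3 : ((N + 1 : ℕ) : ℝ≥0∞) * (ofReal ((2 * d) ^ (n + 1)) * bvol n)
    = ofReal ((N + 1) * (2 * d) ^ (n + 1)) * bvol n := by
    rw [ENNReal.ofReal_mul (by positivity), ← mul_assoc]
    congr 2
    rw [show ((N : ℝ) + 1) = ((N + 1 : ℕ) : ℝ) by push_cast; rfl, ENNReal.ofReal_natCast]
  rw [h3]
  have h4 : ofReal (3 * 2 ^ (n + 1)) * bvol n * ofReal ‖v‖ * ofReal d ^ n
    = ofReal (3 * 2 ^ (n + 1) * ‖v‖ * d ^ n) * bvol n := by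
    rw [ENNReal.ofReal_mul (p := 3 * 2 ^ (n + 1) * ‖v‖) (by positivity),
      ENNReal.ofReal_mul (p := 3 * 2 ^ (n + 1)) (by positivity), ENNReal.ofReal_pow hd.le]
    ring
  rw [h4]
  refine mul_le_mul_left (ENNReal.ofReal_le_ofReal ?_) _
  have h5 : (N + 1 : ℝ) * d ≤ 3 * ‖v‖ := by
    have : (N : ℝ) * d < ‖v‖ + d := by
      calc (N : ℝ) * d < (‖v‖ / d + 1) * d := by gcongr
        _ = _ := by field_simp
    linarith
  calc (N + 1 : ℝ) * (2 * d) ^ (n + 1) = 2 ^ (n + 1) * d ^ n * ((N + 1) * d) := by ring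
    _ ≤ 2 ^ (n + 1) * d ^ n * (3 * ‖v‖) := by gcongr
    _ = _ := by ring

/-- volume of tubes as an outer measure -/
noncomputable def tubeOM {n : ℕ} (v : EX n) : OuterMeasure (EX n) where
  measureOf A := volume (tube v A)
  empty := by
    have : tube v ∅ = ∅ := by ext; simp [tube]
    simp [this]
  mono h := measure_mono (tube_mono v h)
  iUnion_nat s _ := by
    refine (measure_mono ?_).trans (measure_iUnion_le _)
    rintro x ⟨t, ht, hx⟩
    obtain ⟨i, hi⟩ := mem_iUnion.1 hx
    exact mem_iUnion.2 ⟨i, t, ht, hi⟩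

theorem T1 (n : ℕ) : ∃ C : ℝ≥0, 0 < C ∧ ∀ (v : EX n) (A : Set (EX n)), v ≠ 0 →
    volume (tube v A) ≤ C * ofReal ‖v‖ * μH[n] A := by
  have hfin : ofReal (3 * 2 ^ (n + 1)) * bvol n ≠ ⊤ :=
    ENNReal.mul_ne_top ENNReal.ofReal_ne_top (bvol_ne_top n)
  have hne : ofReal (3 * 2 ^ (n + 1)) * bvol n ≠ 0 :=
    mul_ne_zero (by positivity) (bvol_ne_zero n)
  refine ⟨(ofReal (3 * 2 ^ (n + 1)) * bvol n).toNNReal, ?_, ?_⟩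
  · exact ENNReal.toNNReal_pos hne hfin
  intro v A hv
  have hv0 : 0 < ‖v‖ := norm_pos_iff.2 hv
  rw [ENNReal.coe_toNNReal hfin]
  refine HB (tubeOM v) _ (ofReal ‖v‖) (mul_ne_zero hne (by simpa using hv))
    (ENNReal.mul_ne_top hfin ENNReal.ofReal_ne_top) (by simpa using hv) ?_ A
  intro s hs
  change volume (tube v s) ≤ _
  rcases s.eq_empty_or_nonempty with rfl | ⟨x, hx⟩
  · have : tube v ∅ = ∅ := by ext; simp [tube]
    simp [this]
  have hfs : ediam s ≠ ⊤ := (hs.trans_lt ENNReal.ofReal_lt_top).ne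
  set d := (ediam s).toReal with hd
  have hd' : ediam s = ofReal d := (ENNReal.ofReal_toReal hfs).symm
  have hsx : ∀ d', d ≤ d' → s ⊆ closedBall x d' := by
    intro d' hdd y hy
    have := Metric.edist_le_ediam_of_mem hy hx
    rw [edist_dist, hd'] at this
    exact ((ENNReal.ofReal_le_ofReal_iff ENNReal.toReal_nonneg).1 this).trans hdd
  have hdv : d ≤ ‖v‖ := by
    rw [hd'] at hs
    exact (ENNReal.ofReal_le_ofReal_iff hv0.le).1 hs
  rcases (show 0 ≤ d from ENNReal.toReal_nonneg).eq_or_lt with h0 | h0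
  · have : Tendsto (fun d' : ℝ => ofReal (3 * 2 ^ (n + 1)) * bvol n * ofReal ‖v‖ * ofReal d' ^ n) (𝓝[>] 0) (𝓝 (ofReal (3 * 2 ^ (n + 1)) * bvol n * ofReal ‖v‖ * ofReal 0 ^ n)) := by
      refine ENNReal.Tendsto.const_mul ?_ (Or.inr (ENNReal.mul_ne_top hfin ENNReal.ofReal_ne_top))
      refine ENNReal.Tendsto.pow ?_
      exact (ENNReal.continuous_ofReal.tendsto 0).mono_left nhdsWithin_le_nhds
    rw [hd', ← h0]
    refine ge_of_tendsto this ?_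
    filter_upwards [Ioo_mem_nhdsGT hv0] with d' hd'
    exact (measure_mono (tube_mono v (hsx d' (h0 ▸ hd'.1.le)))).trans (tube_ball v x hd'.1 hd'.2.le)
  · rw [hd']
    exact (measure_mono (tube_mono v (hsx d le_rfl))).trans (tube_ball v x h0 hdv)

theorem preconn_frontier {Y : Type*} [TopologicalSpace Y] {S : Set Y} (hS : IsPreconnected S) (Ω : Set Y)
    {a b : Y} (ha : a ∈ S) (hb : b ∈ S) (haΩ : a ∈ Ω) (hbΩ : b ∉ Ω) : (S ∩ frontier Ω).Nonempty := by
  by_contra hcon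
  have h : ∀ z ∈ S, z ∉ frontier Ω := fun z hz hf => hcon ⟨z, hz, hf⟩
  have hsub : S ⊆ interior Ω ∪ (closure Ω)ᶜ := by
    intro z hz
    by_contra hz2
    simp only [mem_union, mem_compl_iff, not_or, not_not] at hz2
    exact h z hz ⟨hz2.2, hz2.1⟩
  have h1 : S ⊆ interior Ω := by
    refine hS.subset_left_of_subset_union isOpen_interior isClosed_closure.isOpen_compl ?_ hsub ?_
    · exact disjoint_compl_right_iff_subset.2 (interior_subset.trans subset_closure)
    · refine ⟨a, ha, ?_⟩
      rcases hsub ha with h2 | h2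
      · exact h2
      · exact absurd (subset_closure haΩ) h2
  exact hbΩ (interior_subset (h1 hb))

theorem seg_frontier {n : ℕ} {K Ω : Set (EX n)} (hK : Convex ℝ K) {a v : EX n} (ha : a ∈ K)
    (hb : a + v ∈ K) (haΩ : a ∈ Ω) (hbΩ : a + v ∉ Ω) : a ∈ tube v (frontier Ω ∩ K) := by
  obtain ⟨z, hz, hzf⟩ := preconn_frontier (convex_segment (𝕜 := ℝ) a (a + v)).isPreconnected Ω
    (left_mem_segment ℝ _ _) (right_mem_segment ℝ _ _) haΩ hbΩ
  have hzK := hK.segment_subset ha hb hz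
  rw [segment_eq_image'] at hz
  obtain ⟨s, hs, rfl⟩ := hz
  refine ⟨s, hs, ?_⟩
  simp only [add_sub_cancel_left] at hzf hzK
  exact ⟨hzf, hzK⟩

theorem RI (n : ℕ) : ∃ C : ℝ≥0, 0 < C ∧ ∀ (K Ω : Set (EX n)) (x : EX n) (ρ : ℝ), 0 < ρ → Convex ℝ K →
    MeasurableSet K → K ⊆ closedBall x ρ → MeasurableSet Ω →
    volume (Ω ∩ K) * volume (K \ Ω) ≤ C * ofReal (ρ ^ (n + 2)) * μH[n] (frontier Ω ∩ K) := by
  obtain ⟨C, hC, hT⟩ := T1 n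
  have hb := bvol_ne_top n
  refine ⟨C * 2 ^ (n + 2) * (bvol n).toNNReal, ?_, ?_⟩
  · have : 0 < (bvol n).toNNReal := ENNReal.toNNReal_pos (bvol_ne_zero n) hb
    positivity
  intro K Ω x ρ hρ hK hKm hKx hΩ
  set A := Ω ∩ K
  set D := K \ Ω
  have hA : MeasurableSet A := hΩ.inter hKm
  have hD : MeasurableSet D := hKm.diff hΩ
  have key : volume A * volume D = ∫⁻ v : EX n, volume (A ∩ (fun z => z + v) ⁻¹' D) := by
    have h1 : ∀ v : EX n, volume (A ∩ (fun z => z + v) ⁻¹' D) = ∫⁻ z, A.indicator 1 z * D.indicator 1 (z + v) := by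
      intro v
      rw [← lintegral_indicator_one (hA.inter (measurable_add_const v hD))]
      congr 1; ext z
      by_cases hz1 : z ∈ A <;> by_cases hz2 : z + v ∈ D <;> simp [hz1, hz2]
    simp_rw [h1]
    rw [lintegral_lintegral_swap]
    · have h2 : ∀ z : EX n, ∫⁻ v, A.indicator (1 : EX n → ℝ≥0∞) z * D.indicator 1 (z + v) = A.indicator 1 z * volume D := by
        intro z
        rw [lintegral_const_mul' _ _ (by by_cases h : z ∈ A <;> simp [h])]
        congr 1
        rw [lintegral_add_left_eq_self (μ := volume) (fun w => D.indicator (1 : EX n → ℝ≥0∞) w) z]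
        exact lintegral_indicator_one hD
      simp_rw [h2]
      rw [lintegral_mul_const _ (measurable_one.indicator hA), lintegral_indicator_one hA]
    · refine Measurable.aemeasurable ?_
      refine Measurable.mul ?_ ?_
      · exact (measurable_one.indicator hA).comp measurable_snd
      · exact (measurable_one.indicator hD).comp (measurable_snd.add measurable_fst)
  rw [key]
  have bd : ∀ v : EX n, volume (A ∩ (fun z => z + v) ⁻¹' D) ≤
      (closedBall (0 : EX n) (2 * ρ)).indicator (fun _ => C * ofReal (2 * ρ) * μH[n] (frontier Ω ∩ K)) v := by
    intro v
    rcases (A ∩ (fun z => z + v) ⁻¹' D).eq_empty_or_nonempty with h | ⟨z, hz1, hz2⟩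
    · simp [h]
    have hvn : ‖v‖ ≤ 2 * ρ := by
      have h1 := hKx hz1.2
      have h2 := hKx hz2.1
      rw [mem_closedBall_iff_norm] at h1 h2
      have : v = (z + v - x) - (z - x) := by abel
      rw [this]
      exact (norm_sub_le _ _).trans (by linarith)
    rw [indicator_of_mem (by simpa using hvn)]
    have hv0 : v ≠ 0 := by
      rintro rfl
      apply hz2.2
      simpa using hz1.1
    calc _ ≤ volume (tube v (frontier Ω ∩ K)) := by
          refine measure_mono ?_
          rintro w ⟨hw1, hw2⟩
          exact seg_frontier hK hw1.2 hw2.1 hw1.1 hw2.2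
      _ ≤ _ := hT v _ hv0
      _ ≤ _ := by gcongr
  refine (lintegral_mono bd).trans ?_
  rw [lintegral_indicator isClosed_closedBall.measurableSet, lintegral_const, Measure.restrict_apply_univ,
    vol_cball _ (by positivity)]
  push_cast
  rw [ENNReal.coe_toNNReal hb, mul_pow, mul_assoc, mul_comm]
  rw [ENNReal.ofReal_mul (by positivity), ENNReal.ofReal_mul (by positivity),
    ENNReal.ofReal_pow zero_le_two, ENNReal.ofReal_pow hρ.le, ENNReal.ofReal_pow hρ.le]
  simp only [ENNReal.ofReal_ofNat]
  apply le_of_eq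
  ring

theorem muH_vol (n : ℕ) : ∃ c : ℝ≥0, ∀ A : Set (EX n), μH[((n + 1 : ℕ) : ℝ)] A = c * volume A := by
  have hf : Module.finrank ℝ (EX n) = n + 1 := by simp
  have h : Measure.IsAddHaarMeasure (μH[((n + 1 : ℕ) : ℝ)] : Measure (EX n)) := by
    have := MeasureTheory.isAddHaarMeasure_hausdorffMeasure (E := EX n)
    rwa [show (Module.finrank ℝ (EX n) : ℝ) = ((n + 1 : ℕ) : ℝ) by rw [hf]] at this
  have h2 := Measure.isAddLeftInvariant_eq_smul (μH[((n + 1 : ℕ) : ℝ)] : Measure (EX n)) volume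
  refine ⟨(μH[((n + 1 : ℕ) : ℝ)] : Measure (EX n)).addHaarScalarFactor volume, fun A => ?_⟩
  conv_lhs => rw [h2]
  rfl

theorem T2 {n : ℕ} (hn : 1 ≤ n) : ∃ C : ℝ≥0, 0 < C ∧ ∀ u : EX n → ℝ, LipschitzWith 1 u →
    ∀ A : Set (EX n), ∃ g : ℝ → ℝ≥0∞, Measurable g ∧ (∀ r, μH[n] (A ∩ u ⁻¹' {r}) ≤ g r) ∧
      ∫⁻ r, g r ≤ C * volume A := by
  obtain ⟨c, hc⟩ := muH_vol n
  refine ⟨c + 1, by positivity, ?_⟩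
  intro u hu A
  by_cases hA : volume A = ⊤
  · refine ⟨fun _ => ⊤, measurable_const, fun _ => le_top, ?_⟩
    rw [hA, ENNReal.mul_top (by positivity)]; exact le_top
  have hfin : μH[((n + 1 : ℕ) : ℝ)] A ≠ ⊤ := by
    rw [hc]; exact ENNReal.mul_ne_top ENNReal.coe_ne_top hA
  have hcov : ∀ k : ℕ, ∃ t : ℕ → Set (EX n), A ⊆ ⋃ i, t i ∧
      (∀ i, ediam (t i) ≤ ((k : ℝ≥0∞) + 1)⁻¹) ∧
      ∑' i, ediam (t i) ^ (n + 1) ≤ μH[((n + 1 : ℕ) : ℝ)] A + ((k : ℝ≥0∞) + 1)⁻¹ := by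
    intro k
    have hpos : (0 : ℝ≥0∞) < ((k : ℝ≥0∞) + 1)⁻¹ := by
      rw [ENNReal.inv_pos]; exact_mod_cast ENNReal.natCast_ne_top (k + 1)
    have h1 : ⨅ (t : ℕ → Set (EX n)) (_ : A ⊆ ⋃ n, t n) (_ : ∀ n, ediam (t n) ≤ ((k : ℝ≥0∞) + 1)⁻¹),
          ∑' n_1, ⨆ _ : (t n_1).Nonempty, ediam (t n_1) ^ ((n + 1 : ℕ) : ℝ) ≤ μH[((n + 1 : ℕ) : ℝ)] A := by
      rw [Measure.hausdorffMeasure_apply]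
      exact le_iSup₂_of_le ((k : ℝ≥0∞) + 1)⁻¹ hpos le_rfl
    have h2 := h1.trans_lt (ENNReal.lt_add_right hfin hpos.ne')
    simp only [iInf_lt_iff] at h2
    obtain ⟨t, h3, h4, h5⟩ := h2
    refine ⟨t, h3, h4, le_trans (le_of_eq ?_) h5.le⟩
    congr 1; ext i
    rcases (t i).eq_empty_or_nonempty with h | h
    · simp [h]
    · simp [h]
      exact_mod_cast (ENNReal.rpow_natCast _ (n + 1)).symm
  choose t ht1 ht2 ht3 using hcov
  let G : ℕ → ℝ → ℝ≥0∞ := fun k r => ∑' i, (closure (u '' t k i)).indicator (fun _ => ediam (t k i) ^ n) r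
  have hGm : ∀ k, Measurable (G k) := fun k =>
    Measurable.tsum fun i => measurable_const.indicator isClosed_closure.measurableSet
  have h0 : Tendsto (fun k : ℕ => ((k : ℝ≥0∞) + 1)⁻¹) atTop (𝓝 0) := by
    have := (tendsto_add_atTop_iff_nat 1).2 ENNReal.tendsto_inv_nat_nhds_zero
    simpa using this
  refine ⟨fun r => liminf (fun k => G k r) atTop, .liminf hGm, ?_, ?_⟩
  · intro r
    have h1 := Measure.hausdorffMeasure_le_liminf_tsum (n : ℝ) (A ∩ u ⁻¹' {r}) _ h0
      (fun k i => t k i ∩ u ⁻¹' {r}) (Eventually.of_forall fun k i =>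
        (Metric.ediam_mono inter_subset_left).trans (ht2 k i))
      (Eventually.of_forall fun k x hx => by
        obtain ⟨i, hi⟩ := mem_iUnion.1 (ht1 k hx.1)
        exact mem_iUnion.2 ⟨i, hi, hx.2⟩)
    refine h1.trans (liminf_le_liminf (Eventually.of_forall fun k => ?_))
    refine ENNReal.tsum_le_tsum fun i => ?_
    rw [ENNReal.rpow_natCast]
    rcases (t k i ∩ u ⁻¹' {r}).eq_empty_or_nonempty with h | ⟨x, hx1, hx2⟩
    · rw [h, Metric.ediam_empty, zero_pow (by omega)]; exact zero_le
    · rw [indicator_of_mem (subset_closure (show r ∈ u '' t k i from ⟨x, hx1, hx2⟩))]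
      gcongr
      exact inter_subset_left
  · refine (lintegral_liminf_le hGm).trans ?_
    have h2 : ∀ k, ∫⁻ r, G k r ≤ μH[((n + 1 : ℕ) : ℝ)] A + ((k : ℝ≥0∞) + 1)⁻¹ := by
      intro k
      refine le_trans ?_ (ht3 k)
      rw [lintegral_tsum fun i => (measurable_const.indicator isClosed_closure.measurableSet).aemeasurable]
      refine ENNReal.tsum_le_tsum fun i => ?_
      rw [lintegral_indicator isClosed_closure.measurableSet, lintegral_const, Measure.restrict_apply_univ, pow_succ]
      gcongr
      refine (Real.volume_le_diam _).trans ?_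
      rw [Metric.ediam_closure]
      simpa using hu.ediam_image_le (t k i)
    have h3 : Tendsto (fun k : ℕ => μH[((n + 1 : ℕ) : ℝ)] A + ((k : ℝ≥0∞) + 1)⁻¹) atTop (𝓝 (μH[((n + 1 : ℕ) : ℝ)] A)) := by
      simpa using tendsto_const_nhds.add h0
    calc liminf (fun k => ∫⁻ r, G k r) atTop ≤ liminf (fun k : ℕ => μH[((n + 1 : ℕ) : ℝ)] A + ((k : ℝ≥0∞) + 1)⁻¹) atTop :=
          liminf_le_liminf (Eventually.of_forall h2)
      _ = μH[((n + 1 : ℕ) : ℝ)] A := h3.liminf_eq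
      _ = c * volume A := hc A
      _ ≤ _ := by gcongr; simp

/-- weighted volume as a measure -/
noncomputable def mv {n : ℕ} (f : EX n → ℝ) : Measure (EX n) :=
  volume.withDensity (fun x => ofReal (f x))

/-- weighted area as a measure -/
noncomputable def mp {n : ℕ} (f : EX n → ℝ) : Measure (EX n) :=
  (μH[(n : ℝ)] : Measure (EX n)).withDensity (fun x => ofReal (f x))

theorem wvol_eq {n : ℕ} (f : EX n → ℝ) (Ω : Set (EX n)) : wvol f Ω = mv f Ω := by
  rw [mv, withDensity_apply']; rfl

theorem wper_eq {n : ℕ} (f : EX n → ℝ) (Ω : Set (EX n)) : wper f Ω = mp f (frontier Ω) := by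
  rw [mp, withDensity_apply _ isClosed_frontier.measurableSet]; rfl

theorem wd_le {n : ℕ} {f : EX n → ℝ} (ν : Measure (EX n)) {A : Set (EX n)} (hA : MeasurableSet A)
    {c : ℝ} (h : ∀ x ∈ A, f x ≤ c) : ν.withDensity (fun x => ofReal (f x)) A ≤ ofReal c * ν A := by
  rw [withDensity_apply _ hA, ← setLIntegral_const]
  exact setLIntegral_mono' hA fun x hx => ENNReal.ofReal_le_ofReal (h x hx)

theorem le_wd {n : ℕ} {f : EX n → ℝ} (ν : Measure (EX n)) {A : Set (EX n)} (hA : MeasurableSet A)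
    {c : ℝ} (h : ∀ x ∈ A, c ≤ f x) : ofReal c * ν A ≤ ν.withDensity (fun x => ofReal (f x)) A := by
  rw [withDensity_apply _ hA, ← setLIntegral_const]
  exact setLIntegral_mono' hA fun x hx => ENNReal.ofReal_le_ofReal (h x hx)

theorem T2w {n : ℕ} (hn : 1 ≤ n) : ∃ C : ℝ≥0, 0 < C ∧ ∀ f : EX n → ℝ, Measurable f → (∀ x, 0 < f x) →
    ∀ u : EX n → ℝ, LipschitzWith 1 u →
    ∀ A : Set (EX n), MeasurableSet A → ∃ g : ℝ → ℝ≥0∞, Measurable g ∧ (∀ r, mp f (A ∩ u ⁻¹' {r}) ≤ g r) ∧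
      ∫⁻ r, g r ≤ C * mv f A := by
  obtain ⟨C, hC, hT⟩ := T2 hn
  refine ⟨2 * C, by positivity, ?_⟩
  intro f hf hpos u hu A hA
  let B : ℤ → Set (EX n) := fun j => A ∩ f ⁻¹' (Ico ((2 : ℝ) ^ j) (2 ^ (j + 1)))
  have hBm : ∀ j, MeasurableSet (B j) := fun j => hA.inter (hf measurableSet_Ico)
  have hBU : A = ⋃ j, B j := by
    ext x
    constructor
    · intro hx
      obtain ⟨j, hj⟩ := exists_mem_Ico_zpow (hpos x) one_lt_two
      exact mem_iUnion.2 ⟨j, hx, hj⟩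
    · intro hx
      obtain ⟨j, hj⟩ := mem_iUnion.1 hx
      exact hj.1
  have hBd : Pairwise (Function.onFun Disjoint B) := by
    intro i j hij
    rw [Function.onFun, Set.disjoint_left]
    rintro x ⟨_, h1, h2⟩ ⟨_, h3, h4⟩
    have a1 := (zpow_lt_zpow_iff_right₀ (one_lt_two (α := ℝ))).1 (h1.trans_lt h4)
    have a2 := (zpow_lt_zpow_iff_right₀ (one_lt_two (α := ℝ))).1 (h3.trans_lt h2)
    omega
  have hu' : ∀ r, MeasurableSet (u ⁻¹' {r}) := fun r => (isClosed_singleton.preimage hu.continuous).measurableSet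
  choose g hg1 hg2 hg3 using fun j => hT u hu (B j)
  refine ⟨fun r => ∑' j, ofReal ((2 : ℝ) ^ (j + 1)) * g j r, .tsum fun j => (hg1 j).const_mul _, ?_, ?_⟩
  · intro r
    have : A ∩ u ⁻¹' {r} = ⋃ j, B j ∩ u ⁻¹' {r} := by rw [← iUnion_inter, ← hBU]
    rw [this]
    refine (measure_iUnion_le _).trans (ENNReal.tsum_le_tsum fun j => ?_)
    refine (wd_le _ ((hBm j).inter (hu' r)) (c := (2 : ℝ) ^ (j + 1)) fun x hx => hx.1.2.2.le).trans ?_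
    gcongr
    exact hg2 j r
  · rw [lintegral_tsum fun j => ((hg1 j).const_mul _).aemeasurable]
    conv_rhs => rw [hBU, measure_iUnion hBd hBm, ← ENNReal.tsum_mul_left]
    refine ENNReal.tsum_le_tsum fun j => ?_
    rw [lintegral_const_mul _ (hg1 j)]
    have h1 := le_wd (volume : Measure (EX n)) (hBm j) (c := (2 : ℝ) ^ j) fun x hx => hx.2.1
    calc _ ≤ ofReal ((2 : ℝ) ^ (j + 1)) * (C * volume (B j)) := by gcongr; exact hg3 j
      _ = 2 * C * (ofReal ((2 : ℝ) ^ j) * volume (B j)) := by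
        rw [zpow_add_one₀ two_ne_zero, ENNReal.ofReal_mul (by positivity), ENNReal.ofReal_ofNat]; ring
      _ ≤ _ := by push_cast; gcongr; exact h1

theorem T2c {n : ℕ} (hn : 1 ≤ n) : ∃ C : ℝ≥0, 0 < C ∧ ∀ f : EX n → ℝ, Measurable f → (∀ x, 0 < f x) →
    ∀ u : EX n → ℝ, LipschitzWith 1 u →
    ∀ A : Set (EX n), MeasurableSet A → ∀ p q : ℝ, p < q → ∃ r ∈ Ioo p q,
      mp f (A ∩ u ⁻¹' {r}) ≤ C * mv f (A ∩ u ⁻¹' (Ioo p q)) / ofReal (q - p) := by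
  obtain ⟨C, hC, hT⟩ := T2w hn
  refine ⟨C, hC, ?_⟩
  intro f hf hpos u hu A hA p q hpq
  obtain ⟨g, hg1, hg2, hg3⟩ := hT f hf hpos u hu (A ∩ u ⁻¹' (Ioo p q)) (hA.inter (hu.continuous.measurable measurableSet_Ioo))
  have hv : volume (Ioo p q) ≠ 0 := by simp [hpq]
  obtain ⟨r, hr, h⟩ := exists_le_setLAverage hv (by simp) hg1.aemeasurable.restrict
  refine ⟨r, hr, ?_⟩
  calc mp f (A ∩ u ⁻¹' {r}) ≤ mp f (A ∩ u ⁻¹' (Ioo p q) ∩ u ⁻¹' {r}) := by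
        refine measure_mono ?_
        rintro x ⟨h1, h2⟩
        exact ⟨⟨h1, by rw [mem_preimage, show u x = r from h2]; exact hr⟩, h2⟩
    _ ≤ g r := hg2 r
    _ ≤ _ := h
    _ ≤ _ := by
      rw [setLAverage_eq, Real.volume_Ioo]
      gcongr
      exact (setLIntegral_le_lintegral _ _).trans hg3



theorem mp_one {n : ℕ} : mp (fun _ : EX n => (1 : ℝ)) = μH[(n : ℝ)] := by
  simp only [mp, ENNReal.ofReal_one]
  exact withDensity_one

theorem mv_one {n : ℕ} : mv (fun _ : EX n => (1 : ℝ)) = volume := by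
  simp only [mv, ENNReal.ofReal_one]
  exact withDensity_one

theorem lip_dist {n : ℕ} (x : EX n) : LipschitzWith 1 (fun z => dist z x) := LipschitzWith.dist_left x

theorem sphere_le {n : ℕ} (hn : 1 ≤ n) : ∃ C : ℝ≥0, 0 < C ∧ ∀ (x : EX n) (r : ℝ), 0 ≤ r →
    μH[n] (sphere x r) ≤ C * ofReal (r ^ n) := by
  obtain ⟨C, hC, hT⟩ := T2c hn
  obtain ⟨r0, hr0, h⟩ := hT (fun _ => 1) measurable_const (fun _ => one_pos) _ (lip_dist (0 : EX n))
    univ .univ 1 2 one_lt_two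
  rw [mp_one, mv_one] at h
  have hfin : μH[n] (sphere (0 : EX n) r0) < ⊤ := by
    have e : univ ∩ (fun z : EX n => dist z 0) ⁻¹' {r0} = sphere 0 r0 := by
      ext z; simp
    rw [← e]
    refine h.trans_lt ?_
    refine ENNReal.div_lt_top (ENNReal.mul_ne_top ENNReal.coe_ne_top ?_) (by norm_num)
    refine ((measure_mono ?_).trans_lt (measure_ball_lt_top (x := (0 : EX n)) (r := 2))).ne
    rintro z ⟨-, hz⟩
    simpa using hz.2
  set M := μH[n] (sphere (0 : EX n) r0) with hM
  refine ⟨M.toNNReal + 1, by positivity, ?_⟩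
  intro x r hr
  have hr00 : 0 < r0 := by linarith [hr0.1]
  have hsub : sphere x r ⊆ (fun z : EX n => x + (r / r0) • z) '' (sphere 0 r0) := by
    intro z hz
    rcases hr.eq_or_lt with h0 | h0
    · subst h0
      have : z = x := by simpa using hz
      obtain ⟨w, hw⟩ := (NormedSpace.sphere_nonempty (x := (0 : EX n)) (r := r0)).2 hr00.le
      exact ⟨w, hw, by simp [this]⟩
    · refine ⟨(r0 / r) • (z - x), ?_, ?_⟩
      · rw [mem_sphere_iff_norm] at hz
        simp only [mem_sphere_iff_norm, sub_zero, norm_smul, hz, Real.norm_eq_abs]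
        rw [abs_of_pos (by positivity)]; field_simp
      · simp only [smul_smul]
        rw [show r / r0 * (r0 / r) = 1 by field_simp]; simp
  have hlip : LipschitzWith (r / r0).toNNReal (fun z : EX n => x + (r / r0) • z) := by
    refine LipschitzWith.of_dist_le_mul fun a b => ?_
    rw [dist_add_left, dist_smul₀, Real.coe_toNNReal _ (by positivity), Real.norm_eq_abs, abs_of_nonneg (by positivity)]
  have h3 := (measure_mono hsub).trans (hlip.hausdorffMeasure_image_le (d := (n : ℝ)) (by positivity) (sphere 0 r0))
  refine h3.trans ?_
  rw [← hM, ENNReal.rpow_natCast, mul_comm, ENNReal.coe_add, ENNReal.coe_toNNReal hfin.ne]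
  rw [← ENNReal.ofReal.eq_1, ← ENNReal.ofReal_pow (by positivity)]
  gcongr
  · exact le_self_add
  · exact div_le_self hr (by linarith [hr0.1])

theorem SUM {n : ℕ} (hn : 1 ≤ n) {ι : Type*} (v p : ι → ℝ≥0∞) (h : ∀ i, v i ^ n ≤ p i ^ (n + 1)) :
    (∑' i, v i) ^ n ≤ (∑' i, p i) ^ (n + 1) := by
  set P := ∑' i, p i
  have hn0 : (n : ℝ) ≠ 0 := by positivity
  have root : ∀ z : ℝ≥0∞, (z ^ ((n : ℝ)⁻¹)) ^ n = z := by
    intro z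
    rw [← ENNReal.rpow_natCast, ← ENNReal.rpow_mul, inv_mul_cancel₀ hn0, ENNReal.rpow_one]
  have h1 : ∀ i, v i ≤ p i * P ^ ((n : ℝ)⁻¹) := by
    intro i
    refine (ENNReal.pow_le_pow_left_iff (n := n) (by omega)).1 ?_
    rw [mul_pow, root]
    refine (h i).trans ?_
    rw [pow_succ]
    gcongr
    exact ENNReal.le_tsum i
  calc (∑' i, v i) ^ n ≤ (∑' i, p i * P ^ ((n : ℝ)⁻¹)) ^ n := by
        gcongr with i; exact h1 i
    _ = P ^ n * P := by rw [ENNReal.tsum_mul_right, mul_pow, root]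
    _ = _ := by rw [pow_succ]

theorem RIB (n : ℕ) : ∃ C : ℝ≥0, 0 < C ∧ ∀ (Ω : Set (EX n)) (x : EX n) (r : ℝ) (a b : ℝ≥0∞), 0 < r →
    MeasurableSet Ω → a * ofReal (r ^ (n + 1)) ≤ volume (Ω ∩ closedBall x r) →
    b * ofReal (r ^ (n + 1)) ≤ volume (closedBall x r \ Ω) →
    a * b * ofReal (r ^ n) ≤ C * μH[n] (frontier Ω ∩ closedBall x r) := by
  obtain ⟨C, hC, hR⟩ := RI n
  refine ⟨C, hC, ?_⟩
  intro Ω x r a b hr hΩ ha hb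
  have h := hR (closedBall x r) Ω x r hr (convex_closedBall x r) isClosed_closedBall.measurableSet
    subset_rfl hΩ
  have h2 := (mul_le_mul' ha hb).trans h
  have h0 : ofReal (r ^ (n + 2)) ≠ 0 := by
    simp only [ne_eq, ENNReal.ofReal_eq_zero, not_le]; positivity
  refine (ENNReal.mul_le_mul_iff_right h0 ENNReal.ofReal_ne_top).1 ?_
  calc _ = a * ofReal (r ^ (n + 1)) * (b * ofReal (r ^ (n + 1))) := by
        simp only [ENNReal.ofReal_pow hr.le]; ring
    _ ≤ _ := h2
    _ = _ := by ring

/-- A scale at which an open set of small volume has balanced density. -/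
theorem balanced {n : ℕ} (G : Set (EX n)) (hG : IsOpen G) {x : EX n} (hx : x ∈ G) {ρ : ℝ} (hρ : 0 < ρ)
    (hs : volume G < ofReal (ρ ^ (n + 1)) * bvol n / 2) :
    ∃ r, 0 < r ∧ r ≤ ρ ∧ bvol n / 2 ^ (n + 2) * ofReal (r ^ (n + 1)) ≤ volume (G ∩ closedBall x r) ∧
      bvol n / 2 ^ (n + 2) * ofReal (r ^ (n + 1)) ≤ volume (closedBall x r \ G) := by
  classical
  let P : ℕ → Prop := fun j => bvol n / 2 * ofReal ((ρ * (1 / 2) ^ j) ^ (n + 1)) ≤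
    volume (G ∩ closedBall x (ρ * (1 / 2) ^ j))
  have hex : ∃ j, P j := by
    obtain ⟨ε, hε, hball⟩ := Metric.isOpen_iff.1 hG x hx
    obtain ⟨j, hj⟩ := exists_pow_lt_of_lt_one (div_pos hε hρ) (by norm_num : (1 / 2 : ℝ) < 1)
    have hjl : ρ * (1 / 2) ^ j < ε := by rwa [lt_div_iff₀ hρ, mul_comm] at hj
    refine ⟨j, ?_⟩
    have : G ∩ closedBall x (ρ * (1 / 2) ^ j) = closedBall x (ρ * (1 / 2) ^ j) :=
      inter_eq_right.2 ((Metric.closedBall_subset_ball hjl).trans hball)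
    show _ ≤ _
    rw [this, vol_cball _ (by positivity), mul_comm]
    gcongr
    exact ENNReal.half_le_self
  have hj := Nat.find_spec hex
  have hmin := fun k => Nat.find_min hex (m := k)
  set j := Nat.find hex
  have hj0 : j ≠ 0 := by
    intro h0
    rw [h0] at hj
    have h1 : bvol n / 2 * ofReal (ρ ^ (n + 1)) ≤ volume G := by
      have : P 0 := hj
      simp only [P, pow_zero, mul_one] at this
      exact this.trans (measure_mono inter_subset_left)
    refine absurd hs (not_lt.2 (le_trans (le_of_eq ?_) h1))
    rw [mul_comm, ENNReal.mul_div_right_comm]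
  obtain ⟨i, hi⟩ := Nat.exists_eq_succ_of_ne_zero hj0
  have hPi := hmin i (by omega)
  set r := ρ * (1 / 2) ^ i with hr
  have hrj : ρ * (1 / 2) ^ j = r / 2 := by rw [hi, hr, pow_succ]; ring
  have hr0 : 0 < r := by positivity
  have hhalf : ofReal ((r / 2) ^ (n + 1)) = ofReal (r ^ (n + 1)) / 2 ^ (n + 1) := by
    rw [div_pow, ENNReal.ofReal_div_of_pos (by positivity), ENNReal.ofReal_pow zero_le_two, ENNReal.ofReal_ofNat]
  have hpowne : (2 : ℝ≥0∞) ^ (n + 1) ≠ 0 := by positivity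
  refine ⟨r, hr0, ?_, ?_, ?_⟩
  · exact mul_le_of_le_one_right hρ.le (pow_le_one₀ (by norm_num) (by norm_num))
  · have h1 : P j := hj
    simp only [P, hrj, hhalf] at h1
    calc _ = bvol n / 2 * (ofReal (r ^ (n + 1)) / 2 ^ (n + 1)) := by
          simp only [div_eq_mul_inv]
          rw [show (2 : ℝ≥0∞) ^ (n + 2) = 2 * 2 ^ (n + 1) by ring, ENNReal.mul_inv (by simp) (by simp)]
          ring
      _ ≤ _ := h1
      _ ≤ _ := measure_mono (inter_subset_inter_right _ (closedBall_subset_closedBall (by linarith)))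
  · have h2 : volume (G ∩ closedBall x r) ≤ bvol n / 2 * ofReal (r ^ (n + 1)) := (not_le.1 hPi).le
    have hsum := measure_inter_add_sdiff (μ := volume) (closedBall x r) hG.measurableSet
    rw [vol_cball x hr0.le, inter_comm] at hsum
    have h3 : bvol n / 2 * ofReal (r ^ (n + 1)) ≤ volume (closedBall x r \ G) := by
      have hfin : bvol n / 2 * ofReal (r ^ (n + 1)) ≠ ⊤ :=
        ENNReal.mul_ne_top (ENNReal.div_ne_top (bvol_ne_top n) two_ne_zero) ENNReal.ofReal_ne_top
      refine (ENNReal.add_le_add_iff_left hfin).1 ?_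
      rw [← add_mul, ENNReal.add_halves, mul_comm (bvol n), ← hsum]
      gcongr
    refine le_trans ?_ h3
    gcongr
    calc (2 : ℝ≥0∞) = 2 ^ 1 := by ring
      _ ≤ _ := pow_le_pow_right₀ one_le_two (by omega)

theorem ISO {n : ℕ} (hn : 1 ≤ n) : ∃ C : ℝ≥0, 0 < C ∧ ∀ (f : EX n → ℝ) (G : Set (EX n)) (ρ : ℝ) (κ : ℝ≥0),
    IsOpen G → 0 < ρ →
    volume G < ofReal (ρ ^ (n + 1)) * bvol n / 2 →
    (∀ x ∈ G, ∃ a b : ℝ, 0 ≤ a ∧ 0 ≤ b ∧ (∀ y ∈ closedBall x (5 * ρ), a ≤ f y ∧ f y ≤ b) ∧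
      b ^ n ≤ (κ * a) ^ (n + 1)) →
    mv f G ^ n ≤ (C * κ * mp f (frontier G)) ^ (n + 1) := by
  obtain ⟨C, hC, hR⟩ := RIB n
  have hb := bvol_ne_top n
  have hb0 := bvol_ne_zero n
  set c : ℝ≥0∞ := bvol n / 2 ^ (n + 2) * (bvol n / 2 ^ (n + 2)) with hc
  have hc0 : c ≠ 0 := by
    refine mul_ne_zero ?_ ?_ <;> exact ENNReal.div_ne_zero.2 ⟨hb0, by simp⟩
  have hct : c ≠ ⊤ := by
    refine ENNReal.mul_ne_top ?_ ?_ <;> exact ENNReal.div_ne_top hb (by positivity)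
  set D : ℝ≥0∞ := 5 ^ (n + 1) * bvol n + 1 with hD
  have hDt : D ≠ ⊤ := by
    rw [hD]
    exact ENNReal.add_ne_top.2 ⟨ENNReal.mul_ne_top (by simp) hb, by simp⟩
  have hMt : D * C / c ≠ ⊤ := ENNReal.div_ne_top (ENNReal.mul_ne_top hDt ENNReal.coe_ne_top) hc0
  refine ⟨(D * C / c).toNNReal + 1, by positivity, ?_⟩
  intro f G ρ κ hG hρ hs hab
  choose! r hr0 hrρ hr1 hr2 using fun x (hx : x ∈ G) => balanced G hG hx hρ hs
  choose! a b ha hb' hab1 hab2 using hab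
  obtain ⟨u, huG, hud, hucov⟩ := Vitali.exists_disjoint_subfamily_covering_enlargement_closedBall G id r ρ hrρ 5 (by norm_num)
  have hucount : u.Countable := by
    refine hud.countable_of_nonempty_interior fun x hx => ?_
    refine ⟨x, ?_⟩
    exact Metric.ball_subset_interior_closedBall (Metric.mem_ball_self (hr0 x (huG hx)))
  have : Countable u := hucount.to_subtype
  have hcovG : G ⊆ ⋃ x : u, closedBall x.1 (5 * r x.1) := by
    intro x hx
    obtain ⟨b, hb, hbs⟩ := hucov x hx
    exact mem_iUnion.2 ⟨⟨b, hb⟩, hbs (Metric.mem_closedBall_self (hr0 x hx).le)⟩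
  have h1 : mv f G ≤ ∑' x : u, mv f (closedBall x.1 (5 * r x.1)) :=
    (measure_mono hcovG).trans (measure_iUnion_le _)
  have h2 : ∑' x : u, mp f (frontier G ∩ closedBall x.1 (r x.1)) ≤ mp f (frontier G) := by
    rw [← measure_iUnion]
    · exact measure_mono (iUnion_subset fun x => inter_subset_left)
    · intro x y hxy
      refine Disjoint.mono inter_subset_right inter_subset_right ?_
      exact hud x.2 y.2 (fun h => hxy (Subtype.ext h))
    · intro x
      exact isClosed_frontier.measurableSet.inter isClosed_closedBall.measurableSet
  set Q : ℝ≥0∞ := ((D * C / c).toNNReal + 1 : ℝ≥0) * κ with hQ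
  have key : ∀ x : u, mv f (closedBall x.1 (5 * r x.1)) ^ n ≤
      (Q * mp f (frontier G ∩ closedBall x.1 (r x.1))) ^ (n + 1) := by
    rintro ⟨x, hx⟩
    have hxG := huG hx
    have hr0' := hr0 x hxG
    set R : ℝ≥0∞ := ofReal (r x) with hR'
    have e1 : mv f (closedBall x (5 * r x)) ≤ ofReal (b x) * (D * R ^ (n + 1)) := by
      refine (wd_le _ isClosed_closedBall.measurableSet (c := b x) fun y hy => ?_).trans ?_
      · exact (hab1 x hxG y (closedBall_subset_closedBall (by linarith [hrρ x hxG]) hy)).2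
      · rw [vol_cball _ (by positivity), mul_pow, ENNReal.ofReal_mul (by positivity), ENNReal.ofReal_pow (by norm_num),
          ENNReal.ofReal_pow hr0'.le, ENNReal.ofReal_ofNat]
        refine mul_le_mul_right ?_ _
        calc (5 : ℝ≥0∞) ^ (n + 1) * R ^ (n + 1) * bvol n = 5 ^ (n + 1) * bvol n * R ^ (n + 1) := by ring
          _ ≤ _ := by gcongr; exact le_self_add
    have e2 : c * R ^ n ≤ C * μH[n] (frontier G ∩ closedBall x (r x)) := by
      have := hR G x (r x) _ _ hr0' hG.measurableSet (hr1 x hxG) (hr2 x hxG)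
      rwa [ENNReal.ofReal_pow hr0'.le] at this
    have e3 : ofReal (a x) * μH[n] (frontier G ∩ closedBall x (r x)) ≤
        mp f (frontier G ∩ closedBall x (r x)) := by
      refine le_wd _ (isClosed_frontier.measurableSet.inter isClosed_closedBall.measurableSet) fun y hy => ?_
      exact (hab1 x hxG y (closedBall_subset_closedBall (by linarith [hrρ x hxG]) hy.2)).1
    have e4 : ofReal (b x) ^ n ≤ (κ * ofReal (a x)) ^ (n + 1) := by
      rw [← ENNReal.ofReal_pow (hb' x hxG), ← ENNReal.ofReal_coe_nnreal, ← ENNReal.ofReal_mul (by positivity),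
        ← ENNReal.ofReal_pow (mul_nonneg (by positivity) (ha x hxG))]
      exact ENNReal.ofReal_le_ofReal (hab2 x hxG)
    have e5 : R ^ n ≤ C / c * μH[n] (frontier G ∩ closedBall x (r x)) := by
      rw [ENNReal.mul_div_right_comm.symm, ENNReal.le_div_iff_mul_le (Or.inl hc0) (Or.inl hct), mul_comm]
      exact e2
    have hD1 : (1 : ℝ≥0∞) ≤ D := le_add_self
    have hQ' : κ * D * (C / c) ≤ Q := by
      rw [hQ, ENNReal.coe_add, ENNReal.coe_toNNReal hMt, mul_comm]
      calc (C : ℝ≥0∞) / c * (κ * D) = D * C / c * κ := by simp only [div_eq_mul_inv]; ring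
        _ ≤ _ := by gcongr; exact le_self_add
    calc _ ≤ (ofReal (b x) * (D * R ^ (n + 1))) ^ n := by gcongr
      _ = ofReal (b x) ^ n * D ^ n * (R ^ n) ^ (n + 1) := by ring
      _ ≤ (κ * ofReal (a x)) ^ (n + 1) * D ^ (n + 1) * (C / c * μH[n] (frontier G ∩ closedBall x (r x))) ^ (n + 1) := by
        gcongr
        omega
      _ = (κ * D * (C / c) * (ofReal (a x) * μH[n] (frontier G ∩ closedBall x (r x)))) ^ (n + 1) := by ring
      _ ≤ _ := by gcongr
  have h3 := SUM hn _ _ key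
  calc mv f G ^ n ≤ _ := by gcongr
    _ ≤ _ := h3
    _ ≤ _ := by
      rw [ENNReal.tsum_mul_left]
      gcongr



theorem ITER {n : ℕ} (hn : 1 ≤ n) (m : ℝ → ℝ) (hm0 : ∀ x, 0 ≤ m x) (hmono : Monotone m) {r K : ℝ} (hr : 0 < r) (hK : 0 < K)
    (h : ∀ ρ₁ ρ₂, r / 2 ≤ ρ₁ → ρ₁ < ρ₂ → ρ₂ ≤ r → m ρ₁ ^ n * (ρ₂ - ρ₁) ^ (n + 1) ≤ (K * m ρ₂) ^ (n + 1))
    (hM : 2 ^ (n * (n + 1)) * (4 * K) ^ (n + 1) * m r ≤ r ^ (n + 1)) : m (r / 2) = 0 := by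
  let ρ : ℕ → ℝ := fun j => r / 2 + r / 2 * (1 / 2) ^ j
  set θ : ℝ := (1 / 2) ^ (n + 1) with hθ
  have hθ0 : 0 < θ := by positivity
  have hclaim : ∀ j, m (ρ j) ≤ m r * θ ^ j := by
    intro j
    induction j with
    | zero => simp [ρ]
    | succ j ih =>
      have h1 : r / 2 ≤ ρ (j + 1) := by simp only [ρ]; have : 0 < r / 2 * (1 / 2) ^ (j + 1) := by positivity
                                        linarith
      have e : ρ j - ρ (j + 1) = r / 4 * (1 / 2) ^ j := by simp only [ρ, pow_succ]; ring
      have e0 : 0 < r / 4 * (1 / 2 : ℝ) ^ j := by positivity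
      have h3 : ρ j ≤ r := by
        have : (1 / 2 : ℝ) ^ j ≤ 1 := pow_le_one₀ (by norm_num) (by norm_num)
        simp only [ρ]; nlinarith
      have h4 := h _ _ h1 (by linarith) h3
      rw [e] at h4
      have h5 : (K * m (ρ j)) ^ (n + 1) ≤ (K * (m r * θ ^ j)) ^ (n + 1) := by
        have := hm0 (ρ j)
        gcongr
      have key : (K * (m r * θ ^ j)) ^ (n + 1) ≤ (m r * θ ^ (j + 1)) ^ n * (r / 4 * (1 / 2) ^ j) ^ (n + 1) := by
        have h6 : (4 : ℝ) ^ (n + 1) * (K * (m r * θ ^ j)) ^ (n + 1) ≤ (m r * θ ^ (j + 1)) ^ n * (r * (1 / 2) ^ j) ^ (n + 1) := by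
          have q1 : θ ^ j = ((1 / 2 : ℝ) ^ j) ^ (n + 1) := by rw [hθ, ← pow_mul, ← pow_mul, mul_comm]
          have q2 : θ ^ n * 2 ^ (n * (n + 1)) = 1 := by
            rw [hθ, ← pow_mul, mul_comm n (n + 1), ← mul_pow]; norm_num
          have q3 : θ ^ n * (2 ^ (n * (n + 1)) * (4 * K) ^ (n + 1) * m r) ≤ θ ^ n * r ^ (n + 1) := by gcongr
          have q4 : (4 * K) ^ (n + 1) * m r ≤ θ ^ n * r ^ (n + 1) := by
            calc _ = θ ^ n * 2 ^ (n * (n + 1)) * ((4 * K) ^ (n + 1) * m r) := by rw [q2, one_mul]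
              _ ≤ _ := by rw [← mul_assoc] at q3; convert q3 using 1; ring
          calc (4 : ℝ) ^ (n + 1) * (K * (m r * θ ^ j)) ^ (n + 1) = (m r ^ n * (θ ^ j) ^ n * θ ^ j) * ((4 * K) ^ (n + 1) * m r) := by
                rw [mul_pow K, mul_pow (m r), mul_pow 4, pow_succ (θ ^ j), pow_succ (m r)]; ring
            _ ≤ (m r ^ n * (θ ^ j) ^ n * θ ^ j) * (θ ^ n * r ^ (n + 1)) := by
                have := hm0 r
                gcongr
            _ = (m r * θ ^ (j + 1)) ^ n * (r ^ (n + 1) * θ ^ j) := by rw [pow_succ θ, mul_pow, mul_pow]; ring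
            _ = _ := by rw [mul_pow r, ← q1]
        have h7 : (4 : ℝ) ^ (n + 1) * (r / 4 * (1 / 2) ^ j) ^ (n + 1) = (r * (1 / 2) ^ j) ^ (n + 1) := by
          rw [← mul_pow]; congr 1; ring
        have h8 : (0 : ℝ) < 4 ^ (n + 1) := by positivity
        refine le_of_mul_le_mul_left ?_ h8
        refine h6.trans (le_of_eq ?_)
        rw [← h7]; ring
      have h9 := h4.trans (h5.trans key)
      have h10 := le_of_mul_le_mul_right h9 (by positivity)
      exact (pow_le_pow_iff_left₀ (hm0 _) (mul_nonneg (hm0 _) (by positivity)) (by omega)).1 h10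
  have hlim : Tendsto (fun j => m r * θ ^ j) atTop (𝓝 0) := by
    have hθ1 : θ < 1 := pow_lt_one₀ (by norm_num) (by norm_num) (by omega)
    simpa using (tendsto_pow_atTop_nhds_zero_of_lt_one hθ0.le hθ1).const_mul (m r)
  refine le_antisymm (ge_of_tendsto' hlim fun j => ?_) (hm0 _)
  refine (hmono ?_).trans (hclaim j)
  have : 0 < r / 2 * (1 / 2 : ℝ) ^ j := by positivity
  simp only [ρ]; linarith

theorem frontier_inter_int {Y : Type*} [TopologicalSpace Y] (G K : Set Y) :
    frontier (G ∩ interior K) ⊆ (frontier G ∩ interior K) ∪ (closure G ∩ frontier K) := by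
  intro z hz
  rcases frontier_inter_subset _ _ hz with ⟨h1, h2⟩ | ⟨h1, h2⟩
  · by_cases h : z ∈ interior K
    · exact Or.inl ⟨h1, h⟩
    · exact Or.inr ⟨h1.1, closure_mono interior_subset h2, h⟩
  · exact Or.inr ⟨h1, frontier_interior_subset h2⟩

theorem frontier_swap {n : ℕ} {G K : Set (EX n)} (hG : IsOpen G) (hK : IsClosed K) (y : EX n) {ϱ : ℝ} (hϱ : 0 < ϱ)
    (hd : Disjoint (closedBall y ϱ) K) :
    frontier ((G \ K) ∪ ball y ϱ) ⊆ (frontier G \ (interior K ∪ ball y ϱ)) ∪ (closure G ∩ frontier K) ∪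
      (sphere y ϱ \ closure G) := by
  intro z hz
  have hGK : IsOpen (G \ K) := hG.sdiff hK
  rcases frontier_union_subset _ _ hz with ⟨h1, h2⟩ | ⟨h1, h2⟩
  · rw [isOpen_ball.isClosed_compl.closure_eq] at h2
    rw [sdiff_eq] at h1
    rcases frontier_inter_subset _ _ h1 with ⟨h3, h4⟩ | ⟨h3, h4⟩
    · rw [closure_compl] at h4
      refine Or.inl (Or.inl ⟨h3, ?_⟩)
      rintro (h | h)
      · exact h4 h
      · exact h2 h
    · rw [frontier_compl] at h4
      exact Or.inl (Or.inr ⟨h3, h4⟩)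
  · rw [hGK.isClosed_compl.closure_eq] at h1
    rw [frontier_ball y hϱ.ne'] at h2
    have hzK : z ∉ K := fun h => Set.disjoint_left.1 hd (Metric.sphere_subset_closedBall h2) h
    have hzG : z ∉ G := fun h => h1 ⟨h, hzK⟩
    by_cases hc : z ∈ closure G
    · refine Or.inl (Or.inl ⟨⟨hc, ?_⟩, ?_⟩)
      · rwa [hG.interior_eq]
      · rintro (h | h)
        · exact hzK (interior_subset h)
        · rw [mem_ball] at h; rw [Metric.mem_sphere] at h2; linarith
    · exact Or.inr ⟨h2, hc⟩

theorem radial_lip {n : ℕ} (y : EX n) {R t : ℝ} (ht : 0 < t) (hR : 0 < R) :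
    LipschitzOnWith (R / t).toNNReal (fun z => y + (R / ‖z - y‖) • (z - y)) {z | t ≤ ‖z - y‖} := by
  refine LipschitzOnWith.of_dist_le_mul fun a ha b hb => ?_
  rw [dist_add_left, Real.coe_toNNReal _ (by positivity)]
  set p := a - y
  set q := b - y
  have hp : t ≤ ‖p‖ := ha
  have hq : t ≤ ‖q‖ := hb
  have hp0 : 0 < ‖p‖ := ht.trans_le hp
  have hq0 : 0 < ‖q‖ := ht.trans_le hq
  have hab : dist a b = ‖p - q‖ := by rw [dist_eq_norm]; congr 1; simp [p, q]
  rw [hab, dist_eq_norm]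
  refine abs_le_of_sq_le_sq' ?_ (by positivity) |>.2
  have e1 : ‖(R / ‖p‖) • p - (R / ‖q‖) • q‖ ^ 2 = R ^ 2 * (2 - 2 * inner ℝ p q / (‖p‖ * ‖q‖)) := by
    rw [norm_sub_sq_real, inner_smul_left, inner_smul_right, norm_smul, norm_smul]
    simp only [Real.norm_eq_abs, abs_of_pos (div_pos hR hp0), abs_of_pos (div_pos hR hq0)]
    simp
    field_simp
    ring
  have e2 : ‖p - q‖ ^ 2 = ‖p‖ ^ 2 - 2 * inner ℝ p q + ‖q‖ ^ 2 := norm_sub_sq_real p q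
  rw [e1, mul_pow, div_pow, e2]
  have hcs := real_inner_le_norm p q
  have h1 : 0 ≤ 2 - 2 * inner ℝ p q / (‖p‖ * ‖q‖) := by
    have : inner ℝ p q / (‖p‖ * ‖q‖) ≤ 1 := by rw [div_le_one (by positivity)]; exact hcs
    rw [mul_div_assoc]; linarith
  have h2 : t ^ 2 * (2 - 2 * inner ℝ p q / (‖p‖ * ‖q‖)) ≤ ‖p‖ ^ 2 - 2 * inner ℝ p q + ‖q‖ ^ 2 := by
    calc t ^ 2 * (2 - 2 * inner ℝ p q / (‖p‖ * ‖q‖)) ≤ (‖p‖ * ‖q‖) * (2 - 2 * inner ℝ p q / (‖p‖ * ‖q‖)) := by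
          refine mul_le_mul_of_nonneg_right ?_ h1
          rw [sq]; gcongr
      _ = 2 * (‖p‖ * ‖q‖) - 2 * inner ℝ p q := by field_simp
      _ ≤ _ := by nlinarith [sq_nonneg (‖p‖ - ‖q‖)]
  calc R ^ 2 * (2 - 2 * inner ℝ p q / (‖p‖ * ‖q‖)) = R ^ 2 / t ^ 2 * (t ^ 2 * (2 - 2 * inner ℝ p q / (‖p‖ * ‖q‖))) := by
        field_simp
    _ ≤ _ := by gcongr

theorem one_add_pow_le (n : ℕ) {s : ℝ} (h0 : 0 ≤ s) (h1 : s ≤ 1) : (1 + s) ^ n ≤ 1 + (2 ^ n - 1) * s := by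
  induction n with
  | zero => simp
  | succ n ih =>
    have h2 : (1 : ℝ) ≤ 2 ^ n := one_le_pow₀ (by norm_num)
    calc (1 + s) ^ (n + 1) = (1 + s) ^ n * (1 + s) := pow_succ _ _
      _ ≤ (1 + (2 ^ n - 1) * s) * (1 + s) := by gcongr
      _ = 1 + 2 ^ n * s + (2 ^ n - 1) * s * s := by ring
      _ ≤ 1 + 2 ^ n * s + (2 ^ n - 1) * s * 1 := by
        have : 0 ≤ (2 ^ n - 1) * s := mul_nonneg (by linarith) h0
        gcongr
      _ = _ := by ring

theorem RAD {n : ℕ} (hn : 1 ≤ n) : ∃ C : ℝ≥0, 0 < C ∧ ∀ (G : Set (EX n)) (y : EX n) (R : ℝ), 0 < R → IsOpen G →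
    μH[n] (sphere y R ∩ G) ≤ μH[n] (frontier G ∩ ball y R) +
      C * volume (G ∩ ball y R) / ofReal R := by
  obtain ⟨C, hC, hT⟩ := T2c hn
  refine ⟨2 ^ (n + 4) * C, by positivity, ?_⟩
  intro G y R hR hG
  have hT' := hT (fun _ => 1) measurable_const (fun _ => one_pos) _ (lip_dist y) G hG.measurableSet
  rw [mp_one, mv_one] at hT'
  let a : ℕ → ℝ := fun j => (1 - (1 / 2) ^ (j + 1)) * R
  have haa : ∀ j, a j < a (j + 1) := by
    intro j
    simp only [a]
    have : (0 : ℝ) < (1 / 2) ^ (j + 1) := by positivity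
    rw [pow_succ _ (j + 1)]; nlinarith
  choose t ht htb using fun j => hT' (a j) (a (j + 1)) (haa j)
  have hdiff : ∀ j, a (j + 1) - a j = (1 / 2) ^ (j + 2) * R := by
    intro j; simp only [a]; ring
  have ht0 : ∀ j, R / 2 < t j := by
    intro j
    refine lt_of_le_of_lt ?_ (ht j).1
    have : (1 / 2 : ℝ) ^ (j + 1) ≤ (1 / 2) ^ 1 := pow_le_pow_of_le_one (by norm_num) (by norm_num) (by omega)
    simp only [a]; nlinarith
  have htR : ∀ j, t j < R := by
    intro j
    refine (ht j).2.trans_le ?_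
    have : (0 : ℝ) < (1 / 2) ^ (j + 1 + 1) := by positivity
    simp only [a]; nlinarith
  have htmono : ∀ j, t j < t (j + 1) := fun j => (ht j).2.trans (ht (j + 1)).1
  have htsm : StrictMono t := strictMono_nat_of_lt_succ htmono
  have hLim : Tendsto t atTop (𝓝 R) := by
    have h1 : Tendsto a atTop (𝓝 R) := by
      have := (tendsto_pow_atTop_nhds_zero_of_lt_one (by norm_num : (0 : ℝ) ≤ 1 / 2) (by norm_num)).comp (tendsto_add_atTop_nat 1)
      have h2 := (this.const_sub 1).mul_const R
      simpa [a] using h2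
    exact tendsto_of_tendsto_of_tendsto_of_le_of_le h1 tendsto_const_nhds (fun j => (ht j).1.le) (fun j => (htR j).le)
  let π : EX n → EX n := fun z => y + (R / ‖z - y‖) • (z - y)
  -- points on rays
  let ray : EX n → ℝ → EX n := fun ω s => y + (s / R) • (ω - y)
  have hraynorm : ∀ ω ∈ sphere y R, ∀ s, 0 ≤ s → ‖ray ω s - y‖ = s := by
    intro ω hω s hs
    rw [mem_sphere_iff_norm] at hω
    simp only [ray, add_sub_cancel_left, norm_smul, hω, Real.norm_eq_abs]
    rw [abs_of_nonneg (by positivity)]; field_simp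
  have hπray : ∀ ω ∈ sphere y R, ∀ s, 0 < s → π (ray ω s) = ω := by
    intro ω hω s hs
    simp only [π, hraynorm ω hω s hs.le]
    simp only [ray, add_sub_cancel_left, smul_smul]
    rw [show R / s * (s / R) = 1 by field_simp]; simp
  have hrayc : ∀ ω, Continuous (ray ω) := fun ω => by fun_prop
  have hrayR : ∀ ω, ray ω R = ω := fun ω => by simp [ray, hR.ne']
  let g : ℕ → ℝ≥0∞ := fun j => μH[n] (G ∩ sphere y (t j))
  let L : ℕ → Set (EX n) := fun j => frontier G ∩ {z | dist z y ∈ Ico (t j) (t (j + 1))}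
  let A : ℕ → Set (EX n) := fun j => G ∩ (fun z => dist z y) ⁻¹' (Ioo (a j) (a (j + 1)))
  have hg : ∀ j, g j ≤ C * 2 ^ (j + 2) * volume (A j) / ofReal R := by
    intro j
    have h := htb j
    rw [hdiff] at h
    have e : (G ∩ (fun z => dist z y) ⁻¹' {t j}) = G ∩ sphere y (t j) := rfl
    rw [e] at h
    refine h.trans (le_of_eq ?_)
    rw [ENNReal.ofReal_mul (by positivity), ENNReal.ofReal_pow (by positivity)]
    rw [show (1 / 2 : ℝ) = 2⁻¹ by norm_num, ENNReal.ofReal_inv_of_pos two_pos, ENNReal.ofReal_ofNat]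
    simp only [div_eq_mul_inv]
    rw [ENNReal.mul_inv (Or.inr ENNReal.ofReal_ne_top) (Or.inr (by simpa using hR)), ← ENNReal.inv_pow, inv_inv]
    ring
  -- the good index
  have hgood : ∀ ω ∈ sphere y R ∩ G, ∃ j, ∀ s ∈ Icc (t j) R, ray ω s ∈ G := by
    rintro ω ⟨hω, hωG⟩
    have hpre : (ray ω) ⁻¹' G ∈ 𝓝 R := (hrayc ω).continuousAt.preimage_mem_nhds (by rw [hrayR]; exact hG.mem_nhds hωG)
    obtain ⟨ε, hε, hb⟩ := Metric.mem_nhds_iff.1 hpre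
    obtain ⟨j, hj⟩ := (hLim.eventually (lt_mem_nhds (show R - ε < R by linarith))).exists
    refine ⟨j, fun s hs => hb ?_⟩
    rw [mem_ball, Real.dist_eq, abs_lt]; constructor <;> linarith [hs.1, hs.2]
  have hcover : sphere y R ∩ G ⊆ π '' (G ∩ sphere y (t 0)) ∪
      ⋃ j, (π '' (G ∩ sphere y (t (j + 1))) ∩ π '' (L j)) := by
    classical
    intro ω hω
    have hex := hgood ω hω
    have hspec := Nat.find_spec hex
    have hmin := fun k => Nat.find_min hex (m := k)
    set j := Nat.find hex
    have hin : ω ∈ π '' (G ∩ sphere y (t j)) := by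
      have htj : 0 < t j := by linarith [ht0 j]
      refine ⟨ray ω (t j), ⟨hspec _ ⟨le_rfl, (htR j).le⟩, ?_⟩, hπray ω hω.1 _ htj⟩
      rw [mem_sphere_iff_norm]; exact hraynorm ω hω.1 _ htj.le
    rcases Nat.eq_zero_or_eq_succ_pred j with h0 | h0
    · rw [h0] at hin; exact Or.inl hin
    · set i := j.pred
      rw [h0] at hin hspec
      refine Or.inr (mem_iUnion.2 ⟨i, hin, ?_⟩)
      have hi := hmin i (by omega)
      push Not at hi
      obtain ⟨s0, hs0, hs0G⟩ := hi
      obtain ⟨z, ⟨s, hs, rfl⟩, hzf⟩ := preconn_frontier (isPreconnected_Icc.image (ray ω) (hrayc ω).continuousOn) G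
        (a := ray ω R) (b := ray ω s0) ⟨R, ⟨(htR i).le, le_rfl⟩, rfl⟩ ⟨s0, hs0, rfl⟩ (by rw [hrayR]; exact hω.2) hs0G
      have hs00 : 0 < s := by linarith [ht0 i, hs.1]
      have hns : s < t (i + 1) := by
        by_contra hcon
        have := hspec s ⟨not_lt.1 hcon, hs.2⟩
        exact hzf.2 (by rwa [hG.interior_eq])
      refine ⟨ray ω s, ⟨hzf, ?_⟩, hπray ω hω.1 _ hs00⟩
      show dist (ray ω s) y ∈ Ico (t i) (t (i + 1))
      rw [dist_eq_norm, hraynorm ω hω.1 _ hs00.le]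
      exact ⟨hs.1, hns⟩
  have hπim : ∀ (i : ℕ) (S : Set (EX n)), (∀ z ∈ S, t i ≤ ‖z - y‖) →
      μH[n] (π '' S) ≤ ofReal (1 + 2 ^ n * (1 / 2) ^ i) * μH[n] S := by
    intro i S hS
    have hti : 0 < t i := by linarith [ht0 i]
    have h1 := ((radial_lip y hti hR).mono hS).hausdorffMeasure_image_le (d := (n : ℝ)) (by positivity)
    refine h1.trans ?_
    gcongr
    rw [ENNReal.rpow_natCast, ← ENNReal.ofReal.eq_1, ← ENNReal.ofReal_pow (by positivity)]
    refine ENNReal.ofReal_le_ofReal ?_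
    set x : ℝ := (1 / 2) ^ (i + 1) with hx
    have hx0 : 0 < x := by positivity
    have hx1 : x ≤ 1 / 2 := by
      have : (1 / 2 : ℝ) ^ (i + 1) ≤ (1 / 2) ^ 1 := pow_le_pow_of_le_one (by norm_num) (by norm_num) (by omega)
      rw [pow_one] at this; exact this
    have h2 : R / t i ≤ 1 + 2 * x := by
      rw [div_le_iff₀ hti]
      have h3 : (1 - x) * R < t i := (ht i).1
      have h4 : 1 ≤ (1 + 2 * x) * (1 - x) := by nlinarith
      calc R = 1 * R := by ring
        _ ≤ (1 + 2 * x) * (1 - x) * R := by gcongr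
        _ = (1 + 2 * x) * ((1 - x) * R) := by ring
        _ ≤ _ := by gcongr
    calc (R / t i) ^ n ≤ (1 + 2 * x) ^ n := by gcongr
      _ ≤ 1 + (2 ^ n - 1) * (2 * x) := one_add_pow_le n (by positivity) (by linarith)
      _ ≤ 1 + 2 ^ n * (2 * x) := by gcongr; linarith
      _ = _ := by rw [hx, pow_succ]; ring
  have hD0 : μH[n] (π '' (G ∩ sphere y (t 0))) ≤ 2 ^ (n + 4) * C * volume (A 0) / ofReal R := by
    refine (hπim 0 _ fun z hz => ?_).trans ?_
    · exact (mem_sphere_iff_norm.1 hz.2).ge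
    · refine (mul_le_mul_right (hg 0) _).trans ?_
      rw [← mul_div_assoc]
      refine ENNReal.div_le_div_right ?_ _
      rw [← mul_assoc]
      refine mul_le_mul_left ?_ _
      have : ofReal (1 + 2 ^ n * (1 / 2) ^ 0) ≤ 2 ^ (n + 1) := by
        rw [show (2 : ℝ≥0∞) ^ (n + 1) = ofReal (2 ^ (n + 1)) by
          rw [ENNReal.ofReal_pow zero_le_two, ENNReal.ofReal_ofNat]]
        refine ENNReal.ofReal_le_ofReal ?_
        have h2 : (1 : ℝ) ≤ 2 ^ n := one_le_pow₀ (by norm_num)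
        rw [pow_succ]; simp; linarith
      calc _ ≤ 2 ^ (n + 1) * (C * 2 ^ (0 + 2) : ℝ≥0∞) := by gcongr
        _ = 2 ^ (n + 3) * C := by ring
        _ ≤ _ := by gcongr; exact one_le_two; omega
  have hDj : ∀ j, μH[n] (π '' (G ∩ sphere y (t (j + 1))) ∩ π '' (L j)) ≤
      μH[n] (L j) + 2 ^ (n + 4) * C * volume (A (j + 1)) / ofReal R := by
    intro j
    have b1 : μH[n] (π '' (G ∩ sphere y (t (j + 1))) ∩ π '' (L j)) ≤ ofReal (1 + 2 ^ n * (1 / 2) ^ j) * min (μH[n] (L j)) (g (j + 1)) := by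
      rcases min_choice (μH[n] (L j)) (g (j + 1)) with h | h <;> rw [h]
      · refine (measure_mono inter_subset_right).trans (hπim j _ fun z hz => ?_)
        have := hz.2.1; rwa [dist_eq_norm] at this
      · refine (measure_mono inter_subset_left).trans (hπim j _ fun z hz => ?_)
        rw [mem_sphere_iff_norm.1 hz.2]; exact (htmono j).le
    refine b1.trans ?_
    rw [ENNReal.ofReal_add (by norm_num) (by positivity), add_mul, ENNReal.ofReal_one, one_mul]
    refine add_le_add (min_le_left _ _) ?_
    refine (mul_le_mul_right ((min_le_right _ _).trans (hg (j + 1))) _).trans ?_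
    rw [← mul_div_assoc]
    refine ENNReal.div_le_div_right ?_ _
    rw [← mul_assoc]
    refine mul_le_mul_left ?_ _
    rw [ENNReal.ofReal_mul (by positivity), ENNReal.ofReal_pow zero_le_two, ENNReal.ofReal_ofNat, ENNReal.ofReal_pow (by positivity),
      show (1 / 2 : ℝ) = 2⁻¹ by norm_num, ENNReal.ofReal_inv_of_pos two_pos, ENNReal.ofReal_ofNat]
    have : (2 : ℝ≥0∞)⁻¹ ^ j * 2 ^ j = 1 := by rw [← mul_pow, ENNReal.inv_mul_cancel two_ne_zero (by simp), one_pow]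
    calc (2 : ℝ≥0∞) ^ n * 2⁻¹ ^ j * (C * 2 ^ (j + 1 + 2)) = 2 ^ n * 8 * C * (2⁻¹ ^ j * 2 ^ j) := by ring
      _ = 2 ^ (n + 3) * C := by rw [this]; ring
      _ ≤ _ := by gcongr; exact one_le_two; omega
  have hLd : ∑' j, μH[n] (L j) ≤ μH[n] (frontier G ∩ ball y R) := by
    rw [← measure_iUnion]
    · refine measure_mono (iUnion_subset fun j z hz => ⟨hz.1, ?_⟩)
      exact mem_ball.2 (hz.2.2.trans (htR _))
    · have : Pairwise (Function.onFun Disjoint fun j => Ico (t j) (t (j + 1))) := by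
        simpa using htsm.monotone.pairwise_disjoint_on_Ico_succ
      intro i j hij
      have h1 := this hij
      refine Disjoint.mono inter_subset_right inter_subset_right ?_
      exact Disjoint.preimage (fun z => dist z y) h1
    · intro j
      refine isClosed_frontier.measurableSet.inter ?_
      exact (measurable_id.dist measurable_const) measurableSet_Ico
  have hAd : ∑' j, volume (A j) ≤ volume (G ∩ ball y R) := by
    rw [← measure_iUnion]
    · refine measure_mono (iUnion_subset fun j z hz => ⟨hz.1, ?_⟩)
      refine mem_ball.2 (hz.2.2.trans ?_)
      exact (ht (j + 1)).1.trans (htR _)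
    · have : Pairwise (Function.onFun Disjoint fun j => Ioo (a j) (a (j + 1))) := by
        simpa using (strictMono_nat_of_lt_succ haa).monotone.pairwise_disjoint_on_Ioo_succ
      intro i j hij
      have h1 := this hij
      refine Disjoint.mono inter_subset_right inter_subset_right ?_
      exact Disjoint.preimage (fun z => dist z y) h1
    · intro j
      exact hG.measurableSet.inter ((measurable_id.dist measurable_const) measurableSet_Ioo)
  refine (measure_mono hcover).trans ((measure_union_le _ _).trans ?_)
  refine (add_le_add hD0 ((measure_iUnion_le _).trans (ENNReal.tsum_le_tsum hDj))).trans ?_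
  rw [ENNReal.tsum_add, add_left_comm]
  refine add_le_add hLd ?_
  simp only [div_eq_mul_inv]
  have e := tsum_eq_zero_add' (ENNReal.summable (f := fun j => 2 ^ (n + 4) * (C : ℝ≥0∞) * volume (A (j + 1)) * (ofReal R)⁻¹))
    (f := fun j => 2 ^ (n + 4) * (C : ℝ≥0∞) * volume (A j) * (ofReal R)⁻¹)
  rw [← e, ENNReal.tsum_mul_right, ENNReal.tsum_mul_left]
  push_cast
  gcongr



theorem FIXA {n : ℕ} (hn : 1 ≤ n) : ∃ C : ℝ≥0, 0 < C ∧ ∀ (f : EX n → ℝ) (G : Set (EX n)) (y : EX n) (ϱ c₀ l : ℝ),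
    0 < ϱ → 0 < c₀ → 0 ≤ l → l ≤ 1 → IsOpen G →
    (∀ z ∈ closedBall y ϱ, f z ≤ (1 + l) * c₀ ∧ c₀ ≤ (1 + l) * f z) →
    mp f (sphere y ϱ \ closure G) ≤ mp f (frontier G ∩ ball y ϱ) +
      (C * mv f (ball y ϱ \ G) / ofReal ϱ + C * ofReal (l * c₀ * ϱ ^ n)) := by
  obtain ⟨C1, hC1, hR⟩ := RAD hn
  obtain ⟨C2, hC2, hS⟩ := sphere_le hn
  refine ⟨4 * C1 + 6 * C2, by positivity, ?_⟩
  intro f G y ϱ c₀ l hϱ hc hl hl1 hG hf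
  set X := mp f (sphere y ϱ \ closure G) with hX
  set Y := mp f (frontier G ∩ ball y ϱ) with hY
  rcases le_total X Y with h | hYX
  · exact h.trans le_self_add
  have hmS : MeasurableSet (sphere y ϱ \ closure G) := MeasurableSet.diff Metric.isClosed_sphere.measurableSet isClosed_closure.measurableSet
  have hmB : MeasurableSet (ball y ϱ \ G) := MeasurableSet.diff isOpen_ball.measurableSet hG.measurableSet
  have hmF : MeasurableSet (frontier G ∩ ball y ϱ) := isClosed_frontier.measurableSet.inter isOpen_ball.measurableSet
  have h1 : X ≤ ofReal ((1 + l) * c₀) * μH[n] (sphere y ϱ \ closure G) :=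
    wd_le _ hmS fun z hz => (hf z (Metric.sphere_subset_closedBall hz.1)).1
  have h2 : μH[n] (sphere y ϱ \ closure G) ≤ μH[n] (frontier G ∩ ball y ϱ) +
      C1 * volume (ball y ϱ \ G) / ofReal ϱ := by
    have := hR (closure G)ᶜ y ϱ hϱ isClosed_closure.isOpen_compl
    rw [← Set.sdiff_eq] at this
    refine this.trans (add_le_add (measure_mono ?_) ?_)
    · rw [frontier_compl]
      exact inter_subset_inter_left _ frontier_closure_subset
    · refine ENNReal.div_le_div_right (mul_le_mul_right (measure_mono ?_) _) _
      rw [inter_comm, ← Set.sdiff_eq]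
      exact sdiff_subset_sdiff_right subset_closure
  have h3 : ofReal c₀ * μH[n] (frontier G ∩ ball y ϱ) ≤ ofReal (1 + l) * Y := by
    have := le_wd (f := f) μH[n] hmF (c := c₀ / (1 + l)) fun z hz => by
      rw [div_le_iff₀ (by positivity), mul_comm]; exact (hf z (ball_subset_closedBall hz.2)).2
    calc _ = ofReal (1 + l) * (ofReal (c₀ / (1 + l)) * μH[n] (frontier G ∩ ball y ϱ)) := by
          rw [← mul_assoc, ← ENNReal.ofReal_mul (by positivity), mul_div_cancel₀ _ (by positivity)]
      _ ≤ _ := by gcongr; exact this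
  have h4 : ofReal c₀ * volume (ball y ϱ \ G) ≤ ofReal (1 + l) * mv f (ball y ϱ \ G) := by
    have := le_wd (f := f) volume hmB (c := c₀ / (1 + l)) fun z hz => by
      rw [div_le_iff₀ (by positivity), mul_comm]; exact (hf z (ball_subset_closedBall hz.1)).2
    calc _ = ofReal (1 + l) * (ofReal (c₀ / (1 + l)) * volume (ball y ϱ \ G)) := by
          rw [← mul_assoc, ← ENNReal.ofReal_mul (by positivity), mul_div_cancel₀ _ (by positivity)]
      _ ≤ _ := by gcongr; exact this
  have h5 : ofReal ((1 + l) ^ 2) ≤ 1 + 3 * ofReal l := by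
    rw [show (1 + 3 * ofReal l) = ofReal (1 + 3 * l) by
      rw [ENNReal.ofReal_add (by norm_num) (by positivity), ENNReal.ofReal_mul (by norm_num)]; simp]
    exact ENNReal.ofReal_le_ofReal (by nlinarith)
  have h6 : ofReal ((1 + l) ^ 2) ≤ 4 := by
    rw [← ENNReal.ofReal_ofNat]
    exact ENNReal.ofReal_le_ofReal (by nlinarith)
  have h7 : Y ≤ ofReal (2 * c₀) * (C2 * ofReal (ϱ ^ n)) := by
    refine hYX.trans (h1.trans ?_)
    refine mul_le_mul' (ENNReal.ofReal_le_ofReal (by nlinarith)) ((measure_mono sdiff_subset).trans (hS y ϱ hϱ.le))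
  calc X ≤ ofReal ((1 + l) * c₀) * (μH[n] (frontier G ∩ ball y ϱ) +
      C1 * volume (ball y ϱ \ G) / ofReal ϱ) := h1.trans (mul_le_mul_right h2 _)
    _ = ofReal (1 + l) * (ofReal c₀ * μH[n] (frontier G ∩ ball y ϱ)) +
      ofReal (1 + l) * C1 * (ofReal c₀ * volume (ball y ϱ \ G)) / ofReal ϱ := by
        rw [ENNReal.ofReal_mul (by positivity)]; simp only [div_eq_mul_inv]; ring
    _ ≤ ofReal (1 + l) * (ofReal (1 + l) * Y) +
      ofReal (1 + l) * C1 * (ofReal (1 + l) * mv f (ball y ϱ \ G)) / ofReal ϱ := by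
        gcongr
    _ = ofReal ((1 + l) ^ 2) * Y + ofReal ((1 + l) ^ 2) * C1 * mv f (ball y ϱ \ G) / ofReal ϱ := by
        rw [ENNReal.ofReal_pow (by positivity)]; simp only [div_eq_mul_inv]; ring
    _ ≤ (1 + 3 * ofReal l) * Y + 4 * C1 * mv f (ball y ϱ \ G) / ofReal ϱ := by gcongr
    _ ≤ Y + (4 * C1 * mv f (ball y ϱ \ G) / ofReal ϱ + 6 * C2 * ofReal (l * c₀ * ϱ ^ n)) := by
        rw [add_mul, one_mul, add_assoc]
        refine add_le_add le_rfl ?_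
        rw [add_comm]
        refine add_le_add le_rfl ?_
        refine (mul_le_mul_right h7 _).trans (le_of_eq ?_)
        rw [ENNReal.ofReal_mul (p := 2) (by norm_num), ENNReal.ofReal_mul (p := l * c₀) (by positivity), ENNReal.ofReal_mul hl, ENNReal.ofReal_ofNat]
        ring
    _ ≤ _ := by
        push_cast
        gcongr
        · exact le_self_add
        · exact le_add_self

theorem DENS {n : ℕ} {F : Set (EX n)} (hF : MeasurableSet F) {w : EX n} {R : ℝ} (h : volume (F ∩ ball w R) ≠ 0) :
    ∃ a ∈ ball w R, ∀ δ : ℝ, 0 < δ → ∃ ϱ₀ : ℝ, 0 < ϱ₀ ∧ ∀ ϱ, 0 < ϱ → ϱ < ϱ₀ →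
      volume (closedBall a ϱ \ F) ≤ ofReal (δ * ϱ ^ (n + 1)) := by
  have hae := Besicovitch.ae_tendsto_measure_inter_div_of_measurableSet (volume : Measure (EX n)) hF
  have : ∃ a ∈ F ∩ ball w R, Tendsto (fun r => volume (F ∩ closedBall a r) / volume (closedBall a r)) (𝓝[>] 0) (𝓝 (F.indicator 1 a)) := by
    by_contra hcon
    push Not at hcon
    refine h (measure_mono_null (fun a ha => ?_) (ae_iff.1 hae))
    exact hcon a ha
  obtain ⟨a, ⟨haF, haB⟩, ha⟩ := this
  refine ⟨a, haB, fun δ hδ => ?_⟩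
  rw [indicator_of_mem haF, Pi.one_apply] at ha
  set b := bvol n
  set δ' : ℝ≥0∞ := ofReal δ / b
  have hb0 := bvol_ne_zero n
  have hbt := bvol_ne_top n
  have hδ' : δ' ≠ 0 := by simp only [δ']; exact (ENNReal.div_pos (by simpa using hδ) hbt).ne'
  have hev := ha.eventually (lt_mem_nhds (show 1 - δ' < 1 from ENNReal.sub_lt_self (by simp) (by simp) hδ'))
  rw [eventually_nhdsWithin_iff, Metric.eventually_nhds_iff] at hev
  obtain ⟨ϱ₀, hϱ₀, hev⟩ := hev
  refine ⟨ϱ₀, hϱ₀, fun ϱ h0 h1 => ?_⟩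
  have h2 := hev (y := ϱ) (by rw [Real.dist_eq, sub_zero, abs_of_pos h0]; exact h1) h0
  have hv0 : volume (closedBall a ϱ) ≠ 0 := (Metric.measure_closedBall_pos _ _ h0).ne'
  have hvt : volume (closedBall a ϱ) ≠ ⊤ := measure_closedBall_lt_top.ne
  rw [ENNReal.lt_div_iff_mul_lt (Or.inl hv0) (Or.inl hvt)] at h2
  have h3 := measure_inter_add_sdiff (μ := volume) (closedBall a ϱ) hF
  rw [inter_comm] at h3
  have h4 : volume (F ∩ closedBall a ϱ) ≠ ⊤ := ne_top_of_le_ne_top hvt (measure_mono inter_subset_right)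
  have h5 : volume (closedBall a ϱ) ≤ (1 - δ') * volume (closedBall a ϱ) + δ' * volume (closedBall a ϱ) := by
    rw [← add_mul]
    calc _ = 1 * volume (closedBall a ϱ) := (one_mul _).symm
      _ ≤ _ := by gcongr; exact le_tsub_add
  have h6 : volume (F ∩ closedBall a ϱ) + volume (closedBall a ϱ \ F) ≤ volume (F ∩ closedBall a ϱ) + δ' * volume (closedBall a ϱ) := by
    rw [h3]; exact h5.trans (by gcongr)
  have h7 := (ENNReal.add_le_add_iff_left h4).1 h6
  refine h7.trans (le_of_eq ?_)
  rw [vol_cball a h0.le, ENNReal.ofReal_mul hδ.le]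
  simp only [δ']
  rw [mul_comm (ofReal (ϱ ^ (n + 1))), ← mul_assoc, ENNReal.div_mul_cancel hb0 hbt]

theorem mv_ball_ne_top {n : ℕ} {f : EX n → ℝ} (hf : Continuous f) (y : EX n) (r : ℝ) : mv f (closedBall y r) ≠ ⊤ := by
  obtain ⟨c, hc⟩ := ((isCompact_closedBall y r).image hf).bddAbove
  refine ne_top_of_le_ne_top ?_ (wd_le (f := f) volume isClosed_closedBall.measurableSet (c := c) fun x hx => hc ⟨x, hx, rfl⟩)
  exact ENNReal.mul_ne_top ENNReal.ofReal_ne_top measure_closedBall_lt_top.ne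

theorem mv_ac {n : ℕ} (f : EX n → ℝ) : mv f ≪ volume := withDensity_absolutelyContinuous _ _

theorem CONT {n : ℕ} {f : EX n → ℝ} (hf : Continuous f) {S : Set (EX n)} (hS : MeasurableSet S) {ϱ : ℝ} :
    Continuous fun y => mv f (ball y ϱ ∩ S) := by
  rw [continuous_iff_continuousAt]
  intro y
  refine tendsto_measure_of_ae_tendsto_indicator _ (isOpen_ball.measurableSet.inter hS)
    (fun i => isOpen_ball.measurableSet.inter hS) (B := closedBall y (ϱ + 1)) isClosed_closedBall.measurableSet
    (mv_ball_ne_top hf y _) ?_ ?_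
  · filter_upwards [Metric.ball_mem_nhds y one_pos] with i hi z hz
    rw [mem_ball] at hi
    have := mem_ball.1 hz.1
    rw [mem_closedBall]
    linarith [dist_triangle z i y]
  · have h0 : mv f (sphere y ϱ) = 0 := mv_ac f (Measure.addHaar_sphere volume y ϱ)
    filter_upwards [measure_eq_zero_iff_ae_notMem.1 h0] with z hz
    have hz' : dist z y ≠ ϱ := hz
    have hc : Tendsto (fun i => dist z i) (𝓝 y) (𝓝 (dist z y)) := (continuous_const.dist continuous_id).continuousAt
    rcases lt_or_gt_of_ne hz' with h | h
    · filter_upwards [hc.eventually (gt_mem_nhds h)] with i hi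
      simp [mem_ball, hi, h]
    · filter_upwards [hc.eventually (lt_mem_nhds h)] with i hi
      simp [mem_ball, hi.not_gt, h.not_gt]



theorem FIX {n : ℕ} (hn : 1 ≤ n) {f : EX n → ℝ} (hf : Continuous f) (hpos : ∀ x, 0 < f x) {F : Set (EX n)} (hF : MeasurableSet F)
    {w : EX n} {R₁ : ℝ} (hR : 0 < R₁) (h1 : volume (F ∩ ball w R₁) ≠ 0) (h2 : volume (ball w R₁ \ F) ≠ 0)
    {η : ℝ} (hη : 0 < η) : ∃ t₀ : ℝ, 0 < t₀ ∧ ∀ tm, 0 < tm → ∃ κ : ℝ, 0 < κ ∧ ∀ G : Set (EX n), IsOpen G →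
      volume ((G \ F ∪ F \ G) ∩ ball w (2 * R₁)) ≤ ofReal κ → ∀ t, tm ≤ t → t ≤ t₀ →
      ∃ (y : EX n) (ϱ : ℝ), 0 < ϱ ∧ closedBall y ϱ ⊆ ball w (2 * R₁) ∧
        mv f (ball y ϱ \ G) = ofReal (t ^ (n + 1)) ∧
        mp f (sphere y ϱ \ closure G) ≤ mp f (frontier G ∩ ball y ϱ) + ofReal (η * t ^ n) := by
  obtain ⟨C, hC, hA⟩ := FIXA hn
  have hC' : (0 : ℝ) < C := hC
  have hKc := isCompact_closedBall w (2 * R₁)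
  have hwK : w ∈ closedBall w (2 * R₁) := Metric.mem_closedBall_self (by positivity)
  obtain ⟨s, hs⟩ := (hKc.image hf).bddAbove
  have hs' : ∀ z ∈ closedBall w (2 * R₁), f z ≤ s := fun z hz => hs ⟨z, hz, rfl⟩
  have hs0 : 0 < s := (hpos w).trans_le (hs' w hwK)
  obtain ⟨z₀, hz₀, hmin⟩ := hKc.exists_isMinOn ⟨w, hwK⟩ hf.continuousOn
  set i := f z₀ with hi
  have hi0 : 0 < i := hpos z₀
  have hi' : ∀ z ∈ closedBall w (2 * R₁), i ≤ f z := fun z hz => hmin hz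
  obtain ⟨β, hβ0, hβ⟩ : ∃ β : ℝ, 0 < β ∧ bvol n = ofReal β :=
    ⟨(bvol n).toReal, ENNReal.toReal_pos (bvol_ne_zero n) (bvol_ne_top n), (ENNReal.ofReal_toReal (bvol_ne_top n)).symm⟩
  set τ : ℝ := min 1 (min (η / (2 * C)) (i * β / 2)) with hτ
  have hτ0 : 0 < τ := by positivity
  have hτ1 : τ ≤ 1 := min_le_left _ _
  have hτ2 : C * τ ≤ η / 2 := by
    have : τ ≤ η / (2 * C) := (min_le_right _ _).trans (min_le_left _ _)
    rw [le_div_iff₀ (by positivity)] at this; linarith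
  have hτ3 : τ ^ (n + 1) ≤ i * β / 2 := (pow_le_of_le_one hτ0.le hτ1 (by omega)).trans ((min_le_right _ _).trans (min_le_right _ _))
  set l : ℝ := min 1 (η * τ ^ n / (2 * C * s)) with hl
  have hl0 : 0 < l := by positivity
  have hl1 : l ≤ 1 := min_le_left _ _
  have hl2 : C * (l * s) ≤ η / 2 * τ ^ n := by
    have : l ≤ η * τ ^ n / (2 * C * s) := min_le_right _ _
    rw [le_div_iff₀ (by positivity)] at this; linarith
  obtain ⟨ϱu, hϱu, hu⟩ := Metric.uniformContinuousOn_iff.1 (hKc.uniformContinuousOn_of_continuous hf.continuousOn) (l * i) (by positivity)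
  have hosc : ∀ z ∈ closedBall w (2 * R₁), ∀ z' ∈ closedBall w (2 * R₁), dist z z' < ϱu → f z ≤ (1 + l) * f z' := by
    intro z hz z' hz' hd
    have h3 := hu z hz z' hz' hd
    rw [Real.dist_eq] at h3
    have h4 := (abs_lt.1 h3).2
    have h5 : l * i ≤ l * f z' := by gcongr; exact hi' z' hz'
    linarith
  set δ : ℝ := min (τ ^ (n + 1) / (2 * s)) (β / 4) with hδ
  have hδ0 : 0 < δ := by positivity
  have hδ1 : s * (2 * δ) ≤ τ ^ (n + 1) := by
    have : δ ≤ τ ^ (n + 1) / (2 * s) := min_le_left _ _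
    rw [le_div_iff₀ (by positivity)] at this; linarith
  have hδ2 : 2 * δ ≤ β / 2 := by
    have : δ ≤ β / 4 := min_le_right _ _
    linarith
  obtain ⟨a, haB, ha⟩ := DENS hF h1
  obtain ⟨b, hbB, hb⟩ := DENS hF.compl (w := w) (R := R₁) (by rwa [inter_comm, ← Set.sdiff_eq])
  obtain ⟨ϱa, hϱa, ha⟩ := ha δ hδ0
  obtain ⟨ϱb, hϱb, hb⟩ := hb δ hδ0
  set ϱ₀ := min (min R₁ ϱu) (min ϱa ϱb) / 2 with hϱ₀
  have hm0 : 0 < min (min R₁ ϱu) (min ϱa ϱb) := by positivity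
  have hϱ00 : 0 < ϱ₀ := by positivity
  have hlt : ϱ₀ < min (min R₁ ϱu) (min ϱa ϱb) := by linarith
  simp only [lt_min_iff] at hlt
  obtain ⟨⟨e1, e2⟩, e3, e4⟩ := hlt
  refine ⟨τ * ϱ₀, by positivity, fun tm htm => ⟨δ * (tm / τ) ^ (n + 1), by positivity, ?_⟩⟩
  intro G hG hGF t ht1 ht2
  have ht0 : 0 < t := htm.trans_le ht1
  set ϱ := t / τ with hϱ
  have hϱ0 : 0 < ϱ := by positivity
  have hϱle : ϱ ≤ ϱ₀ := by rw [hϱ, div_le_iff₀ hτ0]; linarith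
  have htϱ : t = τ * ϱ := by rw [hϱ]; field_simp
  have hGF' : volume ((G \ F ∪ F \ G) ∩ ball w (2 * R₁)) ≤ ofReal (δ * ϱ ^ (n + 1)) := by
    refine hGF.trans (ENNReal.ofReal_le_ofReal ?_)
    have : tm / τ ≤ ϱ := div_le_div_of_nonneg_right ht1 hτ0.le
    gcongr
  have hsub : ∀ y ∈ ball w R₁, closedBall y ϱ ⊆ ball w (2 * R₁) := by
    intro y hy z hz
    rw [mem_ball] at hy ⊢
    rw [mem_closedBall] at hz
    linarith [dist_triangle z y w]
  have hsubK : ∀ y ∈ ball w R₁, closedBall y ϱ ⊆ closedBall w (2 * R₁) := fun y hy =>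
    (hsub y hy).trans ball_subset_closedBall
  have hmB : ∀ y, MeasurableSet (ball y ϱ \ G) := fun y => MeasurableSet.diff isOpen_ball.measurableSet hG.measurableSet
  have hlow : mv f (ball a ϱ \ G) ≤ ofReal (t ^ (n + 1)) := by
    have q1 : volume (ball a ϱ \ G) ≤ ofReal (2 * δ * ϱ ^ (n + 1)) := by
      rw [show 2 * δ * ϱ ^ (n + 1) = δ * ϱ ^ (n + 1) + δ * ϱ ^ (n + 1) by ring, ENNReal.ofReal_add (by positivity) (by positivity)]
      refine le_trans ?_ (add_le_add (ha ϱ hϱ0 (by linarith)) hGF')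
      refine (measure_mono ?_).trans (measure_union_le _ _)
      rintro z ⟨hz, hzG⟩
      by_cases hzF : z ∈ F
      · exact Or.inr ⟨Or.inr ⟨hzF, hzG⟩, hsub a haB (ball_subset_closedBall hz)⟩
      · exact Or.inl ⟨ball_subset_closedBall hz, hzF⟩
    refine (wd_le (f := f) volume (hmB a) (c := s) fun z hz => hs' z (hsubK a haB (ball_subset_closedBall hz.1))).trans ?_
    refine (mul_le_mul_right q1 _).trans ?_
    rw [← ENNReal.ofReal_mul hs0.le]
    refine ENNReal.ofReal_le_ofReal ?_
    rw [htϱ, mul_pow, ← mul_assoc]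
    gcongr
  have hhigh : ofReal (t ^ (n + 1)) ≤ mv f (ball b ϱ \ G) := by
    have q1 : ofReal (β / 2 * ϱ ^ (n + 1)) ≤ volume (ball b ϱ \ G) := by
      have q2 : volume (ball b ϱ) ≤ volume (ball b ϱ \ G) + ofReal (β / 2 * ϱ ^ (n + 1)) := by
        calc volume (ball b ϱ) ≤ volume (ball b ϱ \ G) + (volume (closedBall b ϱ \ Fᶜ) + volume ((G \ F ∪ F \ G) ∩ ball w (2 * R₁))) := by
              refine le_trans (measure_mono ?_) ((measure_union_le _ _).trans (add_le_add le_rfl (measure_union_le _ _)))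
              intro z hz
              by_cases hzG : z ∈ G
              · by_cases hzF : z ∈ F
                · exact Or.inr (Or.inl ⟨ball_subset_closedBall hz, fun h => h hzF⟩)
                · exact Or.inr (Or.inr ⟨Or.inl ⟨hzG, hzF⟩, hsub b hbB (ball_subset_closedBall hz)⟩)
              · exact Or.inl ⟨hz, hzG⟩
          _ ≤ volume (ball b ϱ \ G) + (ofReal (δ * ϱ ^ (n + 1)) + ofReal (δ * ϱ ^ (n + 1))) := by
              gcongr
              exact hb ϱ hϱ0 (by linarith)
          _ ≤ _ := by
              rw [← ENNReal.ofReal_add (by positivity) (by positivity), ← two_mul, ← mul_assoc]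
              gcongr
      rw [vol_ball b hϱ0.le, hβ, ← ENNReal.ofReal_mul (by positivity)] at q2
      rw [show ϱ ^ (n + 1) * β = β / 2 * ϱ ^ (n + 1) + β / 2 * ϱ ^ (n + 1) by ring, ENNReal.ofReal_add (by positivity) (by positivity)] at q2
      exact (ENNReal.add_le_add_iff_right ENNReal.ofReal_ne_top).1 q2
    refine le_trans ?_ (le_wd (f := f) volume (hmB b) (c := i) fun z hz => hi' z (hsubK b hbB (ball_subset_closedBall hz.1)))
    refine le_trans ?_ (mul_le_mul_right q1 _)
    rw [← ENNReal.ofReal_mul hi0.le]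
    refine ENNReal.ofReal_le_ofReal ?_
    rw [htϱ, mul_pow, ← mul_assoc]
    gcongr
    linarith
  obtain ⟨y, hy, hyt⟩ := ((convex_ball w R₁).isPreconnected).intermediate_value haB hbB
    (f := fun y => mv f (ball y ϱ \ G)) (by simp only [Set.sdiff_eq]; exact (CONT hf hG.measurableSet.compl).continuousOn) ⟨hlow, hhigh⟩
  refine ⟨y, ϱ, hϱ0, hsub y hy, hyt, ?_⟩
  have hyK : y ∈ closedBall w (2 * R₁) := hsubK y hy (Metric.mem_closedBall_self hϱ0.le)
  refine (hA f G y ϱ (f y) l hϱ0 (hpos y) hl0.le hl1 hG fun z hz => ?_).trans ?_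
  · have hd : dist z y < ϱu := (mem_closedBall.1 hz).trans_lt (by linarith)
    exact ⟨hosc z (hsubK y hy hz) y hyK hd, hosc y hyK z (hsubK y hy hz) (by rwa [dist_comm])⟩
  · refine add_le_add le_rfl ?_
    simp only at hyt
    rw [hyt, show (C : ℝ≥0∞) = ofReal C by simp, ← ENNReal.ofReal_mul (by positivity), ← ENNReal.ofReal_div_of_pos hϱ0, ← ENNReal.ofReal_mul (by positivity),
      ← ENNReal.ofReal_add (by positivity) (by have := hpos y; positivity)]
    refine ENNReal.ofReal_le_ofReal ?_
    have q1 : C * t ^ (n + 1) / ϱ = C * τ * t ^ n := by rw [pow_succ, htϱ]; field_simp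
    have q2 : C * (l * f y * ϱ ^ n) ≤ η / 2 * t ^ n := by
      calc C * (l * f y * ϱ ^ n) ≤ C * (l * s * ϱ ^ n) := by gcongr; exact hs' y hyK
        _ = C * (l * s) * ϱ ^ n := by ring
        _ ≤ η / 2 * τ ^ n * ϱ ^ n := by gcongr
        _ = _ := by rw [htϱ, mul_pow]; ring
    rw [q1]
    have q3 : C * τ * t ^ n ≤ η / 2 * t ^ n := by gcongr
    linarith



theorem vol_zero_of_muH {n : ℕ} {A : Set (EX n)} (hA : μH[n] A ≠ ⊤) : volume A = 0 := by
  obtain ⟨C, hC, h⟩ := T1 n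
  obtain ⟨e, he⟩ : ∃ e : EX n, ‖e‖ = 1 := ⟨EuclideanSpace.single 0 1, by simp⟩
  have h1 : ∀ j : ℕ, volume A ≤ C * ofReal (1 / ((j : ℝ) + 1)) * μH[n] A := by
    intro j
    have hj : (0 : ℝ) < 1 / ((j : ℝ) + 1) := by positivity
    have hv : ‖(1 / ((j : ℝ) + 1)) • e‖ = 1 / ((j : ℝ) + 1) := by rw [norm_smul, he, mul_one, Real.norm_of_nonneg hj.le]
    have := h ((1 / ((j : ℝ) + 1)) • e) A (by rw [← norm_ne_zero_iff, hv]; exact hj.ne')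
    rw [hv] at this
    refine le_trans (measure_mono fun a ha => ?_) this
    exact ⟨0, by simp, by simpa using ha⟩
  have h2 : Tendsto (fun j : ℕ => C * ofReal (1 / ((j : ℝ) + 1)) * μH[n] A) atTop (𝓝 (C * ofReal 0 * μH[n] A)) := by
    refine ENNReal.Tendsto.mul_const (ENNReal.Tendsto.const_mul ?_ (Or.inr ENNReal.coe_ne_top)) (Or.inr hA)
    exact (ENNReal.continuous_ofReal.tendsto 0).comp tendsto_one_div_add_atTop_nhds_zero_nat
  have := ge_of_tendsto' h2 h1
  simpa using this

theorem exists_lower {n : ℕ} {f : EX n → ℝ} (hf : Continuous f) (hpos : ∀ x, 0 < f x) (x : EX n) (r : ℝ) :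
    ∃ i : ℝ, 0 < i ∧ ∀ z ∈ closedBall x r, i ≤ f z := by
  rcases (closedBall x r).eq_empty_or_nonempty with h | h
  · exact ⟨1, one_pos, by simp [h]⟩
  · obtain ⟨z₀, _, hmin⟩ := (isCompact_closedBall x r).exists_isMinOn h hf.continuousOn
    exact ⟨f z₀, hpos z₀, fun z hz => hmin hz⟩

theorem exists_upper {n : ℕ} {f : EX n → ℝ} (hf : Continuous f) (x : EX n) (r : ℝ) :
    ∃ s : ℝ, 0 < s ∧ ∀ z ∈ closedBall x r, f z ≤ s := by
  obtain ⟨s, hs⟩ := ((isCompact_closedBall x r).image hf).bddAbove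
  exact ⟨max s 1, by positivity, fun z hz => (hs ⟨z, hz, rfl⟩).trans (le_max_left _ _)⟩

theorem vol_frontier {n : ℕ} {f : EX n → ℝ} (hf : Continuous f) (hpos : ∀ x, 0 < f x) {G : Set (EX n)}
    (hP : mp f (frontier G) ≠ ⊤) : volume (frontier G) = 0 := by
  rw [show frontier G = ⋃ m : ℕ, frontier G ∩ closedBall 0 m by
    rw [← inter_iUnion, Metric.iUnion_closedBall_nat, inter_univ]]
  refine measure_iUnion_null fun m => vol_zero_of_muH ?_
  obtain ⟨i, hi, hi'⟩ := exists_lower hf hpos 0 m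
  have := le_wd (f := f) μH[n] (isClosed_frontier.measurableSet.inter isClosed_closedBall.measurableSet)
    (c := i) (fun z (hz : z ∈ frontier G ∩ closedBall 0 m) => hi' z hz.2)
  intro htop
  rw [htop, ENNReal.mul_top (by simpa using hi)] at this
  exact hP (top_le_iff.1 (this.trans (measure_mono inter_subset_left)))

theorem mv_closure {n : ℕ} {f : EX n → ℝ} {G : Set (EX n)} (h0 : volume (frontier G) = 0) (S : Set (EX n)) :
    mv f (closure G ∩ S) = mv f (G ∩ S) := by
  refine le_antisymm ?_ (measure_mono (inter_subset_inter_left _ subset_closure))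
  have : closure G ∩ S ⊆ (G ∩ S) ∪ frontier G := by
    rintro z ⟨hz, hS⟩
    by_cases h : z ∈ G
    · exact Or.inl ⟨h, hS⟩
    · exact Or.inr ⟨hz, fun h' => h (interior_subset h')⟩
  refine (measure_mono this).trans ((measure_union_le _ _).trans ?_)
  rw [mv_ac f h0, add_zero]

/-- Almost minimality. -/
def AM {n : ℕ} (f : EX n → ℝ) (G : Set (EX n)) (ε : ℝ≥0∞) : Prop :=
  IsOpen G ∧ ∀ U : Set (EX n), IsOpen U → mv f (G \ U) = mv f (U \ G) → mv f (G \ U) ≠ ⊤ →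
    mp f (frontier G) ≤ mp f (frontier U) + ε

theorem CL {n : ℕ} {f : EX n → ℝ} {G K : Set (EX n)} {ε e : ℝ≥0∞} (hG : AM f G ε) (hP : mp f (frontier G) ≠ ⊤)
    (hK : IsClosed K) {y : EX n} {ϱ : ℝ} (hϱ : 0 < ϱ) (hd : Disjoint (closedBall y ϱ) K)
    (hv : mv f (G ∩ K) = mv f (ball y ϱ \ G)) (hv' : mv f (G ∩ K) ≠ ⊤)
    (hc : mp f (sphere y ϱ \ closure G) ≤ mp f (frontier G ∩ ball y ϱ) + e) :
    mp f (frontier G ∩ interior K) ≤ mp f (closure G ∩ frontier K) + e + ε := by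
  obtain ⟨hGo, hmin⟩ := hG
  set B := ball y ϱ with hB
  have hdB : Disjoint B K := hd.mono_left ball_subset_closedBall
  have e1 : G \ ((G \ K) ∪ B) = G ∩ K := by
    ext z
    have : z ∈ K → z ∉ B := fun h h' => disjoint_left.1 hdB h' h
    simp only [Set.mem_sdiff, mem_union, mem_inter_iff]; tauto
  have e2 : ((G \ K) ∪ B) \ G = B \ G := by
    ext z; simp only [Set.mem_sdiff, mem_union]; tauto
  have h1 := hmin ((G \ K) ∪ B) ((hGo.sdiff hK).union isOpen_ball) (by rw [e1, e2]; exact hv) (by rw [e1]; exact hv')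
  have h2 := (measure_mono (μ := mp f) (frontier_swap hGo hK y hϱ hd)).trans ((measure_union_le _ _).trans (add_le_add (measure_union_le _ _) le_rfl))
  set rest := mp f (frontier G \ (interior K ∪ B)) with hrest
  have h3 : mp f (frontier G) = mp f (frontier G ∩ interior K) + mp f (frontier G ∩ B) + rest := by
    rw [← measure_inter_add_sdiff (frontier G) (isOpen_interior.union isOpen_ball : IsOpen (interior K ∪ B)).measurableSet, inter_union_distrib_left,
      measure_union _ (isClosed_frontier.measurableSet.inter isOpen_ball.measurableSet)]
    exact Disjoint.mono inter_subset_right inter_subset_right (hdB.symm.mono_left interior_subset)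
  have hrt : rest ≠ ⊤ := ne_top_of_le_ne_top hP (measure_mono sdiff_subset)
  have hbt : mp f (frontier G ∩ B) ≠ ⊤ := ne_top_of_le_ne_top hP (measure_mono inter_subset_left)
  have h4 : mp f (frontier G ∩ interior K) + (mp f (frontier G ∩ B) + rest) ≤
      (mp f (closure G ∩ frontier K) + e + ε) + (mp f (frontier G ∩ B) + rest) := by
    rw [← add_assoc, ← h3]
    refine h1.trans ?_
    calc _ ≤ rest + mp f (closure G ∩ frontier K) + (mp f (frontier G ∩ B) + e) + ε := by
          gcongr; exact h2.trans (by gcongr)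
      _ = _ := by ring
  exact (ENNReal.add_le_add_iff_right (ENNReal.add_ne_top.2 ⟨hbt, hrt⟩)).1 h4

/-- Sequences of almost minimizers converging locally. -/
structure SEQ {n : ℕ} (f : EX n → ℝ) (G : ℕ → Set (EX n)) (F : Set (EX n)) (ε : ℕ → ℝ≥0∞) : Prop where
  meas : MeasurableSet F
  eps : Tendsto ε atTop (𝓝 0)
  am : ∀ k, AM f (G k) (ε k)
  fin : ∀ k, mp f (frontier (G k)) ≠ ⊤
  conv : ∀ w R, Tendsto (fun k => volume ((G k \ F ∪ F \ G k) ∩ ball w R)) atTop (𝓝 0)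

theorem COMP {n : ℕ} (hn : 1 ≤ n) {f : EX n → ℝ} (hf : Continuous f) (hpos : ∀ x, 0 < f x) {G : ℕ → Set (EX n)} {F : Set (EX n)}
    {ε : ℕ → ℝ≥0∞} (hS : SEQ f G F ε) {w : EX n} {R₁ : ℝ} (hR : 0 < R₁) (h1 : volume (F ∩ ball w R₁) ≠ 0)
    (h2 : volume (ball w R₁ \ F) ≠ 0) {η : ℝ} (hη : 0 < η) :
    ∃ t₀ : ℝ, 0 < t₀ ∧ ∀ tm, 0 < tm → ∀ᶠ k in atTop, ∀ K : Set (EX n), IsClosed K → Disjoint (ball w (2 * R₁)) K →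
      ∀ t, tm ≤ t → t ≤ t₀ → mv f (G k ∩ K) = ofReal (t ^ (n + 1)) →
      mp f (frontier (G k) ∩ interior K) ≤ mp f (closure (G k) ∩ frontier K) + ofReal (η * t ^ n) + ε k := by
  obtain ⟨t₀, ht₀, h⟩ := FIX hn hf hpos hS.meas hR h1 h2 hη
  refine ⟨t₀, ht₀, fun tm htm => ?_⟩
  obtain ⟨κ, hκ, h⟩ := h tm htm
  filter_upwards [(hS.conv w (2 * R₁)).eventually (ge_mem_nhds (show (0 : ℝ≥0∞) < ofReal κ by simpa using hκ))] with k hk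
  intro K hK hd t ht1 ht2 hv
  obtain ⟨y, ϱ, hϱ, hsub, hvol, hc⟩ := h (G k) (hS.am k).1 hk t ht1 ht2
  exact CL (hS.am k) (hS.fin k) hK hϱ (hd.mono_left hsub) (hv.trans hvol.symm) (by rw [hv]; exact ENNReal.ofReal_ne_top) hc



theorem ABS {n : ℕ} {f : EX n → ℝ} {G K : Set (EX n)} {t : ℝ} (ht : 0 ≤ t) {c η : ℝ≥0} {ε : ℝ≥0∞} (hcη : c * η ≤ 1 / 2)
    (hiso : ofReal (t ^ (n + 1)) ^ n ≤ (c * mp f (frontier (G ∩ interior K))) ^ (n + 1))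
    (hcomp : mp f (frontier G ∩ interior K) ≤ mp f (closure G ∩ frontier K) + ofReal (η * t ^ n) + ε) :
    ofReal (t ^ n) ≤ 4 * c * mp f (closure G ∩ frontier K) + 2 * c * ε := by
  set X := mp f (closure G ∩ frontier K)
  have h1 : mp f (frontier (G ∩ interior K)) ≤ 2 * X + ofReal (η * t ^ n) + ε := by
    refine (measure_mono (frontier_inter_int G K)).trans ((measure_union_le _ _).trans ?_)
    refine (add_le_add hcomp le_rfl).trans (le_of_eq ?_)
    ring
  have h2 : ofReal (t ^ n) ≤ c * mp f (frontier (G ∩ interior K)) := by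
    rw [← ENNReal.ofReal_pow (by positivity), ← pow_mul, mul_comm, pow_mul, ENNReal.ofReal_pow (by positivity)] at hiso
    exact (ENNReal.pow_le_pow_left_iff (by omega)).1 hiso
  set T := ofReal (t ^ n) with hT
  have h3 : T + T ≤ (4 * c * X + 2 * c * ε) + T := by
    calc T + T = 2 * T := (two_mul _).symm
      _ ≤ 2 * (c * (2 * X + ofReal (η * t ^ n) + ε)) := by gcongr; exact h2.trans (by gcongr)
      _ = (4 * c * X + 2 * c * ε) + 2 * ((c * η : ℝ≥0) : ℝ≥0∞) * T := by
        rw [ENNReal.ofReal_mul (by positivity), ENNReal.ofReal_coe_nnreal]; push_cast; ring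
      _ ≤ (4 * c * X + 2 * c * ε) + 2 * ((1 / 2 : ℝ≥0) : ℝ≥0∞) * T := by gcongr
      _ = _ := by
        rw [show (2 : ℝ≥0∞) * ((1 / 2 : ℝ≥0) : ℝ≥0∞) = 1 by
          rw [show (2 : ℝ≥0∞) = ((2 : ℝ≥0) : ℝ≥0∞) by simp, ← ENNReal.coe_mul]; simp, one_mul]
  exact (ENNReal.add_le_add_iff_right ENNReal.ofReal_ne_top).1 h3

/-- The tail form of the hypothesis on `ζ`. -/
def ZT {n : ℕ} (f : EX n → ℝ) : Prop := ∀ κ : ℝ≥0, 0 < κ → ∃ R : ℝ, ∀ x : EX n, R ≤ ‖x‖ → ∃ a b : ℝ, 0 ≤ a ∧ 0 ≤ b ∧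
    (∀ y ∈ closedBall x (5 * (1 / 10)), a ≤ f y ∧ f y ≤ b) ∧ b ^ n ≤ (κ * a) ^ (n + 1)

theorem ZETA {n : ℕ} (hn : 1 ≤ n) {f : EX n → ℝ} (hcont : Continuous f) (hpos : ∀ x, 0 < f x)
    (hζ : Tendsto (fun m : ℕ =>
        sInf (f '' {x : EuclideanSpace ℝ (Fin (n + 1)) | (m : ℝ) ≤ ‖x‖ ∧ ‖x‖ ≤ m + 2}) /
        sSup ((fun x => f x ^ ((n : ℝ) / (n + 1))) ''
          {x : EuclideanSpace ℝ (Fin (n + 1)) | (m : ℝ) ≤ ‖x‖ ∧ ‖x‖ ≤ m + 2}))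
      atTop atTop) : ZT f := by
  intro κ hκ
  obtain ⟨m₀, hm₀⟩ := eventually_atTop.1 (hζ.eventually_ge_atTop ((κ : ℝ)⁻¹))
  refine ⟨m₀ + 1, fun x hx => ?_⟩
  set m := ⌊‖x‖ - 1 / 2⌋₊ with hm
  have hmge : m₀ ≤ m := Nat.le_floor (by linarith)
  have hm1 : (m : ℝ) ≤ ‖x‖ - 1 / 2 := Nat.floor_le (by have : (0 : ℝ) ≤ m₀ := by positivity
                                                       linarith)
  have hm2 : ‖x‖ - 1 / 2 < m + 1 := Nat.lt_floor_add_one _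
  have hz := hm₀ m hmge
  set S := {x : EuclideanSpace ℝ (Fin (n + 1)) | (m : ℝ) ≤ ‖x‖ ∧ ‖x‖ ≤ m + 2} with hS
  have hSc : IsCompact S := by
    refine Metric.isCompact_of_isClosed_isBounded ?_ ?_
    · exact (isClosed_le continuous_const continuous_norm).inter (isClosed_le continuous_norm continuous_const)
    · refine (Metric.isBounded_closedBall (x := 0) (r := (m : ℝ) + 2)).subset fun z hz => ?_
      simpa using hz.2
  have hbS : closedBall x (5 * (1 / 10)) ⊆ S := by
    intro y hy
    rw [mem_closedBall, dist_eq_norm] at hy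
    have h1 := norm_sub_norm_le x y
    have h2 := norm_sub_norm_le y x
    rw [norm_sub_rev] at h1
    constructor <;> linarith
  have hcp : Continuous (fun x => f x ^ ((n : ℝ) / (n + 1))) := hcont.rpow_const fun x => Or.inl (hpos x).ne'
  set a := sInf (f '' S)
  set q := sSup ((fun x => f x ^ ((n : ℝ) / (n + 1))) '' S)
  have ha : ∀ y ∈ S, a ≤ f y := fun y hy => csInf_le (hSc.image hcont).bddBelow ⟨y, hy, rfl⟩
  have hq : ∀ y ∈ S, f y ^ ((n : ℝ) / (n + 1)) ≤ q := fun y hy => le_csSup (hSc.image hcp).bddAbove ⟨y, hy, rfl⟩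
  have hxS : x ∈ S := hbS (Metric.mem_closedBall_self (by norm_num))
  have ha0 : 0 ≤ a := le_csInf ⟨_, x, hxS, rfl⟩ (by rintro _ ⟨y, _, rfl⟩; exact (hpos y).le)
  have hq0 : 0 < q := (Real.rpow_pos_of_pos (hpos x) _).trans_le (hq x hxS)
  have hn0 : (0 : ℝ) < n := by exact_mod_cast hn
  refine ⟨a, q ^ (((n : ℝ) + 1) / n), ha0, by positivity, fun y hy => ⟨ha y (hbS hy), ?_⟩, ?_⟩
  · calc f y = (f y ^ ((n : ℝ) / (n + 1))) ^ (((n : ℝ) + 1) / n) := by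
          rw [← Real.rpow_mul (hpos y).le, show (n : ℝ) / (n + 1) * ((n + 1) / n) = 1 by field_simp, Real.rpow_one]
      _ ≤ _ := Real.rpow_le_rpow (Real.rpow_nonneg (hpos y).le _) (hq y (hbS hy)) (by positivity)
  · have e1 : (q ^ (((n : ℝ) + 1) / n)) ^ n = q ^ (n + 1) := by
      rw [← Real.rpow_natCast, ← Real.rpow_mul hq0.le, show ((n : ℝ) + 1) / n * n = ((n + 1 : ℕ) : ℝ) by push_cast; field_simp, Real.rpow_natCast]
    rw [e1]
    have hκ' : (0 : ℝ) < κ := hκ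
    have : q ≤ κ * a := by
      rw [inv_eq_one_div, div_le_div_iff₀ hκ' hq0] at hz
      linarith
    gcongr

theorem LOW {n : ℕ} {f : EX n → ℝ} (hcont : Continuous f) (hpos : ∀ x, 0 < f x)
    (hinf : Tendsto f (Bornology.cobounded (EX n)) atTop) : ∃ i : ℝ, 0 < i ∧ ∀ x, i ≤ f x := by
  have h := hinf.eventually_ge_atTop 1
  have h' := (Metric.hasBasis_cobounded_compl_closedBall (0 : EX n)).eventually_iff.1 h
  obtain ⟨R, _, hR⟩ := h'
  obtain ⟨i, hi, hi'⟩ := exists_lower hcont hpos 0 R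
  refine ⟨min i 1, by positivity, fun x => ?_⟩
  by_cases hx : x ∈ closedBall (0 : EX n) R
  · exact (min_le_left _ _).trans (hi' x hx)
  · exact (min_le_right _ _).trans (hR hx)

theorem site {n : ℕ} {F : Set (EX n)} (h1 : volume F ≠ 0) (h2 : volume Fᶜ ≠ 0) :
    ∃ R : ℝ, 0 < R ∧ volume (F ∩ ball 0 R) ≠ 0 ∧ volume (ball 0 R \ F) ≠ 0 := by
  have key : ∀ A : Set (EX n), volume A ≠ 0 → ∃ R : ℕ, volume (A ∩ ball 0 R) ≠ 0 := by
    intro A hA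
    by_contra hcon
    push Not at hcon
    refine hA ?_
    rw [show A = ⋃ m : ℕ, A ∩ ball 0 m by rw [← inter_iUnion, Metric.iUnion_ball_nat, inter_univ]]
    exact measure_iUnion_null hcon
  obtain ⟨a, ha⟩ := key F h1
  obtain ⟨b, hb⟩ := key _ h2
  refine ⟨(a : ℝ) + b + 1, by positivity, fun h => ha (measure_mono_null ?_ h), fun h => hb (measure_mono_null ?_ h)⟩
  · exact inter_subset_inter_right _ (ball_subset_ball (by have : (0 : ℝ) ≤ b := by positivity
                                                           linarith))
  · rw [inter_comm, ← Set.sdiff_eq]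
    exact sdiff_subset_sdiff_left (ball_subset_ball (by have : (0 : ℝ) ≤ a := by positivity
                                                        linarith))



theorem exists_root {n : ℕ} {m : ℝ≥0∞} (h : m ≠ ⊤) : ∃ t : ℝ, 0 ≤ t ∧ m = ofReal (t ^ (n + 1)) := by
  refine ⟨m.toReal ^ (((n + 1 : ℕ) : ℝ)⁻¹), by positivity, ?_⟩
  rw [Real.rpow_inv_natCast_pow ENNReal.toReal_nonneg (by omega), ENNReal.ofReal_toReal h]

theorem tail_zero {n : ℕ} {f : EX n → ℝ} {G : Set (EX n)} (hG : MeasurableSet G) (hvt : mv f G ≠ ⊤) :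
    Tendsto (fun s : ℕ => mv f (G ∩ (ball 0 s)ᶜ)) atTop (𝓝 0) := by
  have h := tendsto_measure_iInter_atTop (μ := mv f) (s := fun s : ℕ => G ∩ (ball (0 : EX n) s)ᶜ)
    (fun i => (hG.inter isOpen_ball.measurableSet.compl).nullMeasurableSet)
    (fun i j hij => inter_subset_inter_right _ (compl_subset_compl.2 (ball_subset_ball (by exact_mod_cast hij))))
    ⟨0, ne_top_of_le_ne_top hvt (measure_mono inter_subset_left)⟩
  rwa [← inter_iInter, ← compl_iUnion, Metric.iUnion_ball_nat, compl_univ, inter_empty, measure_empty] at h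

theorem BDD {n : ℕ} (hn : 1 ≤ n) {f : EX n → ℝ} (hf : Continuous f) (hpos : ∀ x, 0 < f x)
    (hinf : Tendsto f (Bornology.cobounded (EX n)) atTop) (hZ : ZT f) {G : Set (EX n)}
    (hS : SEQ f (fun _ => G) G (fun _ => 0)) (hv0 : mv f G ≠ 0) (hvt : mv f G ≠ ⊤) : Bornology.IsBounded G := by
  obtain ⟨i, hi, hlow⟩ := LOW hf hpos hinf
  have hGo : IsOpen G := (hS.am 0).1
  have hvol : ∀ A : Set (EX n), MeasurableSet A → ofReal i * volume A ≤ mv f A := fun A hA =>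
    le_wd (f := f) volume hA fun z _ => hlow z
  have hi0 : ofReal i ≠ 0 := by simpa using hi
  have hvG : volume G ≠ ⊤ := by
    intro h
    have := hvol G hGo.measurableSet
    rw [h, ENNReal.mul_top hi0] at this
    exact hvt (top_le_iff.1 this)
  have hvGc : volume Gᶜ ≠ 0 := by
    intro h
    have := measure_add_measure_compl (μ := volume) hGo.measurableSet
    rw [h, add_zero] at this
    rw [this] at hvG
    simp at hvG
  obtain ⟨R₁, hR₁, s1, s2⟩ := site (fun h => hv0 (mv_ac f h)) hvGc
  obtain ⟨t₀, ht₀, hcomp⟩ := COMP hn hf hpos hS hR₁ s1 s2 one_pos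
  obtain ⟨CI, hCI, hiso⟩ := ISO hn
  obtain ⟨CT, hCT, hT⟩ := T2c hn
  obtain ⟨R, hR⟩ := hZ (1 / (2 * CI)) (by positivity)
  have hfr : volume (frontier G) = 0 := vol_frontier hf hpos (hS.fin 0)
  set vs : ℝ≥0∞ := ofReal ((1 / 10 : ℝ) ^ (n + 1)) * bvol n / 2 with hvs
  have hvs0 : vs ≠ 0 := by
    simp only [vs]
    refine (ENNReal.div_pos (mul_ne_zero ?_ (bvol_ne_zero n)) (by simp)).ne'
    simp only [ne_eq, ENNReal.ofReal_eq_zero, not_le]; positivity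
  have hCT' : (0 : ℝ) < CT := hCT
  set KK : ℝ := 2 * CT with hKK
  set θ : ℝ := 1 / (2 ^ (n * (n + 1)) * (4 * KK) ^ (n + 1)) with hθ
  have hθ0 : 0 < θ := by positivity
  set thr : ℝ≥0∞ := min (ofReal (t₀ ^ (n + 1))) (min (ofReal i * vs) (ofReal θ)) with hthr
  have hthr0 : 0 < thr := by
    refine lt_min ?_ (lt_min ?_ ?_)
    · simp only [ENNReal.ofReal_pos]; positivity
    · exact pos_iff_ne_zero.2 (mul_ne_zero hi0 hvs0)
    · simpa using hθ0
  obtain ⟨s₀, hs₀, hsR, hsR₁⟩ : ∃ s₀ : ℝ, mv f (G ∩ (ball 0 s₀)ᶜ) < thr ∧ R ≤ s₀ ∧ 2 * R₁ ≤ s₀ := by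
    obtain ⟨s, h1, h2, h3⟩ := (((tail_zero hGo.measurableSet hvt).eventually (gt_mem_nhds hthr0)).and
      ((tendsto_natCast_atTop_atTop.eventually_ge_atTop R).and (tendsto_natCast_atTop_atTop.eventually_ge_atTop (2 * R₁)))).exists
    exact ⟨s, h1, h2, h3⟩
  have htm : ∀ {s s' : ℝ}, s ≤ s' → mv f (G ∩ (ball 0 s')ᶜ) ≤ mv f (G ∩ (ball 0 s)ᶜ) := fun h =>
    measure_mono (inter_subset_inter_right _ (compl_subset_compl.2 (ball_subset_ball h)))
  have step : ∀ s, s₀ ≤ s → mv f (G ∩ (ball 0 s)ᶜ) ^ n ≤ (2 * mp f (closure G ∩ sphere 0 s)) ^ (n + 1) := by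
    intro s hs
    set K := (ball (0 : EX n) s)ᶜ with hK
    have hKc : IsClosed K := isOpen_ball.isClosed_compl
    have hlt : mv f (G ∩ K) < thr := (htm hs).trans_lt hs₀
    by_cases h0 : mv f (G ∩ K) = 0
    · rw [h0, zero_pow (by omega)]; exact bot_le
    obtain ⟨t, ht, hte⟩ := exists_root (n := n) (ne_top_of_lt hlt)
    have ht' : 0 < t := by
      rcases ht.eq_or_lt with h | h
      · rw [← h] at hte; simp [hte] at h0
      · exact h
    have htt : t ≤ t₀ := by
      have := (hlt.trans_le (min_le_left _ _)).le
      rw [hte, ENNReal.ofReal_le_ofReal_iff (by positivity)] at this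
      exact (pow_le_pow_iff_left₀ ht ht₀.le (by omega)).1 this
    obtain ⟨k, hk⟩ := (hcomp t ht').exists
    have hc := hk K hKc (disjoint_compl_right_iff_subset.2 (ball_subset_ball (by linarith))) t le_rfl htt hte
    have hs0' : 0 < s := by linarith
    have hint : interior K = (closedBall 0 s)ᶜ := by rw [hK, interior_compl, closure_ball _ hs0'.ne']
    have hmvint : mv f (G ∩ interior K) = mv f (G ∩ K) := by
      refine le_antisymm (measure_mono (inter_subset_inter_right _ interior_subset)) ?_
      have h2 : G ∩ K ⊆ (G ∩ interior K) ∪ sphere 0 s := by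
        rintro z ⟨hz, hzK⟩
        by_cases hzs : dist z 0 = s
        · exact Or.inr hzs
        · refine Or.inl ⟨hz, ?_⟩
          rw [hint]
          intro hzc
          exact hzK (lt_of_le_of_ne hzc hzs)
      refine (measure_mono h2).trans ((measure_union_le _ _).trans ?_)
      rw [mv_ac f (Measure.addHaar_sphere volume 0 s), add_zero]
    have hI := hiso f (G ∩ interior K) (1 / 10) (1 / (2 * CI)) (hGo.inter isOpen_interior) (by norm_num) (by
        have h3 := hvol (G ∩ interior K) (hGo.inter isOpen_interior).measurableSet
        rw [hmvint] at h3
        have h4 := h3.trans_lt (hlt.trans_le ((min_le_right _ _).trans (min_le_left _ _)))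
        exact lt_of_mul_lt_mul_left' h4) (by
        intro x hx
        refine hR x ?_
        have := interior_subset hx.2
        rw [hK, mem_compl_iff, mem_ball, dist_zero_right, not_lt] at this
        linarith)
    have hcc : CI * (1 / (2 * CI)) = 1 / 2 := by field_simp
    rw [hmvint, hte, ← ENNReal.coe_mul, hcc] at hI
    have hA := ABS (η := 1) (ε := 0) ht'.le (by norm_num) hI (by simpa using hc)
    have hX : mp f (closure G ∩ frontier K) ≤ mp f (closure G ∩ sphere 0 s) := by
      refine measure_mono (inter_subset_inter_right _ ?_)
      rw [hK, frontier_compl]; exact Metric.frontier_ball_subset_sphere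
    rw [hte, ← ENNReal.ofReal_pow (by positivity), ← pow_mul, mul_comm (n + 1), pow_mul, ENNReal.ofReal_pow (by positivity)]
    gcongr
    refine hA.trans ?_
    rw [mul_zero, add_zero]
    refine mul_le_mul' (le_of_eq ?_) hX
    rw [show (4 : ℝ≥0∞) = ((4 : ℝ≥0) : ℝ≥0∞) by simp, ← ENNReal.coe_mul]; norm_num
  let M : ℝ → ℝ := fun x => (mv f (G ∩ (ball 0 (s₀ + 1 - x))ᶜ)).toReal
  have hMfin : ∀ s, mv f (G ∩ (ball 0 s)ᶜ) ≠ ⊤ := fun s => ne_top_of_le_ne_top hvt (measure_mono inter_subset_left)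
  have hM := ITER hn M (fun x => ENNReal.toReal_nonneg) (fun x x' h => ENNReal.toReal_mono (hMfin _) (htm (by linarith)))
    (r := 1) (K := KK) one_pos (by positivity) (by
      intro ρ₁ ρ₂ h1 h2 h3
      obtain ⟨s, hs, hTs⟩ := hT f hf.measurable hpos (fun z => dist z 0) (lip_dist 0) (closure G) isClosed_closure.measurableSet
        (s₀ + 1 - ρ₂) (s₀ + 1 - ρ₁) (by linarith)
      have h4 := step s (by linarith [hs.1])
      rw [mv_closure hfr] at hTs
      have h5 : mp f (closure G ∩ sphere 0 s) ≤ CT * mv f (G ∩ (ball 0 (s₀ + 1 - ρ₂))ᶜ) / ofReal (ρ₂ - ρ₁) := by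
        refine hTs.trans ?_
        rw [show s₀ + 1 - ρ₁ - (s₀ + 1 - ρ₂) = ρ₂ - ρ₁ by ring]
        gcongr
        intro z hz hz'
        exact absurd hz.1 (not_lt.2 (le_of_lt hz'))
      have h6 : mv f (G ∩ (ball 0 (s₀ + 1 - ρ₁))ᶜ) ^ n ≤ (2 * (CT * mv f (G ∩ (ball 0 (s₀ + 1 - ρ₂))ᶜ) / ofReal (ρ₂ - ρ₁))) ^ (n + 1) := by
        refine le_trans ?_ (h4.trans (by gcongr))
        gcongr
        exact hs.2.le
      have h7 := ENNReal.toReal_mono (by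
        refine ENNReal.pow_ne_top (ENNReal.mul_ne_top (by simp) (ENNReal.div_ne_top (ENNReal.mul_ne_top (by simp) (hMfin _)) ?_))
        simpa using h2) h6
      simp only [ENNReal.toReal_pow, ENNReal.toReal_mul, ENNReal.toReal_div, ENNReal.toReal_ofNat, ENNReal.coe_toReal,
        ENNReal.toReal_ofReal (sub_pos.2 h2).le] at h7
      have h8 : 0 < ρ₂ - ρ₁ := by linarith
      calc M ρ₁ ^ n * (ρ₂ - ρ₁) ^ (n + 1) ≤ (2 * (CT * M ρ₂ / (ρ₂ - ρ₁))) ^ (n + 1) * (ρ₂ - ρ₁) ^ (n + 1) := by gcongr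
        _ = _ := by rw [← mul_pow]; congr 1; rw [hKK]; field_simp) (by
      have h9 := (hs₀.trans_le ((min_le_right _ _).trans (min_le_right _ _))).le
      have h10 := ENNReal.toReal_mono ENNReal.ofReal_ne_top h9
      rw [ENNReal.toReal_ofReal hθ0.le, hθ, le_div_iff₀ (by positivity)] at h10
      simp only [M, add_sub_cancel_right, one_pow]
      linarith)
  have hz : mv f (G ∩ (ball 0 (s₀ + 1 - 1 / 2))ᶜ) = 0 := by
    rcases (ENNReal.toReal_eq_zero_iff _).1 hM with h | h
    · exact h
    · exact absurd h (hMfin _)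
  refine (Metric.isBounded_closedBall (x := 0) (r := s₀ + 1)).subset fun x hx => ?_
  by_contra hcon
  have ho : IsOpen (G ∩ (closedBall (0 : EX n) (s₀ + 1))ᶜ) := hGo.inter isClosed_closedBall.isOpen_compl
  have hp := ho.measure_pos volume ⟨x, hx, hcon⟩
  have := hvol _ ho.measurableSet
  have h11 : mv f (G ∩ (closedBall (0 : EX n) (s₀ + 1))ᶜ) = 0 := by
    refine measure_mono_null (inter_subset_inter_right _ (compl_subset_compl.2 ?_)) hz
    exact ball_subset_closedBall.trans (closedBall_subset_closedBall (by linarith))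
  rw [h11] at this
  rcases mul_eq_zero.1 (le_antisymm this bot_le) with h | h
  · exact hi0 h
  · exact hp.ne' h



theorem mp_sphere_ne_top {n : ℕ} (hn : 1 ≤ n) {f : EX n → ℝ} (hf : Continuous f) (x : EX n) {r : ℝ} (hr : 0 < r) :
    mp f (sphere x r) ≠ ⊤ := by
  obtain ⟨C, hC, h⟩ := sphere_le hn
  obtain ⟨s, hs, hb⟩ := exists_upper hf x r
  refine ne_top_of_le_ne_top ?_ (wd_le (f := f) μH[n] Metric.isClosed_sphere.measurableSet (c := s) fun z hz => hb z (Metric.sphere_subset_closedBall hz))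
  exact ENNReal.mul_ne_top ENNReal.ofReal_ne_top (ne_top_of_le_ne_top (by finiteness) (h x r hr.le))

theorem fin_ball {n : ℕ} (hn : 1 ≤ n) {f : EX n → ℝ} (hf : Continuous f) (hpos : ∀ x, 0 < f x)
    (hinf : Tendsto f (Bornology.cobounded (EX n)) atTop) {V : ℝ} (hV : 0 < V) :
    ∃ U : Set (EX n), IsOpen U ∧ mv f U = ofReal V ∧ mp f (frontier U) ≠ ⊤ := by
  obtain ⟨i, hi, hlow⟩ := LOW hf hpos hinf
  have hc : Continuous fun r : ℝ => mv f (ball (0 : EX n) r) := by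
    rw [continuous_iff_continuousAt]
    intro y
    refine tendsto_measure_of_ae_tendsto_indicator _ isOpen_ball.measurableSet
      (fun i => isOpen_ball.measurableSet) (B := closedBall 0 (y + 1)) isClosed_closedBall.measurableSet
      (mv_ball_ne_top hf _ _) ?_ ?_
    · filter_upwards [Metric.ball_mem_nhds y one_pos] with j hj z hz
      rw [mem_ball, Real.dist_eq, abs_lt] at hj
      have := mem_ball.1 hz
      rw [mem_closedBall]
      linarith
    · have h0 : mv f (sphere 0 y) = 0 := mv_ac f (Measure.addHaar_sphere volume 0 y)
      filter_upwards [measure_eq_zero_iff_ae_notMem.1 h0] with z hz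
      have hz' : dist z 0 ≠ y := hz
      rcases lt_or_gt_of_ne hz' with h | h
      · filter_upwards [lt_mem_nhds h] with j hj
        simp only [mem_ball, hj, h]
      · filter_upwards [gt_mem_nhds h] with j hj
        simp only [mem_ball, hj.not_gt, h.not_gt]
  have hb0 := bvol_ne_zero n
  set b := (bvol n).toReal with hbb
  have hb : 0 < b := ENNReal.toReal_pos hb0 (bvol_ne_top n)
  have hbig : ∃ r : ℝ, 0 < r ∧ ofReal V ≤ mv f (ball (0 : EX n) r) := by
    refine ⟨V / (i * b) + 1, by positivity, le_trans ?_ (le_wd (f := f) volume isOpen_ball.measurableSet (c := i) fun z _ => hlow z)⟩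
    rw [vol_ball _ (by positivity), ← ENNReal.ofReal_toReal (bvol_ne_top n), ← ENNReal.ofReal_mul (by positivity), ← ENNReal.ofReal_mul hi.le]
    refine ENNReal.ofReal_le_ofReal ?_
    have h1 : V / (i * b) ≤ (V / (i * b) + 1) ^ (n + 1) := by
      refine le_trans ?_ (le_self_pow₀ (by linarith [show 0 < V / (i * b) by positivity]) (by omega))
      linarith
    rw [div_le_iff₀ (by positivity)] at h1
    linarith
  obtain ⟨r, hr, hrV⟩ := hbig
  obtain ⟨s, hs, hsV⟩ := intermediate_value_Icc hr.le hc.continuousOn ⟨by simp, hrV⟩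
  have hs0 : 0 < s := by
    by_contra h
    simp only [Metric.ball_eq_empty.2 (not_lt.1 h), measure_empty] at hsV
    have := ENNReal.ofReal_pos.2 hV
    rw [← hsV] at this
    exact this.ne rfl
  refine ⟨ball 0 s, isOpen_ball, hsV, ?_⟩
  rw [frontier_ball _ hs0.ne']
  exact mp_sphere_ne_top hn hf _ hs0

theorem AMV {n : ℕ} {f : EX n → ℝ} {G : Set (EX n)} {ε V : ℝ≥0∞} (hG : IsOpen G) (hV : mv f G = V)
    (h : ∀ U, IsOpen U → mv f U = V → mp f (frontier G) ≤ mp f (frontier U) + ε) : AM f G ε := by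
  refine ⟨hG, fun U hU h1 h2 => h U hU ?_⟩
  rw [← measure_inter_add_sdiff U hG.measurableSet, ← h1, inter_comm, measure_inter_add_sdiff G hU.measurableSet, hV]

theorem AMC {n : ℕ} {f : EX n → ℝ} (hf : Continuous f) (hpos : ∀ x, 0 < f x) {G : Set (EX n)} {ε : ℝ≥0∞} (hG : AM f G ε)
    (hP : mp f (frontier G) ≠ ⊤) : AM f (closure G)ᶜ ε := by
  refine ⟨isClosed_closure.isOpen_compl, fun U hU h1 h2 => ?_⟩
  have hfr : frontier (closure G)ᶜ ⊆ frontier G := by rw [frontier_compl]; exact frontier_closure_subset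
  by_cases hPU : mp f (frontier U) = ⊤
  · rw [hPU]; simp
  have hG0 := mv_ac f (vol_frontier hf hpos hP)
  have hU0 := mv_ac f (vol_frontier hf hpos hPU)
  have hz : ∀ᵐ z ∂(mv f), z ∉ frontier G ∧ z ∉ frontier U :=
    (measure_eq_zero_iff_ae_notMem.1 hG0).and (measure_eq_zero_iff_ae_notMem.1 hU0)
  have hGi := hG.1.interior_eq
  have e1 : mv f (G \ (closure U)ᶜ) = mv f (U \ (closure G)ᶜ) := by
    refine measure_congr ?_
    filter_upwards [hz] with z hz
    simp only [frontier, Set.mem_sdiff, hGi, hU.interior_eq, not_and, not_not] at hz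
    refine propext ⟨fun h => ⟨hz.2 (not_not.1 h.2), not_not.2 (subset_closure h.1)⟩, fun h => ⟨hz.1 (not_not.1 h.2), not_not.2 (subset_closure h.1)⟩⟩
  have e2 : mv f ((closure U)ᶜ \ G) = mv f ((closure G)ᶜ \ U) := by
    refine measure_congr ?_
    filter_upwards [hz] with z hz
    simp only [frontier, Set.mem_sdiff, hGi, hU.interior_eq, not_and, not_not] at hz
    refine propext ⟨fun h => ⟨fun h3 => h.2 (hz.1 h3), fun h3 => h.1 (subset_closure h3)⟩, fun h => ⟨fun h3 => h.2 (hz.2 h3), fun h3 => h.1 (subset_closure h3)⟩⟩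
  have := hG.2 (closure U)ᶜ isClosed_closure.isOpen_compl (by rw [e1, e2, h1]) (by rw [e1, ← h1]; exact h2)
  refine (measure_mono hfr).trans (this.trans ?_)
  gcongr
  rw [frontier_compl]; exact frontier_closure_subset

theorem PART2 {n : ℕ} (hn : 1 ≤ n) {f : EX n → ℝ} (hf : Continuous f) (hpos : ∀ x, 0 < f x)
    (hinf : Tendsto f (Bornology.cobounded (EX n)) atTop) (hZ : ZT f) {V : ℝ} (hV : 0 < V) {G : Set (EX n)}
    (hG : IsIsopRegion f G (ofReal V)) : Bornology.IsBounded G := by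
  obtain ⟨U, hU, hUV, hUP⟩ := fin_ball hn hf hpos hinf hV
  obtain ⟨h1, h2, h3⟩ := hG
  rw [wvol_eq] at h2
  have h4 : ∀ U, IsOpen U → mv f U = ofReal V → mp f (frontier G) ≤ mp f (frontier U) := by
    intro U hU hUV
    have := h3 U hU (by rw [wvol_eq, hUV])
    rwa [wper_eq, wper_eq] at this
  refine BDD hn hf hpos hinf hZ ⟨h1.measurableSet, tendsto_const_nhds, fun _ => AMV h1 h2
    (by simpa using h4), fun _ => ne_top_of_le_ne_top hUP (h4 U hU hUV), fun w R => ?_⟩ ?_ ?_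
  · simp
  · rw [h2]; simpa using hV
  · rw [h2]; exact ENNReal.ofReal_ne_top



theorem CPT {α : Type*} [MeasurableSpace α] {μ : Measure α} {G : ℕ → Set α} (hG : ∀ k, MeasurableSet (G k)) (hfin : ∀ k, μ (G k) ≠ ⊤)
    (H : ∀ ε : ℝ, 0 < ε → ∃ (ι : Type) (_ : Finite ι) (F : ℕ → Set ι), ∀ k l, F k = F l → μ (symmDiff (G k) (G l)) < ofReal ε) :
    ∃ E, MeasurableSet E ∧ ∃ φ : ℕ → ℕ, StrictMono φ ∧ Tendsto (fun k => μ (G (φ k) \ E ∪ E \ G (φ k))) atTop (𝓝 0) := by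
  let T : ℕ → Lp ℝ 1 μ := fun k => indicatorConstLp 1 (hG k) (hfin k) (1 : ℝ)
  have hTB : TotallyBounded (range T) := by
    refine Metric.totallyBounded_of_finite_discretization fun ε hε => ?_
    obtain ⟨ι, hι, F, hF⟩ := H ε hε
    have := Fintype.ofFinite (ULift (Set ι))
    refine ⟨ULift (Set ι), inferInstance, fun x => ⟨F x.2.choose⟩, fun x y hxy => ?_⟩
    have h := hF _ _ (congrArg ULift.down hxy)
    rw [← x.2.choose_spec, ← y.2.choose_spec, dist_indicatorConstLp_eq_norm, norm_indicatorConstLp one_ne_zero ENNReal.one_ne_top]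
    simpa [Measure.real] using ENNReal.toReal_lt_of_lt_ofReal h
  have hc : IsCompact (closure (range T)) := isCompact_iff_totallyBounded_isComplete.2 ⟨hTB.closure, isClosed_closure.isComplete⟩
  obtain ⟨g, -, φ, hφ, hlim⟩ := hc.tendsto_subseq (x := T) fun k => subset_closure ⟨k, rfl⟩
  refine ⟨{x | 1 / 2 < g x}, (Lp.stronglyMeasurable g).measurable measurableSet_Ioi, φ, hφ, ?_⟩
  have hlim' := (tendsto_iff_edist_tendsto_0.1 hlim)
  have h2 : Tendsto (fun k => 2 * edist ((T ∘ φ) k) g) atTop (𝓝 0) := by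
    simpa using ENNReal.Tendsto.const_mul hlim' (Or.inr (by simp : (2 : ℝ≥0∞) ≠ ⊤))
  refine tendsto_of_tendsto_of_tendsto_of_le_of_le tendsto_const_nhds h2 (fun _ => bot_le) fun k => ?_
  have h3 : edist ((T ∘ φ) k) g = ∫⁻ x, ‖T (φ k) x - g x‖ₑ ∂μ := by
    rw [Lp.edist_def, eLpNorm_one_eq_lintegral_enorm]; rfl
  have h4 := mul_meas_ge_le_lintegral₀ (μ := μ) (f := fun x => ‖T (φ k) x - g x‖ₑ)
    ((Lp.aestronglyMeasurable _).sub (Lp.aestronglyMeasurable _)).enorm (ofReal (1 / 2))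
  have h5 : μ (G (φ k) \ {x | 1 / 2 < g x} ∪ {x | 1 / 2 < g x} \ G (φ k)) ≤ μ {x | ofReal (1 / 2) ≤ ‖T (φ k) x - g x‖ₑ} := by
    refine measure_mono_ae ?_
    filter_upwards [indicatorConstLp_coeFn (p := 1) (hs := hG (φ k)) (hμs := hfin (φ k)) (c := (1 : ℝ))] with x hx hm
    change ofReal (1 / 2) ≤ ‖T (φ k) x - g x‖ₑ
    rw [show T (φ k) x = _ from hx, ← ofReal_norm]
    refine ENNReal.ofReal_le_ofReal ?_
    rw [Real.norm_eq_abs, le_abs]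
    rcases hm with ⟨h1, h2⟩ | ⟨h1, h2⟩
    · rw [indicator_of_mem h1]; simp only [mem_ofPred_eq, not_lt] at h2; left; linarith
    · rw [indicator_of_notMem h2]; simp only [mem_ofPred_eq] at h1; right; linarith
  change _ ≤ 2 * edist ((T ∘ φ) k) g
  rw [h3]
  calc _ ≤ 2 * (ofReal (1 / 2) * μ {x | ofReal (1 / 2) ≤ ‖T (φ k) x - g x‖ₑ}) := by
        rw [← mul_assoc, show (2 : ℝ≥0∞) * ofReal (1 / 2) = 1 by
          rw [show (2 : ℝ≥0∞) = ofReal 2 by simp, ← ENNReal.ofReal_mul (by norm_num)]; norm_num, one_mul]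
        exact h5
    _ ≤ _ := mul_le_mul_right h4 _

theorem CELL1 (n : ℕ) : ∃ C : ℝ≥0, 0 < C ∧ ∀ (δ : ℝ), 0 < δ → ∀ (K Ω : Set (EX n)) (x : EX n), Convex ℝ K →
    MeasurableSet K → ball x (δ / 2) ⊆ K → K ⊆ closedBall x ((n + 1) * δ) → MeasurableSet Ω →
    (volume K ≤ 2 * volume (Ω ∩ K) → volume (K \ Ω) ≤ C * ofReal δ * μH[n] (frontier Ω ∩ K)) ∧
    (¬ volume K ≤ 2 * volume (Ω ∩ K) → volume (Ω ∩ K) ≤ C * ofReal δ * μH[n] (frontier Ω ∩ K)) := by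
  obtain ⟨C, hC, h⟩ := RI n
  have hb := bvol_ne_top n
  have hb0 := bvol_ne_zero n
  set b := (bvol n).toNNReal with hbb
  have hbn : (b : ℝ≥0∞) = bvol n := ENNReal.coe_toNNReal hb
  have hbp : 0 < b := ENNReal.toNNReal_pos hb0 hb
  refine ⟨C * (n + 1) ^ (n + 2) * 2 ^ (n + 2) / b, by positivity, ?_⟩
  intro δ hδ K Ω x hK hKm hxK hKx hΩ
  have h1 := h K Ω x ((n + 1) * δ) (by positivity) hK hKm hKx hΩ
  have hvK : ofReal ((δ / 2) ^ (n + 1)) * b ≤ volume K := by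
    rw [hbn, ← vol_ball x (by positivity)]; exact measure_mono hxK
  lift δ to ℝ≥0 using hδ.le
  have hδ' : 0 < δ := by exact_mod_cast hδ
  have key : ∀ p q : ℝ≥0∞, volume K ≤ 2 * p → p * q ≤ C * ofReal (((n + 1) * δ) ^ (n + 2)) * μH[n] (frontier Ω ∩ K) →
      q ≤ ↑(C * (n + 1) ^ (n + 2) * 2 ^ (n + 2) / b) * ofReal δ * μH[n] (frontier Ω ∩ K) := by
    intro p q hp hpq
    have h3 : ofReal ((δ / 2) ^ (n + 1)) * b * q ≤ 2 * (C * ofReal (((n + 1) * δ) ^ (n + 2)) * μH[n] (frontier Ω ∩ K)) := by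
      refine le_trans ?_ (mul_le_mul_right hpq 2)
      rw [← mul_assoc]
      exact mul_le_mul_left (hvK.trans hp) _
    have e1 : ofReal (((δ : ℝ) / 2) ^ (n + 1)) * b = (((δ / 2) ^ (n + 1) * b : ℝ≥0) : ℝ≥0∞) := by
      rw [ENNReal.coe_mul]; congr 1
      rw [show ((δ : ℝ) / 2) ^ (n + 1) = (((δ / 2) ^ (n + 1) : ℝ≥0) : ℝ) by push_cast; rfl, ENNReal.ofReal_coe_nnreal]
    have e2 : ofReal ((((n : ℝ) + 1) * δ) ^ (n + 2)) = ((((n + 1) * δ) ^ (n + 2) : ℝ≥0) : ℝ≥0∞) := by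
      rw [show (((n : ℝ) + 1) * δ) ^ (n + 2) = ((((n + 1) * δ) ^ (n + 2) : ℝ≥0) : ℝ) by push_cast; rfl, ENNReal.ofReal_coe_nnreal]
    rw [e1, e2] at h3
    have h4 : (((δ / 2) ^ (n + 1) * b : ℝ≥0) : ℝ≥0∞) ≠ 0 := by simpa using ⟨hδ'.ne', hbp.ne'⟩
    rw [ENNReal.ofReal_coe_nnreal]
    generalize μH[n] (frontier Ω ∩ K) = m at h3 ⊢
    refine (ENNReal.mul_le_mul_iff_right h4 ENNReal.coe_ne_top).1 (h3.trans (le_of_eq ?_))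
    rw [show (2 : ℝ≥0∞) = ((2 : ℝ≥0) : ℝ≥0∞) by simp, ← mul_assoc, ← mul_assoc, ← mul_assoc, ← mul_assoc, ← ENNReal.coe_mul, ← ENNReal.coe_mul, ← ENNReal.coe_mul, ← ENNReal.coe_mul]
    congr 2
    rw [div_pow, mul_pow, pow_succ (2 : ℝ≥0) (n + 1), pow_succ δ (n + 1)]
    field_simp
  refine ⟨fun h2 => key _ _ h2 h1, fun h2 => key _ _ ?_ (by rwa [mul_comm])⟩
  have h5 := measure_inter_add_sdiff (μ := volume) K hΩ
  rw [inter_comm] at h5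
  push Not at h2
  have hf : volume (Ω ∩ K) ≠ ⊤ := ne_top_of_le_ne_top (measure_closedBall_lt_top (x := x) (r := (n + 1) * δ)).ne (measure_mono (inter_subset_right.trans hKx))
  rw [← h5, two_mul] at h2 ⊢
  exact add_le_add_left ((ENNReal.add_lt_add_iff_left hf).1 h2).le _

theorem CELL (n : ℕ) : ∃ C : ℝ≥0, 0 < C ∧ ∀ (δ R : ℝ), 0 < δ → ∃ (ι : Type) (_ : Finite ι) (F : Set (EX n) → Set ι),
    ∀ Ω Ω' : Set (EX n), MeasurableSet Ω → MeasurableSet Ω' → F Ω = F Ω' →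
      volume (symmDiff Ω Ω' ∩ ball 0 R) ≤ C * ofReal δ * (μH[n] (frontier Ω) + μH[n] (frontier Ω')) := by
  obtain ⟨C, hC, h⟩ := CELL1 n
  refine ⟨C, hC, fun δ R hδ => ?_⟩
  set N : ℤ := ⌈R / δ⌉ + 1
  let ι := Fin (n + 1) → Icc (-N) N
  let Q : ι → Set (EX n) := fun a => {x | ∀ j, ⌊x j / δ⌋ = a j}
  have hQ : ∀ a x, x ∈ Q a ↔ ∀ j, a j * δ ≤ x j ∧ x j < (a j + 1) * δ := by
    intro a x
    refine forall_congr' fun j => ?_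
    rw [Int.floor_eq_iff, le_div_iff₀ hδ, div_lt_iff₀ hδ]
  have hQm : ∀ a, MeasurableSet (Q a) := by
    intro a
    have : Q a = ⋂ j, {x : EX n | ⌊x j / δ⌋ = a j} := by ext; simp [Q]
    rw [this]
    refine MeasurableSet.iInter fun j => ?_
    exact (Int.measurable_floor.comp ((EuclideanSpace.proj (𝕜 := ℝ) j).continuous.measurable.div_const δ)) (measurableSet_singleton _)
  have hQd : Pairwise fun a b => Disjoint (Q a) (Q b) := by
    intro a b hab
    rw [Set.disjoint_left]
    intro x hx hy
    exact hab (funext fun j => Subtype.ext ((hx j).symm.trans (hy j)))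
  have hQc : ∀ a, Convex ℝ (Q a) := by
    intro a x hx y hy s t hs ht hst
    rw [hQ] at hx hy ⊢
    intro j
    obtain ⟨h1, h2⟩ := hx j
    obtain ⟨h3, h4⟩ := hy j
    simp only [PiLp.add_apply, PiLp.smul_apply, smul_eq_mul]
    obtain rfl : t = 1 - s := by linarith
    constructor
    · nlinarith
    · rcases hs.eq_or_lt with h | h
      · rw [← h]; linarith
      · nlinarith
  let c : ι → EX n := fun a => WithLp.toLp 2 fun j => (a j + 1 / 2) * δ
  have hcoord : ∀ (z : EX n) j, |z j| ≤ ‖z‖ := fun z j => PiLp.norm_apply_le z j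
  have hQb : ∀ a, ball (c a) (δ / 2) ⊆ Q a := by
    intro a x hx
    rw [hQ]
    intro j
    have h1 := (hcoord (x - c a) j).trans_lt (mem_ball_iff_norm.1 hx)
    rw [abs_lt] at h1
    simp only [PiLp.sub_apply, c] at h1
    constructor <;> linarith
  have hQs : ∀ a, Q a ⊆ closedBall (c a) ((n + 1) * δ) := by
    intro a x hx
    rw [hQ] at hx
    rw [mem_closedBall_iff_norm]
    have h1 : ∀ j, |(x - c a) j| ≤ δ := by
      intro j
      obtain ⟨h1, h2⟩ := hx j
      simp only [PiLp.sub_apply, c]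
      rw [abs_le]; constructor <;> linarith
    rw [EuclideanSpace.norm_eq]
    refine Real.sqrt_le_iff.2 ⟨by positivity, ?_⟩
    calc ∑ j, ‖(x - c a) j‖ ^ 2 ≤ ∑ j : Fin (n + 1), δ ^ 2 := Finset.sum_le_sum fun j _ => by
          rw [Real.norm_eq_abs]; gcongr; exact h1 j
      _ = (n + 1) * δ ^ 2 := by simp
      _ ≤ _ := by
        rw [mul_pow]; gcongr
        nlinarith [show (0 : ℝ) ≤ n by positivity]
  have hcov : ball (0 : EX n) R ⊆ ⋃ a, Q a := by
    intro x hx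
    have h1 : ∀ j, ⌊x j / δ⌋ ∈ Icc (-N) N := by
      intro j
      have h2 := (hcoord x j).trans_lt (mem_ball_zero_iff.1 hx)
      have h3 : |x j / δ| < R / δ := by rw [abs_div, abs_of_pos hδ]; gcongr
      rw [abs_lt] at h3
      have h4 := Int.le_ceil (R / δ)
      constructor
      · rw [Int.le_floor]; push_cast [N]; linarith
      · have : ⌊x j / δ⌋ < N := by rw [Int.floor_lt]; push_cast [N]; linarith
        exact this.le
    exact mem_iUnion.2 ⟨fun j => ⟨_, h1 j⟩, fun j => rfl⟩
  refine ⟨ι, inferInstance, fun Ω => {a | volume (Q a) ≤ 2 * volume (Ω ∩ Q a)}, fun Ω Ω' hΩ hΩ' hF => ?_⟩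
  have hcell : ∀ a, volume (symmDiff Ω Ω' ∩ Q a) ≤ C * ofReal δ * (μH[n] (frontier Ω ∩ Q a) + μH[n] (frontier Ω' ∩ Q a)) := by
    intro a
    have h1 := h δ hδ (Q a) Ω (c a) (hQc a) (hQm a) (hQb a) (hQs a) hΩ
    have h2 := h δ hδ (Q a) Ω' (c a) (hQc a) (hQm a) (hQb a) (hQs a) hΩ'
    have hiff : volume (Q a) ≤ 2 * volume (Ω ∩ Q a) ↔ volume (Q a) ≤ 2 * volume (Ω' ∩ Q a) := by
      have := Set.ext_iff.1 hF a
      simpa using this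
    rw [mul_add]
    by_cases hp : volume (Q a) ≤ 2 * volume (Ω ∩ Q a)
    · refine le_trans (measure_mono ?_) ((measure_union_le _ _).trans (add_le_add (h1.1 hp) (h2.1 (hiff.1 hp))))
      rintro x ⟨hx | hx, hxQ⟩
      · exact Or.inr ⟨hxQ, hx.2⟩
      · exact Or.inl ⟨hxQ, hx.2⟩
    · refine le_trans (measure_mono ?_) ((measure_union_le _ _).trans (add_le_add (h1.2 hp) (h2.2 fun h => hp (hiff.2 h))))
      rintro x ⟨hx | hx, hxQ⟩
      · exact Or.inl ⟨hx.1, hxQ⟩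
      · exact Or.inr ⟨hx.1, hxQ⟩
  have hsum : ∀ Ω : Set (EX n), ∑ a, μH[n] (frontier Ω ∩ Q a) ≤ μH[n] (frontier Ω) := by
    intro Ω
    rw [← tsum_fintype (L := .unconditional _), ← measure_iUnion (fun a b hab => (hQd hab).mono inter_subset_right inter_subset_right) fun a => isClosed_frontier.measurableSet.inter (hQm a)]
    exact measure_mono (iUnion_subset fun a => inter_subset_left)
  calc volume (symmDiff Ω Ω' ∩ ball 0 R) ≤ volume (⋃ a, symmDiff Ω Ω' ∩ Q a) := by
        rw [← inter_iUnion]; exact measure_mono (inter_subset_inter_right _ hcov)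
    _ ≤ ∑ a, volume (symmDiff Ω Ω' ∩ Q a) := measure_iUnion_fintype_le _ _
    _ ≤ ∑ a, C * ofReal δ * (μH[n] (frontier Ω ∩ Q a) + μH[n] (frontier Ω' ∩ Q a)) := Finset.sum_le_sum fun a _ => hcell a
    _ ≤ _ := by
      rw [← Finset.mul_sum, Finset.sum_add_distrib]
      gcongr
      · exact hsum Ω
      · exact hsum Ω'



theorem TAIL {n : ℕ} (hn : 1 ≤ n) {f : EX n → ℝ} (hf : Continuous f) (hpos : ∀ x, 0 < f x)
    (hinf : Tendsto f (Bornology.cobounded (EX n)) atTop) (hZ : ZT f) {V : ℝ} (hV : 0 < V) (M : ℝ≥0) (η : ℝ≥0) (hη : 0 < η) (hη1 : η ≤ 1) :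
    ∃ R : ℝ, ∀ G : Set (EX n), IsOpen G → mv f G = ofReal V → mp f (frontier G) ≤ M →
      mv f (G ∩ (closedBall 0 R)ᶜ) ≤ η := by
  obtain ⟨CI, hCI, hiso⟩ := ISO hn
  obtain ⟨CT, hCT, hT⟩ := T2c hn
  set D : ℝ≥0 := M + CT * V.toNNReal + 1 with hD
  have hD0 : 0 < D := by positivity
  obtain ⟨R, hR⟩ := hZ (η / (CI * D)) (by positivity)
  set vs : ℝ≥0∞ := ofReal ((1 / 10 : ℝ) ^ (n + 1)) * bvol n / 2 with hvs
  have hvs0 : vs ≠ 0 := by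
    rw [hvs]; refine ENNReal.div_ne_zero.2 ⟨mul_ne_zero ?_ (bvol_ne_zero n), by simp⟩
    simp
  have hvst : vs ≠ ⊤ := ENNReal.div_ne_top (ENNReal.mul_ne_top ENNReal.ofReal_ne_top (bvol_ne_top n)) (by simp)
  set v := vs.toReal
  have hv : 0 < v := ENNReal.toReal_pos hvs0 hvst
  have hev := hinf.eventually_ge_atTop (V / v + 1)
  obtain ⟨R', -, hR'⟩ := (Metric.hasBasis_cobounded_compl_closedBall (0 : EX n)).eventually_iff.1 hev
  set R₀ := max R R'
  refine ⟨R₀ + 1, fun G hG hGV hGM => ?_⟩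
  obtain ⟨s, hs, hTs⟩ := hT f hf.measurable hpos (fun z => dist z 0) (lip_dist 0) (closure G) isClosed_closure.measurableSet
    R₀ (R₀ + 1) (by linarith)
  have hfr := vol_frontier hf hpos (ne_top_of_le_ne_top ENNReal.coe_ne_top hGM)
  have hTs' : mp f (closure G ∩ (fun z => dist z 0) ⁻¹' {s}) ≤ CT * V.toNNReal := by
    refine hTs.trans ?_
    rw [mv_closure hfr, show R₀ + 1 - R₀ = 1 by ring, ENNReal.ofReal_one, div_one]
    gcongr
    exact (measure_mono inter_subset_left).trans hGV.le
  set K : Set (EX n) := (ball 0 s)ᶜ with hK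
  have hKi : interior K ⊆ (ball 0 s)ᶜ := interior_subset
  have hfrK : frontier K ⊆ (fun z => dist z 0) ⁻¹' {s} := by
    rw [hK, frontier_compl]; exact Metric.frontier_ball_subset_sphere
  have hP : mp f (frontier (G ∩ interior K)) ≤ D := by
    refine (measure_mono (frontier_inter_int G K)).trans ((measure_union_le _ _).trans ?_)
    calc _ ≤ (M : ℝ≥0∞) + CT * V.toNNReal := add_le_add ((measure_mono inter_subset_left).trans hGM)
            ((measure_mono (inter_subset_inter_right _ hfrK)).trans hTs')
      _ ≤ D := by rw [← ENNReal.coe_mul, ← ENNReal.coe_add, ENNReal.coe_le_coe, hD]; simp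
  have hms : MeasurableSet (G ∩ interior K) := (hG.inter isOpen_interior).measurableSet
  have hI := hiso f (G ∩ interior K) (1 / 10) (η / (CI * D)) (hG.inter isOpen_interior) (by norm_num) (by
      have h3 := le_wd (f := f) volume hms (c := V / v + 1) (by
        intro x hx
        refine hR' ?_
        intro hx'
        refine hKi hx.2 ?_
        have := mem_closedBall.1 hx'
        rw [mem_ball]
        linarith [hs.1, le_max_right R R'])
      have h4 : ofReal (V / v + 1) * volume (G ∩ interior K) ≤ ofReal V :=
        h3.trans ((measure_mono inter_subset_left).trans hGV.le)
      have h5 : ofReal V < ofReal (V / v + 1) * vs := by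
        rw [← ENNReal.ofReal_toReal hvst, ← ENNReal.ofReal_mul (by positivity), ENNReal.ofReal_lt_ofReal_iff (by positivity)]
        have : (V / v + 1) * v = V + v := by field_simp
        change V < (V / v + 1) * v
        linarith
      exact lt_of_mul_lt_mul_left' (h4.trans_lt h5)) (by
      intro x hx
      refine hR x ?_
      have := hKi hx.2
      rw [mem_compl_iff, mem_ball, dist_zero_right, not_lt] at this
      linarith [hs.1, le_max_left R R'])
  have h6 : ((CI : ℝ≥0∞) * ↑(η / (CI * D)) * mp f (frontier (G ∩ interior K))) ≤ η := by
    calc _ ≤ (CI : ℝ≥0∞) * ↑(η / (CI * D)) * D := by gcongr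
      _ = η := by rw [← ENNReal.coe_mul, ← ENNReal.coe_mul]; congr 1; field_simp
  have h7 : mv f (G ∩ interior K) ^ n ≤ (η : ℝ≥0∞) ^ n := by
    refine hI.trans ((pow_le_pow_left' h6 _).trans ?_)
    exact pow_le_pow_of_le_one bot_le (by exact_mod_cast hη1) (by omega)
  have h8 : mv f (G ∩ interior K) ≤ η := (ENNReal.pow_le_pow_left_iff (by omega)).1 h7
  refine (measure_mono (inter_subset_inter_right _ ?_)).trans h8
  refine interior_maximal ?_ isClosed_closedBall.isOpen_compl
  refine compl_subset_compl.2 (ball_subset_closedBall.trans (closedBall_subset_closedBall hs.2.le))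

theorem MINSEQ {n : ℕ} (hn : 1 ≤ n) {f : EX n → ℝ} (hf : Continuous f) (hpos : ∀ x, 0 < f x)
    (hinf : Tendsto f (Bornology.cobounded (EX n)) atTop) (hZ : ZT f) {V : ℝ} (hV : 0 < V) :
    ∃ (σ : ℝ≥0∞) (G : ℕ → Set (EX n)) (E : Set (EX n)) (ε : ℕ → ℝ≥0∞), MeasurableSet E ∧ mv f E = ofReal V ∧
      SEQ f G E ε ∧ SEQ f (fun k => (closure (G k))ᶜ) Eᶜ ε ∧ (∀ k, mp f (frontier (G k)) ≤ σ + ε k) ∧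
      ∀ U, IsOpen U → mv f U = ofReal V → σ ≤ mp f (frontier U) := by
  obtain ⟨U₀, hU₀, hUV, hUP⟩ := fin_ball hn hf hpos hinf hV
  obtain ⟨i, hi, hlow⟩ := LOW hf hpos hinf
  have hvol : ∀ A : Set (EX n), MeasurableSet A → ofReal i * volume A ≤ mv f A := fun A hA =>
    le_wd (f := f) volume hA fun z _ => hlow z
  set σ : ℝ≥0∞ := ⨅ U ∈ {U : Set (EX n) | IsOpen U ∧ mv f U = ofReal V}, mp f (frontier U) with hσ
  have hσle : ∀ U, IsOpen U → mv f U = ofReal V → σ ≤ mp f (frontier U) := fun U h1 h2 => iInf₂_le U ⟨h1, h2⟩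
  have hσt : σ ≠ ⊤ := ne_top_of_le_ne_top hUP (hσle _ hU₀ hUV)
  let e : ℕ → ℝ≥0∞ := fun k => ((k : ℝ≥0∞) + 1)⁻¹
  have he0 : ∀ k, e k ≠ 0 := fun k => ENNReal.inv_ne_zero.2 (by finiteness)
  have he1 : ∀ k, e k ≤ 1 := fun k => ENNReal.inv_le_one.2 (by simp)
  have het : Tendsto e atTop (𝓝 0) := by
    have := (tendsto_add_atTop_iff_nat 1).2 ENNReal.tendsto_inv_nat_nhds_zero
    simpa [e] using this
  have hex : ∀ k, ∃ U : Set (EX n), IsOpen U ∧ mv f U = ofReal V ∧ mp f (frontier U) ≤ σ + e k := by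
    intro k
    have h1 : σ < σ + e k := ENNReal.lt_add_right hσt (he0 k)
    conv_lhs at h1 => rw [hσ]
    obtain ⟨U, hU⟩ := iInf_lt_iff.1 h1
    obtain ⟨h3, h4⟩ := iInf_lt_iff.1 hU
    exact ⟨U, h3.1, h3.2, h4.le⟩
  choose G hGo hGV hGP using hex
  set M : ℝ≥0 := (σ + 1).toNNReal with hM
  have hMe : (M : ℝ≥0∞) = σ + 1 := ENNReal.coe_toNNReal (by finiteness)
  have hGM : ∀ k, mp f (frontier (G k)) ≤ M := fun k => by rw [hMe]; exact (hGP k).trans (by gcongr; exact he1 k)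
  have hGH : ∀ k, μH[n] (frontier (G k)) ≤ M / ofReal i := by
    intro k
    rw [ENNReal.le_div_iff_mul_le (Or.inl (by simpa using hi)) (Or.inl ENNReal.ofReal_ne_top), mul_comm]
    exact (le_wd (f := f) μH[n] isClosed_frontier.measurableSet (c := i) fun z _ => hlow z).trans (hGM k)
  obtain ⟨C, hC, hcell⟩ := CELL n
  obtain ⟨E, hE, φ, hφ, hlim⟩ := CPT (μ := mv f) (G := G) (fun k => (hGo k).measurableSet) (fun k => by rw [hGV k]; exact ENNReal.ofReal_ne_top) (by
    intro τ hτ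
    set η : ℝ≥0 := min 1 (Real.toNNReal (τ / 8)) with hηd
    have hη : 0 < η := by simp [hηd, hτ]
    obtain ⟨R, hR⟩ := TAIL hn hf hpos hinf hZ hV M η hη (min_le_left _ _)
    obtain ⟨b, hb, hub⟩ := exists_upper hf (0 : EX n) (R + 1)
    set N : ℝ := (M / ofReal i).toReal
    have hN : (M : ℝ≥0∞) / ofReal i = ofReal N :=
      (ENNReal.ofReal_toReal (ENNReal.div_ne_top ENNReal.coe_ne_top (by simpa using hi))).symm
    have hN0 : 0 ≤ N := ENNReal.toReal_nonneg
    obtain ⟨ι, hι, F, hF⟩ := hcell (τ / (8 * b * C * (N + 1))) (R + 1) (by positivity)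
    refine ⟨ι, hι, fun k => F (G k), fun k l hkl => ?_⟩
    have h1 := hF _ _ (hGo k).measurableSet (hGo l).measurableSet hkl
    have hsm : MeasurableSet (symmDiff (G k) (G l)) := (hGo k).measurableSet.symmDiff (hGo l).measurableSet
    have h2 : mv f (symmDiff (G k) (G l) ∩ ball 0 (R + 1)) ≤ ofReal (τ / 4) := by
      refine (wd_le (f := f) volume (hsm.inter isOpen_ball.measurableSet) (c := b) fun z hz => hub z (ball_subset_closedBall hz.2)).trans ?_
      refine (mul_le_mul_right (h1.trans (mul_le_mul_right (add_le_add (hGH k) (hGH l)) _)) _).trans ?_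
      rw [hN, ← ENNReal.ofReal_add hN0 hN0, show (C : ℝ≥0∞) = ofReal C by simp, ← ENNReal.ofReal_mul (by positivity), ← ENNReal.ofReal_mul (by positivity), ← ENNReal.ofReal_mul (by positivity)]
      refine ENNReal.ofReal_le_ofReal ?_
      have : b * (C * (τ / (8 * b * C * (N + 1))) * (N + N)) = τ / 4 * (N / (N + 1)) := by
        have : (C : ℝ) ≠ 0 := by exact_mod_cast hC.ne'
        field_simp; ring
      rw [this]
      have h3 : N / (N + 1) ≤ 1 := by rw [div_le_one (by positivity)]; linarith
      nlinarith
    have hη' : (η : ℝ≥0∞) ≤ ofReal (τ / 8) := by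
      rw [ofReal, ENNReal.coe_le_coe]; exact min_le_right _ _
    have h3 : symmDiff (G k) (G l) ⊆ (symmDiff (G k) (G l) ∩ ball 0 (R + 1)) ∪ ((G k ∩ (closedBall 0 R)ᶜ) ∪ (G l ∩ (closedBall 0 R)ᶜ)) := by
      intro z hz
      by_cases hzR : z ∈ closedBall (0 : EX n) R
      · exact Or.inl ⟨hz, Metric.closedBall_subset_ball (by linarith) hzR⟩
      · rcases hz with hz | hz
        · exact Or.inr (Or.inl ⟨hz.1, hzR⟩)
        · exact Or.inr (Or.inr ⟨hz.1, hzR⟩)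
    calc mv f (symmDiff (G k) (G l)) ≤ ofReal (τ / 4) + (ofReal (τ / 8) + ofReal (τ / 8)) := by
          refine (measure_mono h3).trans ((measure_union_le _ _).trans (add_le_add h2 ((measure_union_le _ _).trans (add_le_add ?_ ?_))))
          · exact (hR _ (hGo k) (hGV k) (hGM k)).trans hη'
          · exact (hR _ (hGo l) (hGV l) (hGM l)).trans hη'
      _ < ofReal τ := by
        rw [← ENNReal.ofReal_add (by positivity) (by positivity), ← ENNReal.ofReal_add (by positivity) (by positivity), ENNReal.ofReal_lt_ofReal_iff hτ]
        linarith)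
  have hEV : mv f E = ofReal V := by
    have hh : ∀ A B : Set (EX n), mv f A ≤ mv f B + mv f (A \ B ∪ B \ A) := by
      intro A B
      refine (measure_mono ?_).trans (measure_union_le _ _)
      intro z hz
      by_cases h : z ∈ B
      · exact Or.inl h
      · exact Or.inr (Or.inl ⟨hz, h⟩)
    refine le_antisymm ?_ ?_
    · refine ge_of_tendsto' (f := fun k => ofReal V + mv f (G (φ k) \ E ∪ E \ G (φ k))) (x := atTop) (by simpa using tendsto_const_nhds.add hlim) fun k => ?_
      rw [← hGV (φ k), union_comm]; exact hh _ _
    · refine ge_of_tendsto' (f := fun k => mv f E + mv f (G (φ k) \ E ∪ E \ G (φ k))) (x := atTop) (by simpa using tendsto_const_nhds.add hlim) fun k => ?_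
      rw [← hGV (φ k)]; exact hh _ _
  have hPk : ∀ k, mp f (frontier (G k)) ≠ ⊤ := fun k => ne_top_of_le_ne_top ENNReal.coe_ne_top (hGM k)
  have ham : ∀ k, AM f (G k) (e k) := fun k => AMV (hGo k) (hGV k) fun U hU hUV => (hGP k).trans (by gcongr; exact hσle U hU hUV)
  have hcv : ∀ w R, Tendsto (fun k => volume ((G (φ k) \ E ∪ E \ G (φ k)) ∩ ball w R)) atTop (𝓝 0) := by
    intro w R
    have h1 : Tendsto (fun k => mv f (G (φ k) \ E ∪ E \ G (φ k)) / ofReal i) atTop (𝓝 0) := by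
      have := ENNReal.Tendsto.div_const hlim (Or.inr (by simpa using hi : ofReal i ≠ 0))
      simpa using this
    refine tendsto_of_tendsto_of_tendsto_of_le_of_le tendsto_const_nhds h1 (fun _ => bot_le) fun k => ?_
    refine (measure_mono inter_subset_left).trans ?_
    change volume (G (φ k) \ E ∪ E \ G (φ k)) ≤ mv f (G (φ k) \ E ∪ E \ G (φ k)) / ofReal i
    rw [ENNReal.le_div_iff_mul_le (Or.inl (by simpa using hi)) (Or.inl ENNReal.ofReal_ne_top), mul_comm]
    exact hvol _ (((hGo _).measurableSet.diff hE).union (hE.diff (hGo _).measurableSet))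
  refine ⟨σ, G ∘ φ, E, e ∘ φ, hE, hEV, ⟨hE, het.comp hφ.tendsto_atTop, fun k => ham _, fun k => hPk _, hcv⟩,
    ⟨hE.compl, het.comp hφ.tendsto_atTop, fun k => AMC hf hpos (ham _) (hPk _), fun k => ?_, fun w R => ?_⟩, fun k => hGP _, hσle⟩
  · refine ne_top_of_le_ne_top (hPk (φ k)) (measure_mono ?_)
    rw [frontier_compl]; exact frontier_closure_subset
  · refine (hcv w R).congr fun k => ?_
    refine measure_congr ?_
    filter_upwards [measure_eq_zero_iff_ae_notMem.1 (vol_frontier hf hpos (hPk (φ k)))] with z hz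
    have hz' : z ∈ closure (G (φ k)) ↔ z ∈ G (φ k) := by
      refine ⟨fun h => ?_, fun h => subset_closure h⟩
      by_contra h3
      exact hz ⟨h, by rwa [(hGo _).interior_eq]⟩
    refine propext (and_congr_left' ?_)
    change (z ∈ G (φ k) ∧ z ∉ E ∨ z ∈ E ∧ z ∉ G (φ k)) ↔ (z ∉ closure (G (φ k)) ∧ ¬ z ∉ E ∨ z ∉ E ∧ ¬ z ∉ closure (G (φ k)))
    rw [hz']; tauto



def SG {n : ℕ} (E : Set (EX n)) : Set (EX n) :=
  {x | ∀ r, 0 < r → volume (E ∩ ball x r) ≠ 0 ∧ volume (ball x r \ E) ≠ 0}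

def RG {n : ℕ} (E : Set (EX n)) : Set (EX n) := {x | ∃ r, 0 < r ∧ volume (ball x r \ E) = 0}

theorem SG_compl {n : ℕ} (E : Set (EX n)) : SG Eᶜ = SG E := by
  ext x
  refine forall₂_congr fun r _ => ?_
  rw [inter_comm, Set.sdiff_eq _ Eᶜ, compl_compl, ← Set.sdiff_eq, and_comm, inter_comm E]

theorem isOpen_RG {n : ℕ} (E : Set (EX n)) : IsOpen (RG E) := by
  rw [Metric.isOpen_iff]
  rintro x ⟨r, hr, h⟩
  refine ⟨r / 2, by positivity, fun y hy => ⟨r / 2, by positivity, measure_mono_null (Set.sdiff_subset_sdiff_left ?_) h⟩⟩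
  exact ball_subset_ball' (by have := mem_ball.1 hy; linarith)

theorem mem_cases {n : ℕ} (E : Set (EX n)) (x : EX n) : x ∈ SG E ∨ x ∈ RG E ∨ x ∈ RG Eᶜ := by
  by_contra h
  push Not at h
  obtain ⟨h1, h2, h3⟩ := h
  refine h1 fun r hr => ⟨fun h => h3 ⟨r, hr, ?_⟩, fun h => h2 ⟨r, hr, h⟩⟩
  rwa [Set.sdiff_eq, compl_compl, inter_comm]

theorem RG_disj {n : ℕ} (E : Set (EX n)) : Disjoint (RG E) (RG Eᶜ) := by
  rw [Set.disjoint_left]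
  rintro x ⟨r, hr, h⟩ ⟨s, hs, h'⟩
  have h1 : ball x (min r s) ⊆ (ball x r \ E) ∪ (ball x s \ Eᶜ) := by
    intro z hz
    by_cases hzE : z ∈ E
    · exact Or.inr ⟨ball_subset_ball (min_le_right _ _) hz, fun h => h hzE⟩
    · exact Or.inl ⟨ball_subset_ball (min_le_left _ _) hz, hzE⟩
  exact (Metric.measure_ball_pos volume x (lt_min hr hs)).ne' (measure_mono_null h1 (measure_union_null h h'))

theorem SG_disj {n : ℕ} (E : Set (EX n)) : Disjoint (SG E) (RG E) := by
  rw [Set.disjoint_left]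
  rintro x hx ⟨r, hr, h⟩
  exact (hx r hr).2 h

theorem SG_eq {n : ℕ} (E : Set (EX n)) : SG E = (RG E ∪ RG Eᶜ)ᶜ := by
  refine Subset.antisymm (fun x hx => ?_) fun x hx => (mem_cases E x).resolve_right hx
  rintro (h | h)
  · exact Set.disjoint_left.1 (SG_disj E) hx h
  · rw [← SG_compl] at hx; exact Set.disjoint_left.1 (SG_disj Eᶜ) hx h

theorem isClosed_SG {n : ℕ} (E : Set (EX n)) : IsClosed (SG E) := by
  rw [SG_eq]; exact ((isOpen_RG E).union (isOpen_RG Eᶜ)).isClosed_compl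

theorem frontier_RG {n : ℕ} (E : Set (EX n)) : frontier (RG E) ⊆ SG E := by
  intro x hx
  rw [(isOpen_RG E).frontier_eq] at hx
  rw [SG_eq]
  rintro (h | h)
  · exact hx.2 h
  · exact Set.disjoint_left.1 ((RG_disj E).closure_left (isOpen_RG _)) hx.1 h

theorem RG_null {n : ℕ} (E : Set (EX n)) : volume (RG E \ E) = 0 := by
  refine measure_null_of_locally_null _ fun x hx => ?_
  obtain ⟨r, hr, h⟩ := hx.1
  refine ⟨(RG E \ E) ∩ ball x r, inter_mem self_mem_nhdsWithin (mem_nhdsWithin_of_mem_nhds (Metric.ball_mem_nhds x hr)), measure_mono_null ?_ h⟩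
  rintro z ⟨h1, h2⟩
  exact ⟨h2, h1.2⟩

theorem SITE {n : ℕ} (hn : 1 ≤ n) {E : Set (EX n)} (h1 : volume E ≠ 0) (h2 : volume Eᶜ ≠ 0) (x₀ : EX n) : ∃ w ∈ SG E, w ≠ x₀ := by
  by_contra hcon
  push Not at hcon
  have hr : 1 < Module.rank ℝ (EX n) := by
    rw [← Module.finrank_eq_rank, finrank_euclideanSpace_fin]
    exact_mod_cast (by omega : 1 < n + 1)
  have hc := (isConnected_compl_singleton_of_one_lt_rank hr x₀).isPreconnected
  have hsub : ({x₀}ᶜ : Set (EX n)) ⊆ RG E ∪ RG Eᶜ := fun x hx => (mem_cases E x).resolve_left fun h => hx (hcon x h)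
  have key : ∀ F : Set (EX n), ({x₀}ᶜ : Set (EX n)) ⊆ RG F → volume Fᶜ = 0 := by
    intro F hF
    refine measure_mono_null (t := (RG F \ F) ∪ {x₀}) ?_ (measure_union_null (RG_null F) (measure_singleton _))
    intro z hz
    by_cases h : z = x₀
    · exact Or.inr h
    · exact Or.inl ⟨hF h, hz⟩
  rcases hc.subset_or_subset (isOpen_RG _) (isOpen_RG _) (RG_disj E) hsub with h | h
  · exact h2 (key _ h)
  · have := key _ h
    rw [compl_compl] at this
    exact h1 this

theorem tend_of_symm {α : Type*} [MeasurableSpace α] {μ : Measure α} {G : ℕ → Set α} {F A : Set α}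
    (h : Tendsto (fun k => μ ((G k \ F ∪ F \ G k) ∩ A)) atTop (𝓝 0)) (hF : μ (F ∩ A) ≠ ⊤) :
    Tendsto (fun k => μ (G k ∩ A)) atTop (𝓝 (μ (F ∩ A))) := by
  have hh : ∀ P Q : Set α, μ (P ∩ A) ≤ μ (Q ∩ A) + μ ((P \ Q ∪ Q \ P) ∩ A) := by
    intro P Q
    refine (measure_mono ?_).trans (measure_union_le _ _)
    rintro z ⟨hz, hzA⟩
    by_cases h : z ∈ Q
    · exact Or.inl ⟨h, hzA⟩
    · exact Or.inr ⟨Or.inl ⟨hz, h⟩, hzA⟩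
  have hu : Tendsto (fun k => μ (F ∩ A) + μ ((G k \ F ∪ F \ G k) ∩ A)) atTop (𝓝 (μ (F ∩ A))) := by
    simpa using tendsto_const_nhds.add h
  have hl : Tendsto (fun k => μ (F ∩ A) - μ ((G k \ F ∪ F \ G k) ∩ A)) atTop (𝓝 (μ (F ∩ A))) := by
    simpa using ENNReal.Tendsto.sub tendsto_const_nhds h (Or.inl hF)
  refine tendsto_of_tendsto_of_tendsto_of_le_of_le hl hu (fun k => ?_) fun k => hh _ _
  rw [tsub_le_iff_right, union_comm]
  exact hh _ _

theorem mv_tend {n : ℕ} {f : EX n → ℝ} (hf : Continuous f) {G : ℕ → Set (EX n)} {F : Set (EX n)}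
    {ε : ℕ → ℝ≥0∞} (hS : SEQ f G F ε) {A : Set (EX n)} (hA : MeasurableSet A) {x : EX n} {R : ℝ} (hAx : A ⊆ ball x R) :
    Tendsto (fun k => mv f (G k ∩ A)) atTop (𝓝 (mv f (F ∩ A))) ∧ Tendsto (fun k => volume (G k ∩ A)) atTop (𝓝 (volume (F ∩ A))) := by
  obtain ⟨b, hb, hub⟩ := exists_upper hf x R
  have h0 : Tendsto (fun k => volume ((G k \ F ∪ F \ G k) ∩ A)) atTop (𝓝 0) :=
    tendsto_of_tendsto_of_tendsto_of_le_of_le tendsto_const_nhds (hS.conv x R) (fun _ => bot_le)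
      fun k => measure_mono (inter_subset_inter_right _ hAx)
  have h1 : Tendsto (fun k => ofReal b * volume ((G k \ F ∪ F \ G k) ∩ A)) atTop (𝓝 0) := by
    simpa using ENNReal.Tendsto.const_mul h0 (Or.inr ENNReal.ofReal_ne_top)
  refine ⟨tend_of_symm (tendsto_of_tendsto_of_tendsto_of_le_of_le tendsto_const_nhds h1 (fun _ => bot_le) fun k => ?_) ?_, tend_of_symm h0 ?_⟩
  · have hm := (hS.am k).1.measurableSet
    exact wd_le (f := f) volume (((hm.diff hS.meas).union (hS.meas.diff hm)).inter hA) fun z hz => hub z (ball_subset_closedBall (hAx hz.2))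
  · exact ne_top_of_le_ne_top (mv_ball_ne_top hf x R) (measure_mono (inter_subset_right.trans (hAx.trans ball_subset_closedBall)))
  · exact ne_top_of_le_ne_top (measure_ball_lt_top (x := x) (r := R)).ne (measure_mono (inter_subset_right.trans hAx))



theorem small_ball {n : ℕ} {f : EX n → ℝ} (hf : Continuous f) (x₀ : EX n) {τ : ℝ} (hτ : 0 < τ) :
    ∃ r, 0 < r ∧ mv f (closedBall x₀ r) < ofReal τ := by
  obtain ⟨b, hb, hub⟩ := exists_upper hf x₀ 1
  have hB : 0 < (bvol n).toReal := ENNReal.toReal_pos (bvol_ne_zero n) (bvol_ne_top n)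
  set B := (bvol n).toReal
  set r : ℝ := min 1 (τ / (2 * b * B)) with hr
  have hr0 : 0 < r := by positivity
  refine ⟨r, hr0, ?_⟩
  refine (wd_le (f := f) volume isClosed_closedBall.measurableSet (c := b) fun z hz => hub z (closedBall_subset_closedBall (min_le_left _ _) hz)).trans_lt ?_
  rw [vol_cball _ hr0.le, ← ENNReal.ofReal_toReal (bvol_ne_top n), ← ENNReal.ofReal_mul (by positivity), ← ENNReal.ofReal_mul hb.le, ENNReal.ofReal_lt_ofReal_iff hτ]
  have h1 : r ^ (n + 1) ≤ r := pow_le_of_le_one hr0.le (min_le_left _ _) (by omega)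
  have h2 : r ≤ τ / (2 * b * B) := min_le_right _ _
  rw [le_div_iff₀ (by positivity)] at h2
  have h3 : b * (r ^ (n + 1) * B) ≤ b * (r * B) := by gcongr
  change b * (r ^ (n + 1) * B) < τ
  linarith

theorem COMPL {n : ℕ} (hn : 1 ≤ n) {f : EX n → ℝ} (hf : Continuous f) (hpos : ∀ x, 0 < f x) {G : ℕ → Set (EX n)} {F : Set (EX n)}
    {ε : ℕ → ℝ≥0∞} (hS : SEQ f G F ε) {w x₀ : EX n} (hw : w ∈ SG F) (hwx : w ≠ x₀) {η : ℝ} (hη : 0 < η) :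
    ∃ r₁, 0 < r₁ ∧ r₁ ≤ 1 / 4 ∧ ∀ x ∈ ball x₀ r₁, ∀ ρ, 0 < ρ → ρ ≤ r₁ → mv f (F ∩ ball x ρ) ≠ 0 →
      ∀ᶠ k in atTop, ∀ s, ρ ≤ s → s ≤ r₁ → ∀ t, 0 ≤ t → mv f (G k ∩ closedBall x s) = ofReal (t ^ (n + 1)) →
        mp f (frontier (G k) ∩ interior (closedBall x s)) ≤ mp f (closure (G k) ∩ frontier (closedBall x s)) + ofReal (η * t ^ n) + ε k := by
  set R := dist w x₀ / 8 with hR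
  have hd : 0 < dist w x₀ := dist_pos.2 hwx
  have hR0 : 0 < R := by positivity
  obtain ⟨t₀, ht₀, hcomp⟩ := COMP hn hf hpos hS hR0 (hw R hR0).1 (hw R hR0).2 hη
  obtain ⟨r₂, hr₂, hsm⟩ := small_ball hf x₀ (show 0 < t₀ ^ (n + 1) by positivity)
  refine ⟨min (1 / 4) (min R (r₂ / 2)), by positivity, min_le_left _ _, fun x hx ρ hρ hρr hne => ?_⟩
  set r₁ := min (1 / 4) (min R (r₂ / 2))
  have hr1R : r₁ ≤ R := (min_le_right _ _).trans (min_le_left _ _)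
  have hr1r : r₁ ≤ r₂ / 2 := (min_le_right _ _).trans (min_le_right _ _)
  have hfin : mv f (F ∩ ball x ρ) ≠ ⊤ := ne_top_of_le_ne_top (mv_ball_ne_top hf x ρ) (measure_mono (inter_subset_right.trans ball_subset_closedBall))
  obtain ⟨tm, htm, htme⟩ := exists_root (n := n) (m := mv f (F ∩ ball x ρ) / 2) (ENNReal.div_ne_top hfin (by simp))
  have hne2 : mv f (F ∩ ball x ρ) / 2 ≠ 0 := ENNReal.div_ne_zero.2 ⟨hne, by simp⟩
  have htm' : 0 < tm := by
    rcases htm.eq_or_lt with h | h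
    · rw [← h] at htme; simp at htme; simp [htme] at hne2
    · exact h
  have hlt : mv f (F ∩ ball x ρ) / 2 < mv f (F ∩ ball x ρ) := ENNReal.half_lt_self hne hfin
  have hx' := mem_ball.1 hx
  filter_upwards [hcomp tm htm', (mv_tend hf hS isOpen_ball.measurableSet (Subset.refl (ball x ρ))).1.eventually (lt_mem_nhds hlt)] with k hk hk2 s hs1 hs2 t ht hte
  refine hk _ isClosed_closedBall ?_ t ?_ ?_ hte
  · refine Metric.ball_disjoint_closedBall ?_
    have := dist_triangle w x x₀
    linarith
  · have h1 : ofReal (tm ^ (n + 1)) ≤ ofReal (t ^ (n + 1)) := by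
      rw [← htme, ← hte]
      refine hk2.le.trans (measure_mono (inter_subset_inter_right _ (ball_subset_closedBall.trans (closedBall_subset_closedBall hs1))))
    rw [ENNReal.ofReal_le_ofReal_iff (by positivity)] at h1
    exact (pow_le_pow_iff_left₀ htm ht (by omega)).1 h1
  · have h1 : ofReal (t ^ (n + 1)) ≤ ofReal (t₀ ^ (n + 1)) := by
      rw [← hte]
      refine (measure_mono (inter_subset_right.trans (closedBall_subset_closedBall' ?_))).trans hsm.le
      linarith
    rw [ENNReal.ofReal_le_ofReal_iff (by positivity)] at h1
    exact (pow_le_pow_iff_left₀ ht ht₀.le (by omega)).1 h1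

theorem DEN {n : ℕ} (hn : 1 ≤ n) {f : EX n → ℝ} (hf : Continuous f) (hpos : ∀ x, 0 < f x) {G : ℕ → Set (EX n)} {F : Set (EX n)}
    {ε : ℕ → ℝ≥0∞} (hS : SEQ f G F ε) {w x₀ : EX n} (hw : w ∈ SG F) (hwx : w ≠ x₀) :
    ∃ r₁ c, 0 < r₁ ∧ 0 < c ∧ ∀ x ∈ ball x₀ r₁, ∀ r, 0 < r → r ≤ r₁ →
      mv f (F ∩ ball x r) ≤ ofReal (c * r ^ (n + 1)) → mv f (F ∩ ball x (r / 2)) = 0 := by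
  obtain ⟨CI, hCI, hiso⟩ := ISO hn
  obtain ⟨CT, hCT, hT⟩ := T2c hn
  obtain ⟨a, ha, hla⟩ := exists_lower hf hpos x₀ 10
  obtain ⟨b, hb, hub⟩ := exists_upper hf x₀ 10
  set κ : ℝ≥0 := Real.toNNReal ((b + 1) / a) with hκ
  have hκp : 0 < κ := by simp [hκ]; positivity
  have hκe : (κ : ℝ) = (b + 1) / a := Real.coe_toNNReal _ (by positivity)
  set c : ℝ≥0 := CI * κ with hc
  have hcp : 0 < c := by positivity
  obtain ⟨r₁, hr₁, hr14, hcomp⟩ := COMPL hn hf hpos hS hw hwx (η := ((1 / (2 * c) : ℝ≥0) : ℝ)) (by positivity)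
  set KK : ℝ := 4 * c * CT with hKK
  have hKK0 : 0 < KK := by positivity
  refine ⟨r₁, 1 / (2 ^ (n * (n + 1)) * (4 * KK) ^ (n + 1)), hr₁, by positivity, fun x hx r hr hrr hle => ?_⟩
  have hx' := mem_ball.1 hx
  have hfin : ∀ (A : Set (EX n)) s, mv f (A ∩ ball x s) ≠ ⊤ := fun A s => ne_top_of_le_ne_top (mv_ball_ne_top hf x s) (measure_mono (inter_subset_right.trans ball_subset_closedBall))
  let M : ℝ → ℝ := fun s => (mv f (F ∩ ball x s)).toReal
  have hI := ITER hn M (fun _ => ENNReal.toReal_nonneg) (fun s s' h => ENNReal.toReal_mono (hfin _ _)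
    (measure_mono (inter_subset_inter_right _ (ball_subset_ball h)))) hr hKK0 (by
    intro ρ₁ ρ₂ h1 h2 h3
    by_cases h0 : mv f (F ∩ ball x ρ₁) = 0
    · simp only [M, h0, ENNReal.toReal_zero, zero_pow (show n ≠ 0 by omega), zero_mul]; positivity
    have hd : 0 < ρ₂ - ρ₁ := by linarith
    have hev : ∀ᶠ k in atTop, mv f (G k ∩ ball x ρ₁) ^ n ≤
        (4 * c * (CT * mv f (G k ∩ ball x ρ₂) / ofReal (ρ₂ - ρ₁)) + 2 * c * ε k) ^ (n + 1) := by
      filter_upwards [hcomp x hx ρ₁ (by linarith) (by linarith) h0] with k hk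
      obtain ⟨s, hs, hTs⟩ := hT f hf.measurable hpos (fun z => dist z x) (lip_dist x) (closure (G k)) isClosed_closure.measurableSet ρ₁ ρ₂ h2
      rw [mv_closure (vol_frontier hf hpos (hS.fin k))] at hTs
      have hs0 : 0 < s := by linarith [hs.1]
      have hsfin : mv f (G k ∩ closedBall x s) ≠ ⊤ := ne_top_of_le_ne_top (mv_ball_ne_top hf x s) (measure_mono inter_subset_right)
      obtain ⟨t, ht, hte⟩ := exists_root (n := n) hsfin
      have hc1 := hk s hs.1.le (by linarith [hs.2]) t ht hte
      have hGo := (hS.am k).1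
      have hint : interior (closedBall x s) = ball x s := interior_closedBall x hs0.ne'
      have hmvint : mv f (G k ∩ interior (closedBall x s)) = mv f (G k ∩ closedBall x s) := by
        refine le_antisymm (measure_mono (inter_subset_inter_right _ interior_subset)) ?_
        rw [hint, ← Metric.ball_union_sphere, inter_union_distrib_left]
        refine (measure_union_le _ _).trans ?_
        rw [measure_mono_null inter_subset_right (mv_ac f (Measure.addHaar_sphere volume x s)), add_zero]
      have hI := hiso f (G k ∩ interior (closedBall x s)) 1 κ (hGo.inter isOpen_interior) one_pos (by
          refine (measure_mono (inter_subset_right.trans (interior_subset.trans (closedBall_subset_closedBall (show s ≤ 1 / 4 by linarith [hs.2]))))).trans_lt ?_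
          rw [vol_cball _ (by norm_num), one_pow, ENNReal.ofReal_one, one_mul, ENNReal.div_eq_inv_mul]
          refine (ENNReal.mul_lt_mul_iff_left (bvol_ne_zero n) (bvol_ne_top n)).2 ?_
          rw [show (2 : ℝ≥0∞)⁻¹ = ofReal (1 / 2) by rw [one_div, ENNReal.ofReal_inv_of_pos (by norm_num)]; simp, ENNReal.ofReal_lt_ofReal_iff (by norm_num)]
          exact (pow_le_of_le_one (by norm_num) (by norm_num) (by omega)).trans_lt (by norm_num : (1 / 4 : ℝ) < 1 / 2)) (by
          intro y hy
          have hy' := mem_closedBall.1 (interior_subset hy.2)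
          refine ⟨a, b, ha.le, hb.le, fun z hz => ?_, ?_⟩
          · have hz' : z ∈ closedBall x₀ 10 := by
              rw [mem_closedBall] at hz ⊢
              linarith [dist_triangle z y x₀, dist_triangle y x x₀, hs.2]
            exact ⟨hla z hz', hub z hz'⟩
          · rw [hκe, div_mul_cancel₀ _ ha.ne']
            calc b ^ n ≤ (b + 1) ^ n := by gcongr; linarith
              _ ≤ (b + 1) ^ (n + 1) := pow_le_pow_right₀ (by linarith) (by omega))
      rw [hmvint, hte, ← ENNReal.coe_mul, ← hc] at hI
      have hA := ABS (η := 1 / (2 * c)) ht (by rw [mul_one_div, div_le_div_iff₀ (by positivity) (by norm_num)]; ring_nf; rfl) hI hc1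
      have hX : mp f (closure (G k) ∩ frontier (closedBall x s)) ≤ CT * mv f (G k ∩ ball x ρ₂) / ofReal (ρ₂ - ρ₁) := by
        refine (measure_mono (inter_subset_inter_right _ Metric.frontier_closedBall_subset_sphere)).trans (hTs.trans ?_)
        gcongr
        intro z hz
        exact hz.2
      calc mv f (G k ∩ ball x ρ₁) ^ n ≤ ofReal (t ^ (n + 1)) ^ n := by
            rw [← hte]
            exact pow_le_pow_left' (measure_mono (inter_subset_inter_right _ (ball_subset_closedBall.trans (closedBall_subset_closedBall hs.1.le)))) _
        _ = ofReal (t ^ n) ^ (n + 1) := by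
            rw [← ENNReal.ofReal_pow (by positivity), ← pow_mul, mul_comm (n + 1), pow_mul, ENNReal.ofReal_pow (by positivity)]
        _ ≤ _ := pow_le_pow_left' (hA.trans (by gcongr)) _
    have hl := (mv_tend hf hS isOpen_ball.measurableSet (Subset.refl (ball x ρ₁))).1
    have hu := (mv_tend hf hS isOpen_ball.measurableSet (Subset.refl (ball x ρ₂))).1
    have hl' := ((ENNReal.continuous_pow n).tendsto _).comp hl
    have hd0 : ofReal (ρ₂ - ρ₁) ≠ 0 := by simpa using h2
    have hu' : Tendsto (fun k => (4 * c * (CT * mv f (G k ∩ ball x ρ₂) / ofReal (ρ₂ - ρ₁)) + 2 * c * ε k) ^ (n + 1)) atTop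
        (𝓝 ((4 * c * (CT * mv f (F ∩ ball x ρ₂) / ofReal (ρ₂ - ρ₁)) + 2 * c * 0) ^ (n + 1))) := by
      refine ((ENNReal.continuous_pow (n + 1)).tendsto _).comp (Tendsto.add ?_ ?_)
      · exact ENNReal.Tendsto.const_mul (ENNReal.Tendsto.div_const (ENNReal.Tendsto.const_mul hu (Or.inr ENNReal.coe_ne_top)) (Or.inr hd0)) (Or.inr (by finiteness))
      · exact ENNReal.Tendsto.const_mul hS.eps (Or.inr (by finiteness))
    have h6 := le_of_tendsto_of_tendsto hl' hu' hev
    rw [mul_zero, add_zero] at h6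
    have h7 := ENNReal.toReal_mono (by
        refine ENNReal.pow_ne_top (ENNReal.mul_ne_top (by finiteness) (ENNReal.div_ne_top (ENNReal.mul_ne_top (by simp) (hfin _ _)) hd0))) h6
    simp only [ENNReal.toReal_pow, ENNReal.toReal_mul, ENNReal.toReal_div, ENNReal.toReal_ofNat, ENNReal.coe_toReal,
        ENNReal.toReal_ofReal hd.le] at h7
    calc M ρ₁ ^ n * (ρ₂ - ρ₁) ^ (n + 1) ≤ (4 * c * (CT * M ρ₂ / (ρ₂ - ρ₁))) ^ (n + 1) * (ρ₂ - ρ₁) ^ (n + 1) := by gcongr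
      _ = _ := by rw [← mul_pow]; congr 1; rw [hKK]; field_simp) (by
    have h := ENNReal.toReal_mono ENNReal.ofReal_ne_top hle
    rw [ENNReal.toReal_ofReal (by positivity), one_div, inv_mul_eq_div, le_div_iff₀ (by positivity)] at h
    change 2 ^ (n * (n + 1)) * (4 * KK) ^ (n + 1) * (mv f (F ∩ ball x r)).toReal ≤ _
    linarith)
  rcases (ENNReal.toReal_eq_zero_iff _).1 hI with h | h
  · exact h
  · exact absurd h (hfin _ _)

theorem UPP {n : ℕ} (hn : 1 ≤ n) {f : EX n → ℝ} (hf : Continuous f) (hpos : ∀ x, 0 < f x) {G : ℕ → Set (EX n)} {F : Set (EX n)}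
    {ε : ℕ → ℝ≥0∞} (hS : SEQ f G F ε) {w x₀ : EX n} (hw : w ∈ SG F) (hwx : w ≠ x₀) :
    ∃ r₁ C, 0 < r₁ ∧ 0 < C ∧ ∀ x ∈ ball x₀ r₁, ∀ r, 0 < r → r ≤ r₁ →
      mv f (F ∩ ball x r) ≠ 0 → ∀ᶠ k in atTop, μH[n] (frontier (G k) ∩ ball x r) ≤ ofReal (C * r ^ n) := by
  obtain ⟨CS, hCS, hsph⟩ := sphere_le hn
  obtain ⟨a, ha, hla⟩ := exists_lower hf hpos x₀ 10
  obtain ⟨b, hb, hub⟩ := exists_upper hf x₀ 10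
  obtain ⟨r₁, hr₁, hr14, hcomp⟩ := COMPL hn hf hpos hS hw hwx one_pos
  have hB : 0 < (bvol n).toReal := ENNReal.toReal_pos (bvol_ne_zero n) (bvol_ne_top n)
  set B := (bvol n).toReal with hBd
  set L : ℝ := (b * B + 1) with hL
  have hL1 : 1 ≤ L := by rw [hL]; nlinarith
  refine ⟨r₁, (b * CS + L ^ n + 1) / a, hr₁, by positivity, fun x hx r hr hrr hne => ?_⟩
  have hx' := mem_ball.1 hx
  have hsub : closedBall x r ⊆ closedBall x₀ 10 := closedBall_subset_closedBall' (by linarith)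
  have hrn : (0 : ℝ≥0∞) < ofReal (r ^ n) := by simp; positivity
  filter_upwards [hcomp x hx r hr hrr hne, hS.eps.eventually (gt_mem_nhds hrn)] with k hk hek
  have hsfin : mv f (G k ∩ closedBall x r) ≠ ⊤ := ne_top_of_le_ne_top (mv_ball_ne_top hf x r) (measure_mono inter_subset_right)
  obtain ⟨t, ht, hte⟩ := exists_root (n := n) hsfin
  have h1 := hk r le_rfl hrr t ht hte
  rw [interior_closedBall x hr.ne'] at h1
  have htL : t ≤ L * r := by
    have h2 : ofReal (t ^ (n + 1)) ≤ ofReal (b * (r ^ (n + 1) * B)) := by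
      rw [← hte, ENNReal.ofReal_mul hb.le, ENNReal.ofReal_mul (by positivity), hBd, ENNReal.ofReal_toReal (bvol_ne_top n), ← vol_cball x hr.le]
      exact (measure_mono inter_subset_right).trans (wd_le (f := f) volume isClosed_closedBall.measurableSet fun z hz => hub z (hsub hz))
    rw [ENNReal.ofReal_le_ofReal_iff (by positivity)] at h2
    refine (pow_le_pow_iff_left₀ ht (by positivity) (show n + 1 ≠ 0 by omega)).1 (h2.trans ?_)
    rw [mul_pow]
    have h3 : b * B ≤ L ^ (n + 1) := le_trans (by linarith) (le_self_pow₀ hL1 (by omega))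
    nlinarith [pow_pos hr (n + 1)]
  have h4 : mp f (closure (G k) ∩ frontier (closedBall x r)) ≤ ofReal (b * (CS * r ^ n)) := by
    refine (measure_mono (inter_subset_right.trans Metric.frontier_closedBall_subset_sphere)).trans ?_
    refine (wd_le (f := f) μH[n] Metric.isClosed_sphere.measurableSet fun z hz => hub z (hsub (Metric.sphere_subset_closedBall hz))).trans ?_
    rw [ENNReal.ofReal_mul hb.le, ENNReal.ofReal_mul (by positivity), ENNReal.ofReal_coe_nnreal]
    gcongr
    exact hsph x r hr.le
  have h5 : mp f (frontier (G k) ∩ ball x r) ≤ ofReal ((b * CS + L ^ n + 1) * r ^ n) := by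
    refine h1.trans ?_
    calc _ ≤ ofReal (b * (CS * r ^ n)) + ofReal (1 * (L * r) ^ n) + ofReal (r ^ n) := by gcongr
      _ = _ := by
        rw [← ENNReal.ofReal_add (by positivity) (by positivity), ← ENNReal.ofReal_add (by positivity) (by positivity)]
        congr 1; rw [mul_pow]; ring
  have h6 := (le_wd (f := f) μH[n] (isClosed_frontier.measurableSet.inter isOpen_ball.measurableSet) (c := a) (A := frontier (G k) ∩ ball x r)
    fun z hz => hla z (hsub (ball_subset_closedBall hz.2))).trans h5
  rw [div_mul_eq_mul_div, ENNReal.ofReal_div_of_pos ha, ENNReal.le_div_iff_mul_le (Or.inl (by simpa using ha)) (Or.inl ENNReal.ofReal_ne_top), mul_comm]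
  exact h6



theorem DENV {n : ℕ} (hn : 1 ≤ n) {f : EX n → ℝ} (hf : Continuous f) (hpos : ∀ x, 0 < f x) {G : ℕ → Set (EX n)} {F : Set (EX n)}
    {ε : ℕ → ℝ≥0∞} (hS : SEQ f G F ε) {w x₀ : EX n} (hw : w ∈ SG F) (hwx : w ≠ x₀) :
    ∃ r₁ c C, 0 < r₁ ∧ 0 < c ∧ 0 < C ∧ ∀ x ∈ SG F, x ∈ ball x₀ r₁ → ∀ r, 0 < r → r ≤ r₁ →
      ofReal (c * r ^ (n + 1)) ≤ volume (F ∩ ball x r) ∧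
      ∀ᶠ k in atTop, μH[n] (frontier (G k) ∩ ball x r) ≤ ofReal (C * r ^ n) := by
  obtain ⟨r₁, c, hr₁, hc, hD⟩ := DEN hn hf hpos hS hw hwx
  obtain ⟨r₂, C, hr₂, hC, hU⟩ := UPP hn hf hpos hS hw hwx
  obtain ⟨b, hb, hub⟩ := exists_upper hf x₀ (2 * r₁)
  have hne : ∀ x ∈ SG F, ∀ r, 0 < r → mv f (F ∩ ball x r) ≠ 0 := by
    intro x hx r hr h0
    obtain ⟨i, hi, hl⟩ := exists_lower hf hpos x r
    have h := (le_wd (f := f) volume (hS.meas.inter isOpen_ball.measurableSet) (c := i) (A := F ∩ ball x r) fun z hz => hl z (ball_subset_closedBall hz.2)).trans_eq h0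
    rcases mul_eq_zero.1 (le_antisymm h bot_le) with h | h
    · simp at h; linarith
    · exact (hx r hr).1 h
  refine ⟨min r₁ r₂, c / b, C, by positivity, by positivity, hC, fun x hx hx1 r hr hrr => ⟨?_, ?_⟩⟩
  · have hx2 := ball_subset_ball (min_le_left _ _) hx1
    have h1 : ofReal (c * r ^ (n + 1)) ≤ mv f (F ∩ ball x r) := by
      by_contra h
      exact hne x hx (r / 2) (by positivity) (hD x hx2 r hr (hrr.trans (min_le_left _ _)) (not_le.1 h).le)
    have h2 := h1.trans (wd_le (f := f) volume (hS.meas.inter isOpen_ball.measurableSet) (c := b) fun z hz => hub z (by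
      have := mem_ball.1 hz.2
      have := mem_ball.1 hx2
      have := hrr.trans (min_le_left _ _)
      rw [mem_closedBall]
      linarith [dist_triangle z x x₀]))
    rw [div_mul_eq_mul_div, ENNReal.ofReal_div_of_pos hb]
    exact ENNReal.div_le_of_le_mul' h2
  · exact hU x (ball_subset_ball (min_le_right _ _) hx1) r hr (hrr.trans (min_le_right _ _)) (hne x hx r hr)

theorem LOC {n : ℕ} (hn : 1 ≤ n) {f : EX n → ℝ} (hf : Continuous f) (hpos : ∀ x, 0 < f x) {G : ℕ → Set (EX n)} {E : Set (EX n)}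
    {ε : ℕ → ℝ≥0∞} (hS : SEQ f G E ε) (hS' : SEQ f (fun k => (closure (G k))ᶜ) Eᶜ ε) (h1 : volume E ≠ 0) (h2 : volume Eᶜ ≠ 0) (x₀ : EX n) :
    ∃ r₁ c C, 0 < r₁ ∧ 0 < c ∧ 0 < C ∧ ∀ x ∈ SG E, x ∈ ball x₀ r₁ → ∀ r, 0 < r → r ≤ r₁ →
      ofReal (c * r ^ (n + 1)) ≤ volume (E ∩ ball x r) ∧
      ofReal (c * r ^ (n + 1)) ≤ volume (Eᶜ ∩ ball x r) ∧
      (∀ᶠ k in atTop, μH[n] (frontier (G k) ∩ ball x r) ≤ ofReal (C * r ^ n)) ∧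
      ∀ᶠ k in atTop, ofReal (c * r ^ n) ≤ μH[n] (frontier (G k) ∩ ball x r) := by
  obtain ⟨w, hw, hwx⟩ := SITE hn h1 h2 x₀
  obtain ⟨CR, hCR, hR⟩ := RIB n
  obtain ⟨r₁, c₁, C, hr₁, hc₁, hC, hA⟩ := DENV hn hf hpos hS hw hwx
  obtain ⟨r₂, c₂, C', hr₂, hc₂, hC', hB⟩ := DENV hn hf hpos hS' (SG_compl E ▸ hw) hwx
  rw [SG_compl] at hB
  set c := min c₁ c₂ with hc
  have hc0 : 0 < c := by positivity
  have key : ∀ x ∈ SG E, x ∈ ball x₀ (min r₁ r₂) → ∀ r, 0 < r → r ≤ min r₁ r₂ → ofReal (c * r ^ (n + 1)) ≤ volume (E ∩ ball x r) ∧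
      ofReal (c * r ^ (n + 1)) ≤ volume (Eᶜ ∩ ball x r) := by
    intro x hx hxb r hr hrr
    refine ⟨le_trans (ENNReal.ofReal_le_ofReal ?_) (hA x hx (ball_subset_ball (min_le_left _ _) hxb) r hr (hrr.trans (min_le_left _ _))).1,
      le_trans (ENNReal.ofReal_le_ofReal ?_) (hB x hx (ball_subset_ball (min_le_right _ _) hxb) r hr (hrr.trans (min_le_right _ _))).1⟩
    · gcongr; exact min_le_left _ _
    · gcongr; exact min_le_right _ _
  set d : ℝ := (c / 2) * (c / 2) / 2 ^ n / CR with hd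
  refine ⟨min r₁ r₂, min c d, C, by positivity, by positivity, hC, fun x hx hxb r hr hrr => ⟨?_, ?_, ?_, ?_⟩⟩
  · refine le_trans (ENNReal.ofReal_le_ofReal ?_) (key x hx hxb r hr hrr).1
    gcongr; exact min_le_left _ _
  · refine le_trans (ENNReal.ofReal_le_ofReal ?_) (key x hx hxb r hr hrr).2
    gcongr; exact min_le_left _ _
  · exact (hA x hx (ball_subset_ball (min_le_left _ _) hxb) r hr (hrr.trans (min_le_left _ _))).2
  · have hs : 0 < r / 2 := by positivity
    have hk := key x hx hxb (r / 2) hs (by linarith)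
    have hlt : ofReal (c / 2 * (r / 2) ^ (n + 1)) < ofReal (c * (r / 2) ^ (n + 1)) := by
      rw [ENNReal.ofReal_lt_ofReal_iff (by positivity)]
      have : 0 < c * (r / 2) ^ (n + 1) := by positivity
      linarith
    filter_upwards [(mv_tend hf hS isOpen_ball.measurableSet (Subset.refl (ball x (r / 2)))).2.eventually (lt_mem_nhds (hlt.trans_le hk.1)),
      (mv_tend hf hS' isOpen_ball.measurableSet (Subset.refl (ball x (r / 2)))).2.eventually (lt_mem_nhds (hlt.trans_le hk.2))] with k hk1 hk2
    have h := hR (G k) x (r / 2) (ofReal (c / 2)) (ofReal (c / 2)) hs (hS.am k).1.measurableSet (by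
      rw [← ENNReal.ofReal_mul (by positivity)]
      exact hk1.le.trans (measure_mono (inter_subset_inter_right _ ball_subset_closedBall))) (by
      rw [← ENNReal.ofReal_mul (by positivity)]
      refine hk2.le.trans (measure_mono fun z hz => ⟨ball_subset_closedBall hz.2, fun h => hz.1 (subset_closure h)⟩))
    have h3 : ofReal (d * r ^ n) ≤ μH[n] (frontier (G k) ∩ closedBall x (r / 2)) := by
      rw [hd, div_mul_eq_mul_div, ENNReal.ofReal_div_of_pos (by positivity)]
      refine ENNReal.div_le_of_le_mul' ?_
      rw [ENNReal.ofReal_coe_nnreal]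
      refine le_trans (le_of_eq ?_) h
      rw [← ENNReal.ofReal_mul (by positivity), ← ENNReal.ofReal_mul (by positivity)]
      congr 1; rw [div_pow]; ring
    refine le_trans (ENNReal.ofReal_le_ofReal ?_) (h3.trans (measure_mono (inter_subset_inter_right _ (Metric.closedBall_subset_ball (by linarith)))))
    gcongr; exact min_le_right _ _



theorem MAXSEP {X : Type*} [MetricSpace X] (S : Set X) {ε : ℝ} (hε : 0 < ε) (N : ℕ)
    (h : ∀ T : Finset X, (T : Set X) ⊆ S → (∀ a ∈ T, ∀ b ∈ T, a ≠ b → ε ≤ dist a b) → T.card ≤ N) :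
    ∃ T : Finset X, (T : Set X) ⊆ S ∧ (∀ a ∈ T, ∀ b ∈ T, a ≠ b → ε ≤ dist a b) ∧ S ⊆ ⋃ t ∈ T, ball t ε := by
  classical
  by_contra hcon
  push Not at hcon
  have : ∀ m : ℕ, ∃ T : Finset X, (T : Set X) ⊆ S ∧ (∀ a ∈ T, ∀ b ∈ T, a ≠ b → ε ≤ dist a b) ∧ T.card = m := by
    intro m
    induction m with
    | zero => exact ⟨∅, by simp⟩
    | succ m ih =>
      obtain ⟨T, h1, h2, h3⟩ := ih
      obtain ⟨y, hy, hyn⟩ := not_subset.1 (hcon T h1 h2)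
      simp only [mem_iUnion, mem_ball, not_exists, not_lt] at hyn
      refine ⟨insert y T, by simp [insert_subset_iff, hy, h1], ?_, ?_⟩
      · intro a ha b hb hab
        rw [Finset.mem_insert] at ha hb
        rcases ha with rfl | ha <;> rcases hb with rfl | hb
        · exact absurd rfl hab
        · exact hyn b hb
        · rw [dist_comm]; exact hyn a ha
        · exact h2 a ha b hb hab
      · by_cases hyT : y ∈ T
        · have h5 := hyn y hyT
          rw [dist_self] at h5
          linarith
        · rw [Finset.card_insert_of_notMem hyT, h3]
  obtain ⟨T, h1, h2, h3⟩ := this (N + 1)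
  have := h T h1 h2
  omega

theorem COV {n : ℕ} {G : ℕ → Set (EX n)} {E : Set (EX n)} {x₀ : EX n} {r₁ c C : ℝ} (hc : 0 < c) (hC : 0 < C)
    (h : ∀ x ∈ SG E, x ∈ ball x₀ r₁ → ∀ r, 0 < r → r ≤ r₁ →
      (∀ᶠ k in atTop, μH[n] (frontier (G k) ∩ ball x r) ≤ ofReal (C * r ^ n)) ∧
      ∀ᶠ k in atTop, ofReal (c * r ^ n) ≤ μH[n] (frontier (G k) ∩ ball x r))
    {x : EX n} (hx : x ∈ SG E) (hx0 : x ∈ ball x₀ (r₁ / 4)) {r ε : ℝ} (hε : 0 < ε) (hεr : ε ≤ r) (hr1 : r ≤ r₁ / 4) :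
    ∃ T : Finset (EX n), SG E ∩ ball x r ⊆ (⋃ t ∈ T, ball t ε) ∧ T.card * ε ^ n ≤ C / c * 4 ^ n * r ^ n := by
  have hr : 0 < r := by linarith
  have key : ∀ T : Finset (EX n), (T : Set (EX n)) ⊆ SG E ∩ ball x r → (∀ a ∈ T, ∀ b ∈ T, a ≠ b → ε ≤ dist a b) →
      T.card * ε ^ n ≤ C / c * 4 ^ n * r ^ n := by
    intro T hT hsep
    have hx0' := mem_ball.1 hx0
    have hTb : ∀ t ∈ T, t ∈ SG E ∧ dist t x < r := fun t ht => ⟨(hT ht).1, mem_ball.1 (hT ht).2⟩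
    have hev : ∀ᶠ k in atTop, ∀ t ∈ T, ofReal (c * (ε / 2) ^ n) ≤ μH[n] (frontier (G k) ∩ ball t (ε / 2)) := by
      rw [Finset.eventually_all]
      intro t ht
      refine (h t (hTb t ht).1 ?_ (ε / 2) (by positivity) (by linarith)).2
      rw [mem_ball]
      linarith [dist_triangle t x x₀, (hTb t ht).2]
    obtain ⟨k, hk1, hk2⟩ := (hev.and (h x hx (ball_subset_ball (by linarith) hx0) (2 * r) (by linarith) (by linarith)).1).exists
    have h1 : ofReal (T.card * (c * (ε / 2) ^ n)) ≤ ofReal (C * (2 * r) ^ n) := by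
      calc ofReal (T.card * (c * (ε / 2) ^ n)) = ∑ t ∈ T, ofReal (c * (ε / 2) ^ n) := by
            rw [Finset.sum_const, nsmul_eq_mul, ENNReal.ofReal_mul (by positivity), ENNReal.ofReal_natCast]
        _ ≤ ∑ t ∈ T, μH[n] (frontier (G k) ∩ ball t (ε / 2)) := Finset.sum_le_sum hk1
        _ = μH[n] (⋃ t ∈ T, frontier (G k) ∩ ball t (ε / 2)) := by
            refine (measure_biUnion_finset ?_ fun t _ => isClosed_frontier.measurableSet.inter isOpen_ball.measurableSet).symm
            intro a ha b hb hab
            refine Disjoint.mono inter_subset_right inter_subset_right (Metric.ball_disjoint_ball ?_)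
            linarith [hsep a ha b hb hab]
        _ ≤ _ := by
            refine (measure_mono ?_).trans hk2
            refine iUnion₂_subset fun t ht => inter_subset_inter_right _ (ball_subset_ball' ?_)
            linarith [(hTb t ht).2]
    rw [ENNReal.ofReal_le_ofReal_iff (by positivity), div_pow, mul_pow] at h1
    rw [div_mul_eq_mul_div, div_mul_eq_mul_div, le_div_iff₀ hc]
    have h4 : (4 : ℝ) ^ n = 2 ^ n * 2 ^ n := by rw [← mul_pow]; norm_num
    have h2 : (0 : ℝ) < 2 ^ n := by positivity
    calc (T.card : ℝ) * ε ^ n * c = T.card * (c * (ε ^ n / 2 ^ n)) * 2 ^ n := by field_simp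
      _ ≤ C * (2 ^ n * r ^ n) * 2 ^ n := by gcongr
      _ = _ := by rw [h4]; ring
  obtain ⟨T, h1, h2, h3⟩ := MAXSEP (SG E ∩ ball x r) hε ⌈C / c * 4 ^ n * r ^ n / ε ^ n⌉₊ (fun T h1 h2 => by
    have := key T h1 h2
    rw [← le_div_iff₀ (by positivity)] at this
    exact_mod_cast this.trans (Nat.le_ceil _))
  exact ⟨T, h3, key T h1 h2⟩

theorem HUP {n : ℕ} {A : Set (EX n)} {r K : ℝ} (hr : 0 < r)
    (h : ∀ ε, 0 < ε → ε ≤ r → ∃ T : Finset (EX n), A ⊆ (⋃ t ∈ T, ball t ε) ∧ T.card * ε ^ n ≤ K) :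
    μH[n] A ≤ ofReal (2 ^ n * K) := by
  have hpos : ∀ m : ℕ, 0 < r / ((m : ℝ) + 1) := fun m => by positivity
  choose T hT1 hT2 using fun m : ℕ => h (r / ((m : ℝ) + 1)) (hpos m) (div_le_self hr.le (by linarith [m.cast_nonneg (α := ℝ)]))
  have hd : ∀ m (t : EX n), ediam (ball t (r / ((m : ℕ) + 1 : ℝ))) ≤ ofReal (2 * (r / ((m : ℝ) + 1))) := fun m t => by
    rw [ENNReal.ofReal_mul (by norm_num), ENNReal.ofReal_ofNat, ← Metric.eball_ofReal]
    exact Metric.ediam_eball_le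
  have h0 : Tendsto (fun m : ℕ => ofReal (2 * (r / ((m : ℝ) + 1)))) atTop (𝓝 0) := by
    rw [← ENNReal.ofReal_zero]
    refine (ENNReal.continuous_ofReal.tendsto _).comp ?_
    have := (tendsto_one_div_add_atTop_nhds_zero_nat (𝕜 := ℝ)).const_mul (2 * r)
    rw [mul_zero] at this
    exact this.congr fun m => by ring
  refine (Measure.hausdorffMeasure_le_liminf_sum (n : ℝ) A _ h0 (fun m (t : T m) => ball (t : EX n) (r / ((m : ℝ) + 1)))
    (Eventually.of_forall fun m t => hd m t) (Eventually.of_forall fun m => ?_)).trans ?_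
  · refine (hT1 m).trans ?_
    rw [iUnion_subtype]
  · refine (liminf_le_liminf (Eventually.of_forall fun m => ?_) (v := fun _ => ofReal (2 ^ n * K))).trans (by simp)
    calc ∑ i : T m, ediam (ball (i : EX n) (r / ((m : ℝ) + 1))) ^ (n : ℝ) ≤ ∑ i : T m, ofReal (2 * (r / ((m : ℝ) + 1))) ^ n := by
          refine Finset.sum_le_sum fun i _ => ?_
          rw [ENNReal.rpow_natCast]
          exact pow_le_pow_left' (hd m i) n
      _ = ofReal (2 ^ n * ((T m).card * (r / ((m : ℝ) + 1)) ^ n)) := by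
          have := hpos m
          rw [Finset.sum_const, Finset.card_univ, Fintype.card_coe, nsmul_eq_mul, ← ENNReal.ofReal_pow (by positivity), ← ENNReal.ofReal_natCast, ← ENNReal.ofReal_mul (by positivity)]
          congr 1; rw [mul_pow]; ring
      _ ≤ _ := by
          refine ENNReal.ofReal_le_ofReal ?_
          gcongr
          exact hT2 m

theorem INB {n : ℕ} {E : Set (EX n)} {x : EX n} {r κ : ℝ} (hκ : 0 < κ * r) (h : volume {z ∈ ball x r | ∃ y ∈ SG E, dist z y < κ * r} < volume (E ∩ ball x r)) :
    ∃ p ∈ ball x r, ball p (κ * r) ⊆ RG E := by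
  have h0 := RG_null Eᶜ
  have h1 : ¬ (E ∩ ball x r ⊆ {z ∈ ball x r | ∃ y ∈ SG E, dist z y < κ * r} ∪ RG Eᶜ \ Eᶜ) := by
    intro hs
    have := (measure_mono (μ := volume) hs).trans (measure_union_le _ _)
    rw [h0, add_zero] at this
    exact absurd h (not_lt.2 this)
  obtain ⟨p, hp, hpn⟩ := not_subset.1 h1
  have hps : ∀ y ∈ SG E, κ * r ≤ dist p y := fun y hy => by
    by_contra hlt
    exact hpn (Or.inl ⟨hp.2, y, hy, not_le.1 hlt⟩)
  have hpR : p ∈ RG E := by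
    rcases mem_cases E p with h | h | h
    · have := hps p h
      rw [dist_self] at this; linarith
    · exact h
    · exact absurd (Or.inr ⟨h, fun h' => h' hp.1⟩) hpn
  refine ⟨p, hp.2, fun z hz => ?_⟩
  by_contra hzn
  obtain ⟨y, hy1, hy2⟩ := preconn_frontier (convex_ball p (κ * r)).isPreconnected (RG E) (Metric.mem_ball_self hκ) hz hpR hzn
  have := hps y (frontier_RG E hy2)
  rw [mem_ball, dist_comm] at hy1
  linarith

def AHP {n : ℕ} (E : Set (EX n)) : Prop := ∀ x₀ : EX n, ∃ r₁ κ C, 0 < r₁ ∧ 0 < κ ∧ 0 < C ∧ ∀ x ∈ SG E, x ∈ ball x₀ r₁ → ∀ r, 0 < r → r ≤ r₁ →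
      μH[n] (SG E ∩ ball x r) ≤ ofReal (C * r ^ n) ∧ (∃ p ∈ ball x r, ball p (κ * r) ⊆ RG E) ∧
      ∃ q ∈ ball x r, ball q (κ * r) ⊆ RG Eᶜ

theorem AHL {n : ℕ} (hn : 1 ≤ n) {f : EX n → ℝ} (hf : Continuous f) (hpos : ∀ x, 0 < f x) {G : ℕ → Set (EX n)} {E : Set (EX n)}
    {ε : ℕ → ℝ≥0∞} (hS : SEQ f G E ε) (hS' : SEQ f (fun k => (closure (G k))ᶜ) Eᶜ ε) (h1 : volume E ≠ 0) (h2 : volume Eᶜ ≠ 0) : AHP E := by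
  intro x₀
  obtain ⟨r₁, c, C, hr₁, hc, hC, hL⟩ := LOC hn hf hpos hS hS' h1 h2 x₀
  have hcov := @COV n G E x₀ r₁ c C hc hC fun x hx hxb r hr hrr => (hL x hx hxb r hr hrr).2.2
  have hB : 0 < (bvol n).toReal := ENNReal.toReal_pos (bvol_ne_zero n) (bvol_ne_top n)
  set B := (bvol n).toReal with hBd
  set M := 2 ^ (n + 1) * B * (C / c * 4 ^ n * 2 ^ n) with hM
  have hM0 : 0 < M := by positivity
  set κ : ℝ := min 1 (c / (2 * M)) with hκd
  have hκ : 0 < κ := by positivity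
  refine ⟨r₁ / 8, κ, 2 ^ n * (C / c * 4 ^ n), by positivity, hκ, by positivity, fun x hx hxb r hr hrr => ?_⟩
  have hxb4 : x ∈ ball x₀ (r₁ / 4) := ball_subset_ball (by linarith) hxb
  have hN : volume {z ∈ ball x r | ∃ y ∈ SG E, dist z y < κ * r} < ofReal (c * r ^ (n + 1)) := by
    have hκr : κ * r ≤ r := mul_le_of_le_one_left hr.le (min_le_left _ _)
    obtain ⟨T, hT1, hT2⟩ := hcov hx hxb4 (show 0 < κ * r by positivity) (show κ * r ≤ 2 * r by linarith) (by linarith)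
    have hsub : {z ∈ ball x r | ∃ y ∈ SG E, dist z y < κ * r} ⊆ ⋃ t ∈ T, ball t (2 * (κ * r)) := by
      rintro z ⟨hz, y, hy, hzy⟩
      have hyx : y ∈ ball x (2 * r) := by
        rw [mem_ball] at hz ⊢
        linarith [dist_triangle y z x, dist_comm y z]
      obtain ⟨t, ht, hyt⟩ := mem_iUnion₂.1 (hT1 ⟨hy, hyx⟩)
      refine mem_iUnion₂.2 ⟨t, ht, ?_⟩
      rw [mem_ball] at hyt ⊢
      linarith [dist_triangle z y t]
    refine (measure_mono hsub).trans_lt ((measure_biUnion_finset_le _ _).trans_lt ?_)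
    rw [Finset.sum_congr rfl fun t _ => vol_ball t (show 0 ≤ 2 * (κ * r) by positivity), Finset.sum_const, nsmul_eq_mul, ← ENNReal.ofReal_toReal (bvol_ne_top n),
      ← ENNReal.ofReal_natCast, ← ENNReal.ofReal_mul (by positivity), ← ENNReal.ofReal_mul (by positivity), ENNReal.ofReal_lt_ofReal_iff (by positivity), ← hBd]
    have h3 : κ * (2 * M) ≤ c := (le_div_iff₀ (by positivity)).1 (min_le_right _ _)
    calc (T.card : ℝ) * ((2 * (κ * r)) ^ (n + 1) * B) = (T.card * (κ * r) ^ n) * (2 ^ (n + 1) * B * (κ * r)) := by rw [mul_pow, pow_succ (κ * r)]; ring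
      _ ≤ (C / c * 4 ^ n * (2 * r) ^ n) * (2 ^ (n + 1) * B * (κ * r)) := by gcongr
      _ = κ * M * r ^ (n + 1) := by rw [hM, mul_pow, pow_succ r]; ring
      _ < c * r ^ (n + 1) := by
        gcongr
        nlinarith [mul_pos hκ hM0]
  have hκr : 0 < κ * r := by positivity
  have hl := hL x hx (ball_subset_ball (by linarith) hxb) r hr (by linarith)
  refine ⟨?_, INB hκr (hN.trans_le hl.1), INB hκr (by rw [SG_compl]; exact hN.trans_le hl.2.1)⟩
  rw [mul_assoc]
  exact HUP hr fun ε hε hεr => hcov hx hxb4 hε hεr (by linarith)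

theorem SG_fin {n : ℕ} {E : Set (EX n)} (h : AHP E) (x₀ : EX n) : ∃ r, 0 < r ∧ μH[n] (SG E ∩ ball x₀ r) ≠ ⊤ := by
  by_cases hx : x₀ ∈ SG E
  · obtain ⟨r₁, κ, C, hr, hκ, hC, hh⟩ := h x₀
    exact ⟨r₁, hr, ne_top_of_le_ne_top ENNReal.ofReal_ne_top (hh x₀ hx (Metric.mem_ball_self hr) r₁ hr le_rfl).1⟩
  · obtain ⟨r, hr, hs⟩ := Metric.isOpen_iff.1 (isClosed_SG E).isOpen_compl x₀ hx
    refine ⟨r, hr, ?_⟩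
    rw [show SG E ∩ ball x₀ r = ∅ from Set.eq_empty_of_forall_notMem fun z hz => hs hz.2 hz.1]
    simp

theorem SG_lf {n : ℕ} {E : Set (EX n)} (h : AHP E) : IsLocallyFiniteMeasure ((μH[n] : Measure (EX n)).restrict (SG E)) := by
  refine ⟨fun x => ?_⟩
  obtain ⟨r, hr, hh⟩ := SG_fin h x
  refine ⟨ball x r, Metric.ball_mem_nhds x hr, ?_⟩
  rw [Measure.restrict_apply isOpen_ball.measurableSet, inter_comm]
  exact hh.lt_top

theorem SG_null {n : ℕ} {E : Set (EX n)} (h : AHP E) : volume (SG E) = 0 := by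
  refine measure_null_of_locally_null _ fun x hx => ?_
  obtain ⟨r, hr, hh⟩ := SG_fin h x
  exact ⟨_, inter_mem_nhdsWithin _ (Metric.ball_mem_nhds x hr), vol_zero_of_muH hh⟩



theorem GG1 {n : ℕ} {φ : EX n → ℝ} (hφ : ContDiff ℝ 1 φ) (hc : HasCompactSupport φ) (Ω : Set (EX n)) (v : EX n) (s₀ : ℝ) :
    HasDerivAt (fun s : ℝ => ∫ z in Ω, φ (z + s • v)) (∫ z in Ω, fderiv ℝ φ (z + s₀ • v) v) s₀ := by
  have hd : Continuous (fderiv ℝ φ) := hφ.continuous_fderiv one_ne_zero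
  obtain ⟨M, hM⟩ := (hc.fderiv ℝ).exists_bound_of_continuous hd
  obtain ⟨R, hR⟩ := hc.isCompact.isBounded.subset_closedBall (0 : EX n)
  set R' := R + (|s₀| + 1) * ‖v‖ with hR'
  have hM0 : 0 ≤ M := (norm_nonneg _).trans (hM 0)
  refine (hasDerivAt_integral_of_dominated_loc_of_deriv_le (F := fun s z => φ (z + s • v)) (F' := fun s z => fderiv ℝ φ (z + s • v) v)
    (bound := (closedBall (0 : EX n) R').indicator fun _ => M * ‖v‖) (Metric.ball_mem_nhds s₀ one_pos) ?_ ?_ ?_ ?_ ?_ ?_).2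
  · exact Eventually.of_forall fun s => (hφ.continuous.comp (by fun_prop)).aestronglyMeasurable
  · exact ((hφ.continuous.integrable_of_hasCompactSupport hc).comp_add_right (s₀ • v)).integrableOn
  · exact ((hd.comp (by fun_prop : Continuous fun z : EX n => z + s₀ • v)).clm_apply continuous_const).aestronglyMeasurable
  · refine Eventually.of_forall fun z s hs => ?_
    by_cases hz : z ∈ closedBall (0 : EX n) R'
    · rw [indicator_of_mem hz]
      exact (ContinuousLinearMap.le_opNorm _ _).trans (by gcongr; exact hM _)
    · rw [indicator_of_notMem hz]
      have : fderiv ℝ φ (z + s • v) = 0 := by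
        by_contra h
        have h1 := hR (support_fderiv_subset ℝ h)
        refine hz ?_
        rw [mem_closedBall_zero_iff] at h1 ⊢
        have h2 : ‖z‖ ≤ ‖z + s • v‖ + ‖s • v‖ := by simpa using norm_sub_le (z + s • v) (s • v)
        have h3 : ‖s • v‖ ≤ (|s₀| + 1) * ‖v‖ := by
          rw [norm_smul]
          gcongr
          have h4 := mem_ball.1 hs
          rw [Real.dist_eq] at h4
          rw [Real.norm_eq_abs]
          linarith [abs_add_le (s - s₀) s₀, show s - s₀ + s₀ = s by ring, congrArg abs (show s - s₀ + s₀ = s by ring)]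
        linarith
      rw [this]; simp
  · refine (IntegrableOn.integrable_indicator ?_ isClosed_closedBall.measurableSet).integrableOn
    exact integrableOn_const (hs := measure_closedBall_lt_top.ne)
  · refine Eventually.of_forall fun z s _ => ?_
    have h1 : HasFDerivAt φ (fderiv ℝ φ (z + s • v)) (z + s • v) := (hφ.differentiable one_ne_zero _).hasFDerivAt
    have h2 : HasDerivAt (fun s : ℝ => z + s • v) v s := by
      simpa using ((hasDerivAt_id s).smul_const v).const_add z
    exact h1.comp_hasDerivAt s h2

theorem GG2a (n : ℕ) : ∃ C : ℝ≥0, 0 < C ∧ ∀ (S Ω : Set (EX n)), IsClosed S → IsOpen Ω → frontier Ω ⊆ S → ∀ (φ : EX n → ℝ) (L : ℝ≥0) (R : ℝ) (v : EX n),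
    LipschitzWith L φ → HasCompactSupport φ → Function.support φ ⊆ closedBall 0 R → v ≠ 0 →
    ‖(∫ z in Ω, φ (z + v)) - ∫ z in Ω, φ z‖ₑ ≤ C * ofReal ‖v‖ * (∫⁻ z in S, ‖φ z‖ₑ ∂μH[n] + ofReal (L * ‖v‖) * μH[n] (S ∩ closedBall 0 (R + ‖v‖))) := by
  obtain ⟨C, hC, hT⟩ := T1 n
  refine ⟨C, hC, fun S Ω hS hΩ hfr φ L R v hL hc hR hv => ?_⟩
  have hφi : Integrable φ volume := hL.continuous.integrable_of_hasCompactSupport hc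
  set D : Set (EX n) := ((fun z => z - v) ⁻¹' Ω \ Ω) ∪ (Ω \ (fun z => z - v) ⁻¹' Ω) with hD
  have hΩ' : MeasurableSet ((fun z => z - v) ⁻¹' Ω) := (hΩ.preimage (by fun_prop)).measurableSet
  have hDm : MeasurableSet D := (hΩ'.diff hΩ.measurableSet).union (hΩ.measurableSet.diff hΩ')
  have h1 : (∫ z in Ω, φ (z + v)) - ∫ z in Ω, φ z = ∫ z, (((fun z => z - v) ⁻¹' Ω).indicator φ z - Ω.indicator φ z) := by
    rw [integral_sub (hφi.indicator hΩ') (hφi.indicator hΩ.measurableSet), integral_indicator hΩ.measurableSet, ← integral_indicator hΩ.measurableSet,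
      ← integral_sub_right_eq_self _ v]
    congr 1
    refine integral_congr_ae (Eventually.of_forall fun z => ?_)
    simp [indicator]; rfl
  have h2 : ‖(∫ z in Ω, φ (z + v)) - ∫ z in Ω, φ z‖ₑ ≤ ∫⁻ z in D, ofReal |φ z| := by
    rw [h1, ← lintegral_indicator hDm]
    refine (enorm_integral_le_lintegral_enorm _).trans (lintegral_mono fun z => ?_)
    by_cases ha : z ∈ (fun z => z - v) ⁻¹' Ω <;> by_cases hb : z ∈ Ω
    · simp [ha, hb]
    · have : z ∈ D := Or.inl ⟨ha, hb⟩
      rw [indicator_of_mem ha, indicator_of_notMem hb, indicator_of_mem this, sub_zero, ← Real.norm_eq_abs, ofReal_norm]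
    · have : z ∈ D := Or.inr ⟨hb, ha⟩
      rw [indicator_of_notMem ha, indicator_of_mem hb, indicator_of_mem this, zero_sub, enorm_neg, ← Real.norm_eq_abs, ofReal_norm]
    · simp [ha, hb]
  refine h2.trans ?_
  set K := closedBall (0 : EX n) (R + ‖v‖) with hK
  set ψ : EX n → ℝ := K.indicator fun z => |φ z| + L * ‖v‖ with hψ
  have hψ0 : ∀ z, 0 ≤ ψ z := fun z => indicator_nonneg (fun z _ => by positivity) z
  have hψm : Measurable ψ := (by have := hL.continuous; fun_prop : Continuous fun z => |φ z| + L * ‖v‖).measurable.indicator isClosed_closedBall.measurableSet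
  have h3 : ∀ t ∈ Ioi (0 : ℝ), (volume.restrict D) {z | t < |φ z|} ≤ C * ofReal ‖v‖ * (μH[n].restrict S) {z | t < ψ z} := by
    intro t ht
    rw [Measure.restrict_apply (measurableSet_lt measurable_const (by have := hL.continuous.measurable; fun_prop)), Measure.restrict_apply (measurableSet_lt measurable_const hψm)]
    refine (measure_mono ?_).trans ((hT (-v) _ (neg_ne_zero.2 hv)).trans_eq (by rw [norm_neg]))
    rintro z ⟨hzt, hzD⟩
    have hz : z ∈ tube (-v) (frontier Ω) := by
      rcases hzD with h | h
      · rw [← frontier_compl]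
        have := seg_frontier (K := univ) (Ω := Ωᶜ) convex_univ (a := z) (v := -v) (mem_univ _) (mem_univ _) h.2 (by rw [← sub_eq_add_neg]; exact not_not.2 h.1)
        rwa [inter_univ] at this
      · have := seg_frontier (K := univ) (Ω := Ω) convex_univ (a := z) (v := -v) (mem_univ _) (mem_univ _) h.1 (by rw [← sub_eq_add_neg]; exact h.2)
        rwa [inter_univ] at this
    obtain ⟨s, hs, hzs⟩ := hz
    refine ⟨s, hs, ?_, hfr hzs⟩
    have hsv : ‖s • -v‖ ≤ ‖v‖ := by
      rw [norm_smul, norm_neg, Real.norm_of_nonneg hs.1]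
      exact mul_le_of_le_one_left (norm_nonneg _) hs.2
    have hzR : ‖z‖ ≤ R := by
      rw [← mem_closedBall_zero_iff]
      refine hR fun h0 => ?_
      rw [mem_ofPred_eq, h0, abs_zero] at hzt
      exact absurd hzt (not_lt.2 (le_of_lt ht))
    have hmem : z + s • -v ∈ K := by
      rw [hK, mem_closedBall_zero_iff]
      linarith [norm_add_le z (s • -v)]
    rw [mem_ofPred_eq, hψ, indicator_of_mem hmem]
    have h4 := hL.dist_le_mul z (z + s • -v)
    rw [Real.dist_eq, dist_self_add_right] at h4
    have h5 : |φ z| ≤ |φ (z + s • -v)| + |φ z - φ (z + s • -v)| := by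
      have := abs_sub_abs_le_abs_sub (φ z) (φ (z + s • -v)); linarith
    have h6 : (L : ℝ) * ‖s • -v‖ ≤ L * ‖v‖ := by gcongr
    exact lt_of_lt_of_le hzt (by linarith)
  rw [lintegral_eq_lintegral_meas_lt _ (Eventually.of_forall fun z => abs_nonneg _) (by have := hL.continuous.measurable; fun_prop)]
  refine (setLIntegral_mono' measurableSet_Ioi h3).trans ?_
  rw [lintegral_const_mul' _ _ (by finiteness), ← lintegral_eq_lintegral_meas_lt _ (Eventually.of_forall hψ0) hψm.aemeasurable]
  gcongr
  calc ∫⁻ z in S, ofReal (ψ z) ∂μH[n] ≤ ∫⁻ z in S, (‖φ z‖ₑ + K.indicator (fun _ => ofReal (L * ‖v‖)) z) ∂μH[n] := by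
        refine lintegral_mono fun z => ?_
        by_cases hz : z ∈ K
        · simp only [hψ, indicator_of_mem hz]
          rw [ENNReal.ofReal_add (abs_nonneg _) (by positivity), ← Real.norm_eq_abs, ofReal_norm]
        · simp [hψ, indicator_of_notMem hz]
    _ = _ := by
        rw [lintegral_add_right _ (measurable_const.indicator isClosed_closedBall.measurableSet), lintegral_indicator isClosed_closedBall.measurableSet, setLIntegral_const,
          Measure.restrict_apply isClosed_closedBall.measurableSet, inter_comm]

theorem GG2 (n : ℕ) : ∃ C : ℝ≥0, 0 < C ∧ ∀ (S Ω : Set (EX n)), IsClosed S → IsOpen Ω → frontier Ω ⊆ S → IsLocallyFiniteMeasure ((μH[n] : Measure (EX n)).restrict S) →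
    ∀ (φ : EX n → ℝ) (v : EX n), ContDiff ℝ 1 φ → HasCompactSupport φ →
    ‖∫ z in Ω, fderiv ℝ φ z v‖ₑ ≤ C * ofReal ‖v‖ * ∫⁻ z in S, ‖φ z‖ₑ ∂μH[n] := by
  obtain ⟨C, hC, hG⟩ := GG2a n
  refine ⟨C, hC, fun S Ω hS hΩ hfr hlf φ v hφ hc => ?_⟩
  by_cases hv : v = 0
  · simp [hv]
  obtain ⟨L, hL⟩ := hφ.lipschitzWith_of_hasCompactSupport hc one_ne_zero
  obtain ⟨R, hR⟩ := hc.isCompact.isBounded.subset_closedBall (0 : EX n)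
  have hR' := (subset_tsupport φ).trans hR
  set m := μH[n] (S ∩ closedBall 0 (R + ‖v‖)) with hm
  have hmf : m ≠ ⊤ := by
    have := (isCompact_closedBall (0 : EX n) (R + ‖v‖)).measure_lt_top (μ := (μH[n] : Measure (EX n)).restrict S)
    rw [Measure.restrict_apply isClosed_closedBall.measurableSet, inter_comm] at this
    exact this.ne
  have h1 := (GG1 hφ hc Ω v 0).tendsto_slope_zero_right
  simp only [zero_add, zero_smul, add_zero] at h1
  have h2 := (continuous_enorm.tendsto _).comp h1
  have h3 : Tendsto (fun t : ℝ => C * ofReal ‖v‖ * (∫⁻ z in S, ‖φ z‖ₑ ∂μH[n] + ofReal (L * (t * ‖v‖)) * m)) (𝓝[>] 0)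
      (𝓝 (C * ofReal ‖v‖ * (∫⁻ z in S, ‖φ z‖ₑ ∂μH[n] + ofReal (L * (0 * ‖v‖)) * m))) := by
    refine ENNReal.Tendsto.const_mul (tendsto_const_nhds.add (ENNReal.Tendsto.mul_const ?_ (Or.inr hmf))) (Or.inr (by finiteness))
    refine (ENNReal.continuous_ofReal.tendsto _).comp (Tendsto.mono_left ?_ nhdsWithin_le_nhds)
    exact (by fun_prop : Continuous fun t : ℝ => L * (t * ‖v‖)).tendsto 0
  rw [zero_mul, mul_zero, ENNReal.ofReal_zero, zero_mul, add_zero] at h3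
  refine le_of_tendsto_of_tendsto h2 h3 ?_
  filter_upwards [Ioo_mem_nhdsGT (zero_lt_one' ℝ)] with t ht
  have ht0 : 0 < t := ht.1
  have h4 := hG S Ω hS hΩ hfr φ L R (t • v) hL hc hR' (smul_ne_zero ht0.ne' hv)
  rw [norm_smul, Real.norm_of_nonneg ht0.le] at h4
  have h5 : ofReal t ≠ 0 := by simpa using ht0
  simp only [Function.comp_apply, enorm_smul]
  rw [enorm_inv ht0.ne', Real.enorm_eq_ofReal ht0.le]
  refine (mul_le_mul_right h4 _).trans ?_
  rw [ENNReal.ofReal_mul ht0.le, ← mul_assoc, ← mul_assoc, mul_comm _ (C : ℝ≥0∞), mul_assoc (C : ℝ≥0∞), ← mul_assoc _ (ofReal t), ENNReal.inv_mul_cancel h5 ENNReal.ofReal_ne_top, one_mul]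
  gcongr
  rw [hm]
  refine measure_mono (inter_subset_inter_right _ (closedBall_subset_closedBall ?_))
  nlinarith [norm_nonneg v, ht.2]

theorem RZ {A H : Type*} [AddCommGroup A] [Module ℝ A] [NormedAddCommGroup H] [InnerProductSpace ℝ H] [CompleteSpace H]
    (ι : A →ₗ[ℝ] H) (l : A →ₗ[ℝ] ℝ) (K : ℝ) (h : ∀ a, ‖l a‖ ≤ K * ‖ι a‖) : ∃ y : H, ∀ a, l a = inner ℝ y (ι a) := by
  have hk : LinearMap.ker ι ≤ LinearMap.ker l := fun a ha => by
    rw [LinearMap.mem_ker] at ha ⊢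
    have := h a
    rw [ha, norm_zero, mul_zero] at this
    exact norm_le_zero_iff.1 this
  let g : LinearMap.range ι →ₗ[ℝ] ℝ := ((LinearMap.ker ι).liftQ l hk) ∘ₗ ι.quotKerEquivRange.symm.toLinearMap
  have hg : ∀ a, g ⟨ι a, LinearMap.mem_range_self ι a⟩ = l a := fun a => by
    simp only [g, LinearMap.comp_apply, LinearEquiv.coe_coe]
    rw [LinearMap.quotKerEquivRange_symm_apply_image]
    simp
  let G : LinearMap.range ι →L[ℝ] ℝ := g.mkContinuous K (by
    rintro ⟨_, a, rfl⟩
    rw [hg]; exact h a)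
  obtain ⟨F, hF, -⟩ := exists_extension_norm_eq (LinearMap.range ι) G
  refine ⟨(InnerProductSpace.toDual ℝ H).symm F, fun a => ?_⟩
  rw [InnerProductSpace.toDual_symm_apply]
  have := hF ⟨ι a, LinearMap.mem_range_self ι a⟩
  rw [this]
  exact (hg a).symm



def testF (n : ℕ) (R : ℝ) : Submodule ℝ (EX n → ℝ) where
  carrier := {φ | ContDiff ℝ 1 φ ∧ HasCompactSupport φ ∧ Function.support φ ⊆ ball 0 R}
  add_mem' := fun {a b} ha hb => ⟨ha.1.add hb.1, ha.2.1.add hb.2.1, (Function.support_add a b).trans (union_subset ha.2.2 hb.2.2)⟩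
  zero_mem' := ⟨contDiff_const, HasCompactSupport.zero, by simp⟩
  smul_mem' := fun c a ha => ⟨ha.1.const_smul c, ha.2.1.smul_left (f := fun _ => c), (Function.support_const_smul_subset c a).trans ha.2.2⟩

theorem GG3a {n : ℕ} {S Ω : Set (EX n)} (hS : IsClosed S) (hΩ : IsOpen Ω) (hfr : frontier Ω ⊆ S) (hlf : IsLocallyFiniteMeasure ((μH[n] : Measure (EX n)).restrict S)) (R : ℝ) (v : EX n) :
    ∃ ν : EX n → ℝ, Integrable ν (μH[n].restrict (S ∩ ball 0 R)) ∧ ∀ φ ∈ testF n R,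
      ∫ z in Ω, fderiv ℝ φ z v = ∫ z in S ∩ ball 0 R, φ z * ν z ∂μH[n] := by
  obtain ⟨C, hC, hG⟩ := GG2 n
  set μ := (μH[n] : Measure (EX n)).restrict (S ∩ ball 0 R) with hμ
  have hμS : μ = ((μH[n] : Measure (EX n)).restrict S).restrict (ball 0 R) := by
    rw [hμ, Measure.restrict_restrict isOpen_ball.measurableSet, inter_comm]
  have : IsFiniteMeasure μ := ⟨by
    rw [hμS, Measure.restrict_apply MeasurableSet.univ, univ_inter]
    exact (measure_mono ball_subset_closedBall).trans_lt (isCompact_closedBall (0 : EX n) R).measure_lt_top⟩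
  have hmem : ∀ φ ∈ testF n R, MemLp φ 2 μ := fun φ h => h.1.continuous.memLp_of_hasCompactSupport h.2.1
  have hint : ∀ φ ∈ testF n R, Integrable (fun z => fderiv ℝ φ z v) (volume.restrict Ω) := fun φ h =>
    (((h.1.continuous_fderiv one_ne_zero).clm_apply continuous_const).integrable_of_hasCompactSupport (h.2.1.fderiv_apply ℝ v)).integrableOn
  have hdf : ∀ φ ∈ testF n R, ∀ z, DifferentiableAt ℝ φ z := fun φ h z => h.1.differentiable one_ne_zero z
  let ι : testF n R →ₗ[ℝ] Lp ℝ 2 μ :=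
    { toFun := fun φ => (hmem φ φ.2).toLp φ
      map_add' := fun a b => rfl
      map_smul' := fun c a => rfl }
  let l : testF n R →ₗ[ℝ] ℝ :=
    { toFun := fun φ => ∫ z in Ω, fderiv ℝ φ z v
      map_add' := fun a b => by
        rw [← integral_add (hint a a.2) (hint b b.2)]
        congr 1; ext z
        rw [Submodule.coe_add, fderiv_add (hdf a a.2 z) (hdf b b.2 z)]; rfl
      map_smul' := fun c a => by
        rw [RingHom.id_apply, smul_eq_mul, ← integral_const_mul]
        congr 1; ext z
        rw [Submodule.coe_smul, fderiv_const_smul (hdf a a.2 z)]; rfl }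
  set K : ℝ≥0∞ := C * ofReal ‖v‖ * μ univ ^ (1 / (1 : ℝ≥0∞).toReal - 1 / (2 : ℝ≥0∞).toReal) with hK
  have hKt : K ≠ ⊤ := ENNReal.mul_ne_top (by finiteness) (ENNReal.rpow_ne_top_of_nonneg (by norm_num) (measure_ne_top _ _))
  obtain ⟨y, hy⟩ := RZ ι l K.toReal (fun φ => by
    have h1 := hG S Ω hS hΩ hfr hlf φ v φ.2.1 φ.2.2.1
    have h2 : ∫⁻ z in S, ‖(φ : EX n → ℝ) z‖ₑ ∂μH[n] = ∫⁻ z, ‖(φ : EX n → ℝ) z‖ₑ ∂μ := by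
      rw [hμS, ← lintegral_indicator isOpen_ball.measurableSet]
      congr 1; ext z
      by_cases hz : z ∈ ball (0 : EX n) R
      · rw [indicator_of_mem hz]
      · rw [indicator_of_notMem hz, show (φ : EX n → ℝ) z = 0 from by_contra fun h => hz (φ.2.2.2 h)]; simp
    have h3 := eLpNorm_le_eLpNorm_mul_rpow_measure_univ (p := 1) (q := 2) (μ := μ) (by norm_num) (hmem φ φ.2).1
    rw [eLpNorm_one_eq_lintegral_enorm, ← h2] at h3
    have h4 : ‖l φ‖ₑ ≤ K * eLpNorm (φ : EX n → ℝ) 2 μ := by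
      refine h1.trans ((mul_le_mul_right h3 _).trans_eq ?_)
      rw [hK]; ring
    have h5 := ENNReal.toReal_mono (ENNReal.mul_ne_top hKt (hmem φ φ.2).2.ne) h4
    rw [toReal_enorm, ENNReal.toReal_mul] at h5
    refine h5.trans_eq ?_
    congr 1
    exact (Lp.norm_toLp _ (hmem φ φ.2)).symm)
  refine ⟨y, (Lp.memLp y).integrable (by norm_num), fun φ hφ => ?_⟩
  have h := hy ⟨φ, hφ⟩
  refine h.trans ?_
  rw [L2.inner_def]
  refine integral_congr_ae ?_
  filter_upwards [(hmem φ hφ).coeFn_toLp] with z hz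
  have : (ι ⟨φ, hφ⟩ : EX n → ℝ) z = φ z := hz
  rw [this]
  simp

theorem GG3 {n : ℕ} {S Ω : Set (EX n)} (hS : IsClosed S) (hΩ : IsOpen Ω) (hfr : frontier Ω ⊆ S) (hlf : IsLocallyFiniteMeasure ((μH[n] : Measure (EX n)).restrict S)) (R : ℝ) :
    ∃ ν : EX n → EX n, Integrable ν (μH[n].restrict (S ∩ ball 0 R)) ∧ ∀ φ ∈ testF n R, ∀ v,
      ∫ z in Ω, fderiv ℝ φ z v = ∫ z in S ∩ ball 0 R, φ z * inner ℝ (ν z) v ∂μH[n] := by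
  choose ν h1 h2 using fun i : Fin (n + 1) => GG3a hS hΩ hfr hlf R (EuclideanSpace.single i (1 : ℝ))
  refine ⟨fun z => ∑ i, ν i z • EuclideanSpace.single i (1 : ℝ), integrable_finsetSum _ fun i _ => (h1 i).smul_const _, fun φ hφ v => ?_⟩
  have hv : v = ∑ i, v i • EuclideanSpace.single i (1 : ℝ) := by
    have := (EuclideanSpace.basisFun (Fin (n + 1)) ℝ).sum_repr v
    simpa using this.symm
  have h3 : ∀ z, fderiv ℝ φ z v = ∑ i, v i * fderiv ℝ φ z (EuclideanSpace.single i 1) := fun z => by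
    conv_lhs => rw [hv]
    simp
  have h4 : ∀ z, φ z * inner ℝ (∑ i, ν i z • EuclideanSpace.single i (1 : ℝ)) v = ∑ i, v i * (φ z * ν i z) := fun z => by
    rw [sum_inner, Finset.mul_sum]
    refine Finset.sum_congr rfl fun i _ => ?_
    rw [real_inner_smul_left, EuclideanSpace.inner_single_left]
    simp; ring
  obtain ⟨M, hM⟩ := hφ.2.1.exists_bound_of_continuous hφ.1.continuous
  simp_rw [h3, h4]
  rw [integral_finsetSum, integral_finsetSum]
  · refine Finset.sum_congr rfl fun i _ => ?_
    rw [integral_const_mul, integral_const_mul, h2 i φ hφ]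
  · intro i _
    exact ((h1 i).bdd_mul hφ.1.continuous.aestronglyMeasurable (Eventually.of_forall hM)).const_mul _
  · intro i _
    exact ((((hφ.1.continuous_fderiv one_ne_zero).clm_apply continuous_const).integrable_of_hasCompactSupport (hφ.2.1.fderiv_apply ℝ _)).integrableOn).const_mul _



noncomputable def HS {n : ℕ} (S : Set (EX n)) (R : ℝ) : Measure (EX n) := (μH[n] : Measure (EX n)).restrict (S ∩ ball 0 R)

theorem HS_fin {n : ℕ} {S : Set (EX n)} (hlf : IsLocallyFiniteMeasure ((μH[n] : Measure (EX n)).restrict S)) (R : ℝ) : IsFiniteMeasure (HS S R) := ⟨by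
  rw [HS, inter_comm, ← Measure.restrict_restrict isOpen_ball.measurableSet, Measure.restrict_apply MeasurableSet.univ, univ_inter]
  exact (measure_mono ball_subset_closedBall).trans_lt (isCompact_closedBall (0 : EX n) R).measure_lt_top⟩

theorem LEB {n : ℕ} {E : Set (EX n)} (h : AHP E) {R : ℝ} {ν : EX n → EX n} (hν : Integrable ν (HS (SG E) R)) :
    ∀ᵐ x ∂HS (SG E) R, (x ∈ SG E ∧ x ∈ ball 0 R) ∧ ∀ η : ℝ, 0 < η → ∃ ρ, 0 < ρ ∧ ∀ r, 0 < r → r < ρ →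
      ∫ z in closedBall x r, ‖ν z - ν x‖ ∂HS (SG E) R ≤ η * r ^ n := by
  have := HS_fin (SG_lf h) R
  have hae : ∀ᵐ x ∂HS (SG E) R, x ∈ SG E ∩ ball 0 R := ae_restrict_mem ((isClosed_SG E).measurableSet.inter isOpen_ball.measurableSet)
  filter_upwards [hae, VitaliFamily.ae_tendsto_average_norm_sub (Besicovitch.vitaliFamily (HS (SG E) R)) hν.locallyIntegrable] with x hx ht
  refine ⟨hx, fun η hη => ?_⟩
  obtain ⟨r₁, κ, C, hr₁, hκ, hC, hh⟩ := h x
  have h1 := ht.comp (Besicovitch.tendsto_filterAt (HS (SG E) R) x)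
  have h2 := (tendsto_order.1 h1).2 (η / (C * 2 ^ n)) (by positivity)
  obtain ⟨ρ, hρ, h3⟩ := mem_nhdsGT_iff_exists_Ioo_subset.1 h2
  refine ⟨min ρ (r₁ / 2), lt_min hρ (by positivity), fun r hr hrr => ?_⟩
  have h4 := h3 ⟨hr, hrr.trans_le (min_le_left _ _)⟩
  have hr2 : 2 * r ≤ r₁ := by linarith [hrr.trans_le (min_le_right ρ (r₁ / 2))]
  simp only [Function.comp, mem_ofPred_eq] at h4
  rw [← measure_smul_setAverage _ (measure_ne_top _ _), smul_eq_mul]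
  have h5 : (HS (SG E) R).real (closedBall x r) ≤ C * (2 * r) ^ n := by
    refine ENNReal.toReal_le_of_le_ofReal (by positivity) ?_
    refine le_trans ?_ (hh x hx.1 (Metric.mem_ball_self hr₁) (2 * r) (by positivity) hr2).1
    rw [HS, Measure.restrict_apply isClosed_closedBall.measurableSet]
    exact measure_mono fun z hz => ⟨hz.2.1, Metric.closedBall_subset_ball (by linarith) hz.1⟩
  calc _ ≤ C * (2 * r) ^ n * (η / (C * 2 ^ n)) := mul_le_mul h5 h4.le (integral_nonneg fun z => norm_nonneg (ν z - ν x)) (by positivity)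
    _ = η * r ^ n := by rw [mul_pow]; field_simp

theorem FLAT1 {n : ℕ} {S Ω Ω' : Set (EX n)} (hlf : IsLocallyFiniteMeasure ((μH[n] : Measure (EX n)).restrict S)) (hΩ : IsOpen Ω) (hd : Disjoint Ω Ω')
    {R : ℝ} {ν : EX n → EX n} (hν : Integrable ν (HS S R))
    (hG : ∀ φ ∈ testF n R, ∀ v, ∫ z in Ω, fderiv ℝ φ z v = ∫ z, φ z * inner ℝ (ν z) v ∂HS S R) {x a : EX n} (hx : x ∈ ball 0 R)
    (hL : ∀ η : ℝ, 0 < η → ∃ ρ, 0 < ρ ∧ ∀ r, 0 < r → r < ρ → ∫ z in closedBall x r, ‖ν z - a‖ ∂HS S R ≤ η * r ^ n)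
    {ε : ℝ} (hε : 0 < ε) (hε1 : ε ≤ 1) :
    ∃ ρ, 0 < ρ ∧ ∀ r, 0 < r → r < ρ → ∀ p ∈ ball x r, ∀ q ∈ ball x r, ball p (ε * r) ⊆ Ω → ball q (ε * r) ⊆ Ω' →
      0 < inner ℝ a (q - p) := by
  have hfin := HS_fin hlf R
  have hB : 0 < (bvol n).toReal := ENNReal.toReal_pos (bvol_ne_zero n) (bvol_ne_top n)
  set B := (bvol n).toReal with hBd
  obtain ⟨ρ, hρ, hL⟩ := hL ((ε / 4) ^ (n + 1) * B / 2) (by positivity)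
  obtain ⟨ρ', hρ', hxR⟩ := Metric.isOpen_iff.1 isOpen_ball x hx
  refine ⟨min ρ ρ' / 2, by positivity, fun r hr hrr p hp q hq hpΩ hqΩ => ?_⟩
  have hr1 : 2 * r < ρ := by linarith [min_le_left ρ ρ']
  have hr2 : 2 * r < ρ' := by linarith [min_le_right ρ ρ']
  have hεr : 0 < ε * r := by positivity
  have hεr1 : ε * r ≤ r := mul_le_of_le_one_left hr.le hε1
  by_contra hcon
  push Not at hcon
  set w := p - q with hw
  have haw : 0 ≤ inner ℝ a w := by
    rw [hw, ← neg_sub q p, inner_neg_right]; linarith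
  have hwn : ‖w‖ ≤ 2 * r := by
    rw [hw, ← dist_eq_norm]
    linarith [dist_triangle_right p q x, mem_ball.1 hp, mem_ball.1 hq]
  let b : ContDiffBump p := ⟨ε * r / 2, ε * r, by positivity, by linarith⟩
  have hb1 : ContDiff ℝ 1 (b : EX n → ℝ) := b.contDiff
  set g : ℝ → ℝ := fun s => ∫ z in Ω, b (z + s • w) with hg
  have hbi : Integrable (b : EX n → ℝ) (volume.restrict Ω) := (hb1.continuous.integrable_of_hasCompactSupport b.hasCompactSupport).integrableOn
  have hg0 : (ε * r / 2) ^ (n + 1) * B ≤ g 0 := by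
    have hs : closedBall p (ε * r / 2) ⊆ Ω := (Metric.closedBall_subset_ball (by linarith)).trans hpΩ
    calc _ = ∫ z in closedBall p (ε * r / 2), (1 : ℝ) := by
          rw [setIntegral_const, smul_eq_mul, mul_one, Measure.real, vol_cball p (by positivity), ENNReal.toReal_mul, ENNReal.toReal_ofReal (by positivity)]
      _ = ∫ z in closedBall p (ε * r / 2), b z := setIntegral_congr_fun isClosed_closedBall.measurableSet fun z hz => (b.one_of_mem_closedBall hz).symm
      _ ≤ ∫ z in Ω, b z := setIntegral_mono_set hbi (Eventually.of_forall fun z => b.nonneg) (LE.le.eventuallyLE hs)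
      _ = g 0 := by simp [hg]
  have hg1 : g 1 = 0 := by
    refine setIntegral_eq_zero_of_forall_eq_zero fun z hz => ?_
    refine b.zero_of_le_dist ?_
    by_contra hlt
    push Not at hlt
    refine disjoint_left.1 hd hz (hqΩ ?_)
    rw [mem_ball, dist_eq_norm]
    rw [dist_eq_norm, hw] at hlt
    rwa [show z - q = z + (1 : ℝ) • (p - q) - p by module]
  obtain ⟨t, ht, hgt⟩ := exists_hasDerivAt_eq_slope g (fun s => ∫ z in Ω, fderiv ℝ b (z + s • w) w) zero_lt_one
    (fun s _ => (GG1 hb1 b.hasCompactSupport Ω w s).continuousAt.continuousWithinAt) (fun s _ => GG1 hb1 b.hasCompactSupport Ω w s)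
  rw [hg1] at hgt
  set φ : EX n → ℝ := fun z => b (z + t • w) with hφ
  have hsupp : Function.support φ ⊆ ball x (2 * r) := fun z hz => by
    have h1 : z + t • w ∈ Function.support b := hz
    rw [b.support_eq, mem_ball, dist_eq_norm] at h1
    have h2 : p - t • w ∈ ball x r := by
      have := (convex_ball x r) hp hq (sub_nonneg.2 ht.2.le) ht.1.le (by ring)
      rw [hw]; convert this using 1; module
    have h3 : dist z (p - t • w) < ε * r := by
      rw [dist_eq_norm]; convert h1 using 2; module
    rw [mem_ball] at h2 ⊢
    linarith [dist_triangle z (p - t • w) x]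
  have hφt : φ ∈ testF n R := by
    refine ⟨hb1.comp (contDiff_id.add contDiff_const), ?_, hsupp.trans ((ball_subset_ball hr2.le).trans hxR)⟩
    exact HasCompactSupport.of_support_subset_isCompact (isCompact_closedBall x (2 * r)) (hsupp.trans ball_subset_closedBall)
  have h1 := hG φ hφt w
  have h2 : ∀ z, fderiv ℝ φ z w = fderiv ℝ b (z + t • w) w := fun z => by rw [hφ, fderiv_comp_add_right]
  simp_rw [h2] at h1
  rw [hgt] at h1
  obtain ⟨M, hM⟩ := hφt.2.1.exists_bound_of_continuous hφt.1.continuous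
  have hi1 : Integrable (fun z => φ z * inner ℝ (ν z) w) (HS S R) :=
    (hν.inner_const w).bdd_mul hφt.1.continuous.aestronglyMeasurable (Eventually.of_forall hM)
  have hi2 : Integrable (fun z => ‖ν z - a‖) (HS S R) := (hν.sub (integrable_const a)).norm
  have h3 : ∀ z, (closedBall x (2 * r)).indicator (fun z => -(2 * r) * ‖ν z - a‖) z ≤ φ z * inner ℝ (ν z) w := fun z => by
    by_cases hz : z ∈ closedBall x (2 * r)
    · rw [indicator_of_mem hz]
      have h4 : inner ℝ (ν z) w = inner ℝ (ν z - a) w + inner ℝ a w := by rw [inner_sub_left]; ring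
      have h5 := neg_le_of_abs_le (abs_real_inner_le_norm (ν z - a) w)
      have h6 : ‖ν z - a‖ * ‖w‖ ≤ ‖ν z - a‖ * (2 * r) := by gcongr
      have h7 : 0 ≤ φ z := b.nonneg
      have h8 : φ z ≤ 1 := b.le_one
      have h9 : 0 ≤ ‖ν z - a‖ * (2 * r) := by positivity
      have h10 : φ z * (-(‖ν z - a‖ * (2 * r))) ≤ φ z * inner ℝ (ν z) w := by gcongr; linarith
      nlinarith
    · rw [indicator_of_notMem hz]
      have : φ z = 0 := by
        by_contra hne
        exact hz (ball_subset_closedBall (hsupp hne))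
      rw [this, zero_mul]
  have h4 := integral_mono ((hi2.const_mul (-(2 * r))).indicator (isClosed_closedBall (x := x) (ε := 2 * r)).measurableSet) hi1 h3
  rw [integral_indicator isClosed_closedBall.measurableSet, integral_const_mul, ← h1] at h4
  have h5 := hL (2 * r) (by positivity) hr1
  have h6 : (2 * r) * ∫ z in closedBall x (2 * r), ‖ν z - a‖ ∂HS S R ≤ (2 * r) * ((ε / 4) ^ (n + 1) * B / 2 * (2 * r) ^ n) := by gcongr
  have h7 : (2 * r) * ((ε / 4) ^ (n + 1) * B / 2 * (2 * r) ^ n) = (ε * r / 2) ^ (n + 1) * B / 2 := by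
    rw [show ε * r / 2 = ε / 4 * (2 * r) by ring, mul_pow (ε / 4) (2 * r), pow_succ (2 * r)]; ring
  have h8 : 0 < (ε * r / 2) ^ (n + 1) * B := by positivity
  rw [sub_zero, div_one] at h4
  linarith



theorem LOWS {n : ℕ} {E : Set (EX n)} {x e p : EX n} {r ε : ℝ} (hr : 0 < r) (hε : ε ≤ 1 / 4) (he : ‖e‖ = 1)
    (h1 : ∀ z ∈ SG E, z ∈ ball x r → -(ε * r) ≤ inner ℝ e (z - x)) (hp : p ∈ ball x (r / 16))
    (h2 : ∀ q ∈ ball x r, ball q (r / 4) ⊆ RG Eᶜ → 0 < inner ℝ e (q - p)) {y : EX n} (hy : y ∈ ball x r)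
    (hy1 : inner ℝ e (y - x) < -(ε * r)) : y ∈ RG E := by
  set K : Set (EX n) := ball x r ∩ {z | inner ℝ e (z - x) < -(ε * r)} with hK
  have hKc : Convex ℝ K := by
    refine (convex_ball x r).inter ?_
    have : {z : EX n | inner ℝ e (z - x) < -(ε * r)} = {z | (innerSL ℝ e) z < -(ε * r) + inner ℝ e x} := by
      ext z; simp only [mem_ofPred_eq, inner_sub_right, innerSL_apply_apply]; constructor <;> intro h <;> linarith
    rw [this]
    exact convex_halfSpace_lt (innerSL ℝ e).isLinear _
  rcases mem_cases E y with h | h | h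
  · linarith [h1 y h hy]
  · exact h
  exfalso
  have hKR : K ⊆ RG Eᶜ := by
    intro z hz
    by_contra hzn
    obtain ⟨b, hb, hbf⟩ := preconn_frontier hKc.isPreconnected (RG Eᶜ) ⟨hy, hy1⟩ hz h hzn
    have := frontier_RG Eᶜ hbf
    rw [SG_compl] at this
    have h3 : inner ℝ e (b - x) < -(ε * r) := hb.2
    linarith [h1 b this hb.1]
  have hq : x - (r / 2) • e ∈ ball x r := by
    rw [mem_ball_iff_norm, sub_sub_cancel_left, norm_neg, norm_smul, he, Real.norm_of_nonneg (by positivity)]; linarith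
  have h3 := h2 (x - (r / 2) • e) hq fun z hz => hKR ?_
  · have h4 : inner ℝ e (x - (r / 2) • e - p) = -(r / 2) + inner ℝ e (x - p) := by
      rw [sub_right_comm, inner_sub_right, real_inner_smul_right, real_inner_self_eq_norm_sq, he]; ring
    have h5 := real_inner_le_norm e (x - p)
    rw [he, one_mul, ← dist_eq_norm, dist_comm] at h5
    linarith [mem_ball.1 hp]
  · rw [mem_ball_iff_norm] at hz
    have h6 : z - x = (z - (x - (r / 2) • e)) - (r / 2) • e := by module
    constructor
    · rw [mem_ball_iff_norm, h6]
      refine (norm_sub_le _ _).trans_lt ?_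
      rw [norm_smul, he, Real.norm_of_nonneg (by positivity)]; linarith
    · rw [mem_ofPred_eq, h6, inner_sub_right, real_inner_smul_right, real_inner_self_eq_norm_sq, he]
      have := real_inner_le_norm e (z - (x - (r / 2) • e))
      rw [he] at this
      nlinarith

def FLT {n : ℕ} (E : Set (EX n)) (x e : EX n) (ε r : ℝ) : Prop :=
  (∀ z ∈ SG E, z ∈ ball x r → |inner ℝ e (z - x)| ≤ ε * r) ∧
    (∀ y ∈ ball x r, inner ℝ e (y - x) < -(ε * r) → y ∈ RG E) ∧ ∀ y ∈ ball x r, ε * r < inner ℝ e (y - x) → y ∈ RG Eᶜ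

theorem FLAT2 {n : ℕ} {E : Set (EX n)} (h : AHP E) {x a : EX n} (hx : x ∈ SG E)
    (hF : ∀ ε : ℝ, 0 < ε → ε ≤ 1 → ∃ ρ, 0 < ρ ∧ ∀ r, 0 < r → r < ρ → ∀ p ∈ ball x r, ∀ q ∈ ball x r,
      ball p (ε * r) ⊆ RG E → ball q (ε * r) ⊆ RG Eᶜ → 0 < inner ℝ a (q - p)) :
    ∃ e : EX n, ‖e‖ = 1 ∧ ∀ ε : ℝ, 0 < ε → ε ≤ 1 / 4 → ∃ ρ, 0 < ρ ∧ ∀ r, 0 < r → r < ρ → FLT E x e ε r := by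
  obtain ⟨r₁, κ, C, hr₁, hκ, -, hh⟩ := h x
  have ha : a ≠ 0 := by
    obtain ⟨ρ, hρ, h1⟩ := hF (min 1 κ) (by positivity) (min_le_left _ _)
    set r := min (ρ / 2) r₁ with hr
    have hr0 : 0 < r := by positivity
    obtain ⟨-, ⟨p, hp, hp'⟩, q, hq, hq'⟩ := hh x hx (Metric.mem_ball_self hr₁) r hr0 (min_le_right _ _)
    have h2 : min 1 κ * r ≤ κ * r := by gcongr; exact min_le_right _ _
    have := h1 r hr0 ((min_le_left _ _).trans_lt (by linarith)) p hp q hq ((ball_subset_ball h2).trans hp') ((ball_subset_ball h2).trans hq')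
    rintro rfl
    simp at this
  have hae : ∀ v : EX n, 0 < inner ℝ a v → 0 < inner ℝ (‖a‖⁻¹ • a) v := fun v hv => by
    rw [real_inner_smul_left]
    exact mul_pos (inv_pos.2 (norm_pos_iff.2 ha)) hv
  set e := ‖a‖⁻¹ • a with hed
  have he : ‖e‖ = 1 := norm_smul_inv_norm (𝕜 := ℝ) ha
  refine ⟨e, he, fun ε hε hε4 => ?_⟩
  obtain ⟨ρ, hρ, h1⟩ := hF (min (1 / 8) (κ * ε / 8)) (by positivity) ((min_le_left _ _).trans (by norm_num))
  refine ⟨min (ρ / 2) r₁, by positivity, fun r hr hrr => ?_⟩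
  have hrρ : 2 * r < ρ := by linarith [hrr.trans_le (min_le_left (ρ / 2) r₁)]
  have hrr1 : r < r₁ := hrr.trans_le (min_le_right (ρ / 2) r₁)
  set s := min (1 / 8) (κ * ε / 8) * (2 * r) with hs
  have hs1 : s ≤ r / 4 := by
    have : s ≤ 1 / 8 * (2 * r) := by rw [hs]; gcongr; exact min_le_left _ _
    linarith
  have hs2 : s ≤ κ * (ε * r / 4) := by
    have : s ≤ κ * ε / 8 * (2 * r) := by rw [hs]; gcongr; exact min_le_right _ _
    linarith
  have hδ : 0 < ε * r / 4 := by positivity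
  have hδr : ε * r / 4 ≤ r / 16 := by nlinarith
  have key : ∀ p ∈ ball x (2 * r), ∀ q ∈ ball x (2 * r), ball p s ⊆ RG E → ball q s ⊆ RG Eᶜ → 0 < inner ℝ e (q - p) :=
    fun p hp q hq hp' hq' => hae _ (h1 (2 * r) (by positivity) hrρ p hp q hq hp' hq')
  have hz : ∀ z ∈ SG E, z ∈ ball x r → (∃ p ∈ ball z (ε * r / 4), ball p s ⊆ RG E) ∧ ∃ q ∈ ball z (ε * r / 4), ball q s ⊆ RG Eᶜ := by
    intro z hz hzx
    obtain ⟨-, ⟨p, hp, hp'⟩, q, hq, hq'⟩ := hh z hz (ball_subset_ball hrr1.le hzx) (ε * r / 4) hδ (by linarith)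
    exact ⟨⟨p, hp, (ball_subset_ball hs2).trans hp'⟩, q, hq, (ball_subset_ball hs2).trans hq'⟩
  obtain ⟨⟨p, hp, hp'⟩, q, hq, hq'⟩ := hz x hx (Metric.mem_ball_self hr)
  have hb : ∀ z ∈ ball x r, ∀ w ∈ ball z (ε * r / 4), w ∈ ball x (2 * r) := fun z hz w hw => by
    rw [mem_ball] at *
    linarith [dist_triangle w z x]
  have hi : ∀ z w : EX n, w ∈ ball z (ε * r / 4) → |inner ℝ e (w - z)| ≤ ε * r / 4 := fun z w hw => by
    refine (abs_real_inner_le_norm _ _).trans ?_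
    rw [he, one_mul]
    exact (mem_ball_iff_norm.1 hw).le
  have hxr := Metric.mem_ball_self (x := x) hr
  have hA : ∀ z ∈ SG E, z ∈ ball x r → |inner ℝ e (z - x)| ≤ ε * r := by
    intro z hzS hzx
    obtain ⟨⟨p', hp1, hp2⟩, q', hq1, hq2⟩ := hz z hzS hzx
    have k1 := key p' (hb z hzx p' hp1) q (hb x hxr q hq) hp2 hq'
    have k2 := key p (hb x hxr p hp) q' (hb z hzx q' hq1) hp' hq2
    rw [show q - p' = (q - x) - (p' - z) - (z - x) by abel, inner_sub_right, inner_sub_right] at k1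
    rw [show q' - p = (q' - z) - (p - x) + (z - x) by abel, inner_add_right, inner_sub_right] at k2
    have := abs_le.1 (hi _ _ hp); have := abs_le.1 (hi _ _ hq); have := abs_le.1 (hi _ _ hp1); have := abs_le.1 (hi _ _ hq1)
    rw [abs_le]; constructor <;> linarith
  have hbb : ∀ z ∈ ball x r, z ∈ ball x (2 * r) := fun z hz => ball_subset_ball (by linarith) hz
  refine ⟨hA, fun y hy hy1 => ?_, fun y hy hy1 => ?_⟩
  · exact LOWS hr hε4 he (fun z hz hzx => (abs_le.1 (hA z hz hzx)).1) (ball_subset_ball hδr hp)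
      (fun q₁ hq₁ hq₂ => key p (hb x hxr p hp) q₁ (hbb _ hq₁) hp' ((ball_subset_ball hs1).trans hq₂)) hy hy1
  · refine LOWS (E := Eᶜ) (e := -e) (p := q) hr hε4 (by rw [norm_neg, he]) (fun z hz hzx => ?_) (ball_subset_ball hδr hq)
      (fun q₁ hq₁ hq₂ => ?_) hy (by rw [inner_neg_left]; linarith)
    · rw [SG_compl] at hz
      rw [inner_neg_left]; linarith [(abs_le.1 (hA z hz hzx)).2]
    · rw [compl_compl] at hq₂
      rw [inner_neg_left, ← inner_neg_right, neg_sub]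
      exact key q₁ (hbb _ hq₁) q (hb x hxr q hq) ((ball_subset_ball hs1).trans hq₂) hq'

theorem FLATAE {n : ℕ} {E : Set (EX n)} (h : AHP E) : ∀ᵐ x ∂(μH[n] : Measure (EX n)).restrict (SG E), x ∈ SG E ∧ ∃ e : EX n, ‖e‖ = 1 ∧ ∀ ε : ℝ, 0 < ε → ε ≤ 1 / 4 →
    ∃ ρ, 0 < ρ ∧ ∀ r, 0 < r → r < ρ → FLT E x e ε r := by
  have hR : ∀ R : ℕ, ∀ᵐ x ∂(μH[n] : Measure (EX n)).restrict (SG E), x ∈ ball 0 (R : ℝ) → x ∈ SG E ∧ ∃ e : EX n, ‖e‖ = 1 ∧ ∀ ε : ℝ, 0 < ε → ε ≤ 1 / 4 →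
      ∃ ρ, 0 < ρ ∧ ∀ r, 0 < r → r < ρ → FLT E x e ε r := by
    intro R
    rw [← ae_restrict_iff' isOpen_ball.measurableSet, Measure.restrict_restrict isOpen_ball.measurableSet, inter_comm]
    obtain ⟨ν, hν, hG⟩ := GG3 (isClosed_SG E) (isOpen_RG E) (frontier_RG E) (SG_lf h) R
    filter_upwards [LEB h hν] with x hx
    exact ⟨hx.1.1, FLAT2 h hx.1.1 fun ε hε hε1 => FLAT1 (SG_lf h) (isOpen_RG E) (RG_disj E) hν hG hx.1.2 hx.2 hε hε1⟩
  filter_upwards [ae_all_iff.2 hR] with x hx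
  obtain ⟨k, hk⟩ := exists_nat_gt ‖x‖
  exact hx k (by simpa using hk)



noncomputable def PR (n : ℕ) (δ : ℝ≥0∞) : OuterMeasure (EX n) := OuterMeasure.mkMetric'.pre (fun s => ediam s ^ (n : ℝ)) δ

theorem PR_le {n : ℕ} (δ : ℝ≥0∞) (hδ : 0 < δ) (A : Set (EX n)) : PR n δ A ≤ μH[n] A := by
  have h : PR n δ ≤ OuterMeasure.mkMetric fun r => r ^ (n : ℝ) := le_iSup₂_of_le δ hδ le_rfl
  exact (h A).trans_eq (by rw [OuterMeasure.coe_mkMetric]; rfl)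

theorem muH_le_of_PR {n : ℕ} {A : Set (EX n)} {c : ℝ≥0∞} (h : ∀ δ, 0 < δ → PR n δ A ≤ c) : μH[n] A ≤ c := by
  have h1 : μH[n] A = (OuterMeasure.mkMetric fun r => r ^ (n : ℝ)) A := by rw [OuterMeasure.coe_mkMetric]; rfl
  rw [h1, OuterMeasure.mkMetric, OuterMeasure.mkMetric', OuterMeasure.iSup_apply]
  refine iSup_le fun δ => ?_
  rw [OuterMeasure.iSup_apply]
  exact iSup_le fun hδ => h δ hδ

def DS {n : ℕ} (e : EX n) : Set (EX n) := {z | ‖z‖ ≤ 1 ∧ inner ℝ e z = 0}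

theorem proj_le {n : ℕ} {e : EX n} (he : ‖e‖ = 1) (z : EX n) : ‖z - inner ℝ e z • e‖ ≤ ‖z‖ := by
  rw [← sq_le_sq₀ (norm_nonneg _) (norm_nonneg _), norm_sub_sq_real, norm_smul, he, inner_smul_right, real_inner_comm, Real.norm_eq_abs]
  have := sq_abs (inner ℝ z e)
  nlinarith [sq_nonneg (inner ℝ z e)]

theorem proj_orth {n : ℕ} {e : EX n} (he : ‖e‖ = 1) (z : EX n) : inner ℝ e (z - inner ℝ e z • e) = 0 := by
  rw [inner_sub_right, inner_smul_right, real_inner_self_eq_norm_sq, he]; ring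

theorem DS_pos {n : ℕ} {e : EX n} (he : ‖e‖ = 1) : μH[n] (DS e) ≠ 0 := by
  intro h0
  obtain ⟨C, hC, hT⟩ := T1 n
  have h1 := hT e (DS e) (by rw [← norm_ne_zero_iff, he]; exact one_ne_zero)
  rw [h0, mul_zero] at h1
  have h2 : ball (-(1 / 2 : ℝ) • e) (1 / 2) ⊆ tube e (DS e) := by
    intro z hz
    rw [mem_ball_iff_norm] at hz
    have h3 : inner ℝ e (z - -(1 / 2 : ℝ) • e) = inner ℝ e z + 1 / 2 := by
      rw [inner_sub_right, inner_smul_right, real_inner_self_eq_norm_sq, he]; ring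
    have h4 := abs_real_inner_le_norm e (z - -(1 / 2 : ℝ) • e)
    rw [h3, he, one_mul, abs_le] at h4
    refine ⟨-inner ℝ e z, ⟨by linarith, by linarith⟩, ?_⟩
    rw [neg_smul, ← sub_eq_add_neg]
    refine ⟨(proj_le he z).trans ?_, proj_orth he z⟩
    have h5 := norm_add_le (z - -(1 / 2 : ℝ) • e) (-(1 / 2 : ℝ) • e)
    rw [sub_add_cancel, norm_smul, he, norm_neg, Real.norm_of_nonneg (by norm_num)] at h5
    linarith
  exact (Metric.measure_ball_pos volume (-(1 / 2 : ℝ) • e) (by norm_num : (0 : ℝ) < 1 / 2)).ne' (le_antisymm ((measure_mono h2).trans h1) (zero_le))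

theorem lip_inner {n : ℕ} {e : EX n} (he : ‖e‖ = 1) (x : EX n) : LipschitzWith 1 fun z => inner ℝ e (z - x) := by
  refine LipschitzWith.of_dist_le_mul fun y z => ?_
  rw [Real.dist_eq, ← inner_sub_right, sub_sub_sub_cancel_right, NNReal.coe_one, one_mul, dist_eq_norm]
  exact (abs_real_inner_le_norm _ _).trans (by rw [he, one_mul])

theorem DS_fin {n : ℕ} (hn : 1 ≤ n) {e : EX n} (he : ‖e‖ = 1) : μH[n] (DS e) ≠ ⊤ := by
  obtain ⟨C, hC, hT⟩ := T2c hn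
  obtain ⟨r, hr, h⟩ := hT (fun _ => 1) measurable_const (fun _ => one_pos) _ (lip_inner he 0) (closedBall 0 2) isClosed_closedBall.measurableSet 0 1 one_pos
  rw [mp_one, mv_one] at h
  have h1 : μH[n] (DS e) ≤ μH[n] (closedBall 0 2 ∩ (fun z : EX n => inner ℝ e (z - 0)) ⁻¹' {r}) := by
    rw [← (isometry_add_right (r • e)).hausdorffMeasure_image (Or.inl n.cast_nonneg)]
    refine measure_mono ?_
    rintro _ ⟨z, hz, rfl⟩
    refine ⟨?_, ?_⟩
    · rw [mem_closedBall_zero_iff]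
      refine (norm_add_le _ _).trans ?_
      rw [norm_smul, he, Real.norm_of_nonneg hr.1.le]
      linarith [hz.1, hr.2]
    · rw [mem_preimage, mem_singleton_iff, sub_zero, inner_add_right, hz.2, inner_smul_right, real_inner_self_eq_norm_sq, he]; ring
  refine ne_top_of_le_ne_top ?_ (h1.trans h)
  have : volume (closedBall (0 : EX n) 2 ∩ (fun z => inner ℝ e (z - 0)) ⁻¹' Ioo 0 1) ≠ ⊤ :=
    ne_top_of_le_ne_top measure_closedBall_lt_top.ne (measure_mono inter_subset_left)
  rw [sub_zero, ENNReal.ofReal_one, div_one]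
  exact ENNReal.mul_ne_top (by finiteness) this

theorem DS_cpt {n : ℕ} (e : EX n) : IsCompact (DS e) := by
  have : DS e = closedBall 0 1 ∩ {z | inner ℝ e z = 0} := by ext z; simp [DS]
  rw [this]
  exact (isCompact_closedBall _ _).inter_right (isClosed_eq (by fun_prop) continuous_const)

theorem ENL {n : ℕ} (hn : 1 ≤ n) {D : Set (EX n)} (hD : μH[n] D ≠ ⊤) {η : ℝ≥0∞} (hη : η ≠ 0) :
    ∃ U : ℕ → Set (EX n), (∀ i, IsOpen (U i)) ∧ D ⊆ ⋃ i, U i ∧ (∀ i, ediam (U i) ≤ 3) ∧ ∑' i, ediam (U i) ^ (n : ℝ) ≤ μH[n] D + η := by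
  have h1 : (⨅ (t : ℕ → Set (EX n)) (_ : D ⊆ ⋃ i, t i) (_ : ∀ i, ediam (t i) ≤ 1), ∑' i, ⨆ _ : (t i).Nonempty, ediam (t i) ^ (n : ℝ)) < μH[n] D + η / 2 := by
    refine lt_of_le_of_lt ?_ (ENNReal.lt_add_right hD (ENNReal.half_pos hη).ne')
    rw [Measure.hausdorffMeasure_apply]
    exact le_iSup₂_of_le 1 one_pos le_rfl
  simp only [iInf_lt_iff] at h1
  obtain ⟨t, ht1, ht2, ht3⟩ := h1
  obtain ⟨w, hw, hws⟩ := ENNReal.exists_pos_sum_of_countable' (ENNReal.half_pos hη).ne' ℕ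
  have h2 : ∀ i, ∃ U, IsOpen U ∧ t i ⊆ U ∧ ediam U ≤ 3 ∧ ediam U ^ (n : ℝ) ≤ (⨆ _ : (t i).Nonempty, ediam (t i) ^ (n : ℝ)) + w i := by
    intro i
    rcases (t i).eq_empty_or_nonempty with h | h
    · have hn0 : (0 : ℝ) < n := by exact_mod_cast hn
      refine ⟨∅, isOpen_empty, h.le, by simp, by simp [ENNReal.zero_rpow_of_pos hn0]⟩
    · have hm : ediam (t i) ≠ ⊤ := ne_top_of_le_ne_top ENNReal.one_ne_top (ht2 i)
      have hc : Tendsto (fun s : ℝ≥0 => (ediam (t i) + 2 * s) ^ (n : ℝ)) (𝓝 0) (𝓝 (ediam (t i) ^ (n : ℝ))) := by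
        have hc1 : Continuous fun s : ℝ≥0 => (ediam (t i) + 2 * (s : ℝ≥0∞)) ^ (n : ℝ) :=
          ENNReal.continuous_rpow_const.comp (continuous_const.add (ENNReal.continuous_const_mul (by simp) |>.comp ENNReal.continuous_coe))
        simpa using hc1.tendsto 0
      have hlt : ediam (t i) ^ (n : ℝ) < ediam (t i) ^ (n : ℝ) + w i :=
        ENNReal.lt_add_right (ENNReal.rpow_ne_top_of_nonneg n.cast_nonneg hm) (hw i).ne'
      have he := (hc.eventually (gt_mem_nhds hlt)).and (gt_mem_nhds (zero_lt_one : (0 : ℝ≥0) < 1))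
      obtain ⟨s, ⟨hs1, hs2⟩, hs0⟩ := ((he.filter_mono nhdsWithin_le_nhds).and self_mem_nhdsWithin : ∀ᶠ s in 𝓝[>] (0 : ℝ≥0), _).exists
      have hth := Metric.ediam_thickening_le (s := t i) s
      refine ⟨Metric.thickening s (t i), Metric.isOpen_thickening, Metric.self_subset_thickening (by exact_mod_cast hs0) _, hth.trans ?_, ?_⟩
      · have hs2' : (s : ℝ≥0∞) ≤ 1 := by exact_mod_cast hs2.le
        calc _ ≤ (1 : ℝ≥0∞) + 2 * 1 := by gcongr; exact ht2 i
          _ = 3 := by norm_num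
      · refine (ENNReal.rpow_le_rpow hth n.cast_nonneg).trans (hs1.le.trans ?_)
        gcongr
        exact le_iSup (fun _ : (t i).Nonempty => ediam (t i) ^ (n : ℝ)) h
  choose U hU1 hU2 hU3 hU4 using h2
  refine ⟨U, hU1, ht1.trans (iUnion_mono hU2), hU3, ?_⟩
  calc _ ≤ ∑' i, ((⨆ _ : (t i).Nonempty, ediam (t i) ^ (n : ℝ)) + w i) := ENNReal.tsum_le_tsum hU4
    _ = (∑' i, ⨆ _ : (t i).Nonempty, ediam (t i) ^ (n : ℝ)) + ∑' i, w i := ENNReal.tsum_add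
    _ ≤ (μH[n] D + η / 2) + η / 2 := add_le_add ht3.le hws.le
    _ = _ := by rw [add_assoc, ENNReal.add_halves]

theorem UPB {n : ℕ} (hn : 1 ≤ n) {e : EX n} (he : ‖e‖ = 1) {η : ℝ≥0∞} (hη : η ≠ 0) :
    ∃ ε₀ : ℝ, 0 < ε₀ ∧ ∀ (x : EX n) (r : ℝ) (δ : ℝ≥0∞) (A : Set (EX n)), 0 < r → 3 * ofReal r ≤ δ →
      (∀ z ∈ A, ‖z - x‖ ≤ r ∧ |inner ℝ e (z - x)| < ε₀ * r) → PR n δ A ≤ ofReal (r ^ n) * (μH[n] (DS e) + η) := by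
  obtain ⟨U, hU1, hU2, hU3, hU4⟩ := ENL hn (DS_fin hn he) hη
  obtain ⟨ε₀, hε₀, hs⟩ := (DS_cpt e).exists_thickening_subset_open (isOpen_iUnion hU1) hU2
  refine ⟨ε₀, hε₀, fun x r δ A hr hδ hA => ?_⟩
  have h1 : A ⊆ ⋃ i, (fun z => x + r • z) '' U i := by
    intro z hz
    obtain ⟨hz1, hz2⟩ := hA z hz
    have hw : r⁻¹ • (z - x) ∈ ⋃ i, U i := by
      refine hs (Metric.mem_thickening_iff.2 ⟨_, ⟨(proj_le he (r⁻¹ • (z - x))).trans ?_, proj_orth he _⟩, ?_⟩)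
      · rw [norm_smul, norm_inv, Real.norm_of_nonneg hr.le]
        exact inv_mul_le_one_of_le₀ hz1 hr.le
      · rw [dist_eq_norm, sub_sub_cancel, norm_smul, he, mul_one, inner_smul_right, Real.norm_eq_abs, abs_mul, abs_of_pos (inv_pos.2 hr), inv_mul_lt_iff₀ hr]
        linarith
    obtain ⟨i, hi⟩ := mem_iUnion.1 hw
    refine mem_iUnion.2 ⟨i, _, hi, ?_⟩
    simp [smul_smul, mul_inv_cancel₀ hr.ne']
  have hl : LipschitzWith r.toNNReal fun z : EX n => x + r • z := LipschitzWith.of_dist_le_mul fun a b => by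
    rw [dist_add_left, dist_smul₀, Real.norm_of_nonneg hr.le, Real.coe_toNNReal _ hr.le]
  calc PR n δ A ≤ ∑' i, PR n δ ((fun z => x + r • z) '' U i) := (measure_mono h1).trans (measure_iUnion_le _)
    _ ≤ ∑' i, ofReal (r ^ n) * ediam (U i) ^ (n : ℝ) := by
      refine ENNReal.tsum_le_tsum fun i => ?_
      have h2 : ediam ((fun z => x + r • z) '' U i) ≤ ofReal r * ediam (U i) := hl.ediam_image_le _
      refine (OuterMeasure.mkMetric'.pre_le (h2.trans ?_)).trans ((ENNReal.rpow_le_rpow h2 n.cast_nonneg).trans_eq ?_)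
      · refine le_trans ?_ hδ
        rw [mul_comm]
        gcongr
        exact hU3 i
      · rw [ENNReal.mul_rpow_of_nonneg _ _ n.cast_nonneg, ENNReal.rpow_natCast, ENNReal.ofReal_pow hr.le]
    _ ≤ _ := by
      rw [ENNReal.tsum_mul_left]
      gcongr



theorem DS_scale {n : ℕ} (e x : EX n) {c : ℝ} (hc : 0 < c) : ofReal (c ^ n) * μH[n] (DS e) = μH[n] ((fun z => x + c • z) '' DS e) := by
  have h1 : (fun z => x + c • z) '' DS e = (fun z => x + z) '' ((fun z => c • z) '' DS e) := (image_image _ _ _).symm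
  rw [h1, (isometry_add_left x).hausdorffMeasure_image (Or.inl n.cast_nonneg), Set.image_smul, Measure.hausdorffMeasure_smul₀ n.cast_nonneg hc.ne', ENNReal.smul_def, smul_eq_mul]
  congr 1
  rw [NNReal.rpow_natCast, ENNReal.coe_pow, ENNReal.ofReal_pow hc.le, ← enorm_eq_nnnorm, Real.enorm_of_nonneg hc.le]

theorem LOWB {n : ℕ} (hn : 1 ≤ n) {f : EX n → ℝ} {G : ℕ → Set (EX n)} {E : Set (EX n)} {εs : ℕ → ℝ≥0∞} (hS : SEQ f G E εs) {x e : EX n} (he : ‖e‖ = 1)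
    {ε r : ℝ} (hr : 0 < r) (hε : 0 < ε) (hε3 : 3 * ε < 1) (hF : FLT E x e ε r) :
    ofReal (((1 - 3 * ε) * r) ^ n) * μH[n] (DS e) ≤ liminf (fun k => μH[n] (frontier (G k) ∩ ball x r)) atTop := by
  obtain ⟨C, hC, hT⟩ := T2c hn
  have hεr : 0 < ε * r := by positivity
  set v : ℕ → ℝ≥0∞ := fun k => volume ((G k \ E ∪ E \ G k) ∩ ball x r) with hv
  set b : ℕ → ℝ≥0∞ := fun k => C * v k / ofReal (ε * r) with hb
  have hb0 : Tendsto (fun k => b k + b k) atTop (𝓝 0) := by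
    have h1 : Tendsto b atTop (𝓝 0) := by
      have := ENNReal.Tendsto.div_const (ENNReal.Tendsto.const_mul (a := (C : ℝ≥0∞)) (hS.conv x r) (Or.inr ENNReal.coe_ne_top)) (b := ofReal (ε * r)) (Or.inr (ENNReal.ofReal_pos.2 hεr).ne')
      simpa using this
    simpa using h1.add h1
  rw [DS_scale e x (by nlinarith : 0 < (1 - 3 * ε) * r)]
  set X := (fun z => x + ((1 - 3 * ε) * r) • z) '' DS e with hX
  have hXt : μH[n] X ≠ ⊤ := by
    rw [hX, ← DS_scale e x (by nlinarith : 0 < (1 - 3 * ε) * r)]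
    exact ENNReal.mul_ne_top ENNReal.ofReal_ne_top (DS_fin hn he)
  have hXx : ∀ y ∈ X, inner ℝ e (y - x) = 0 ∧ ‖y - x‖ ≤ (1 - 3 * ε) * r := by
    rintro _ ⟨z, hz, rfl⟩
    have h0 : 0 < (1 - 3 * ε) * r := by nlinarith
    simp only [add_sub_cancel_left]
    rw [inner_smul_right, hz.2, mul_zero, norm_smul, Real.norm_of_nonneg h0.le]
    exact ⟨rfl, mul_le_of_le_one_right h0.le hz.1⟩
  set π : EX n → EX n := fun z => z - inner ℝ e (z - x) • e with hπ
  have hπl : LipschitzWith 1 π := LipschitzWith.of_dist_le_mul fun y z => by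
    rw [NNReal.coe_one, one_mul, dist_eq_norm, dist_eq_norm]
    have h1 : π y - π z = (y - z) - inner ℝ e (y - z) • e := by
      simp only [hπ, inner_sub_right, sub_smul]
      abel
    rw [h1]
    exact proj_le he (y - z)
  have hπs : ∀ y ∈ X, ∀ s : ℝ, inner ℝ e (y + s • e - x) = s ∧ π (y + s • e) = y := by
    intro y hy s
    have h1 : inner ℝ e (y + s • e - x) = s := by
      rw [add_sub_right_comm, inner_add_right, (hXx y hy).1, inner_smul_right, real_inner_self_eq_norm_sq, he]; ring
    exact ⟨h1, by simp only [hπ]; rw [h1]; abel⟩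
  have hXb : ∀ y ∈ X, ∀ s : ℝ, |s| < 2 * (ε * r) → y + s • e ∈ ball x r := by
    intro y hy s hs
    rw [mem_ball_iff_norm, add_sub_right_comm]
    refine (norm_add_le _ _).trans_lt ?_
    rw [norm_smul, he, Real.norm_eq_abs]
    nlinarith [(hXx y hy).2]
  have key : ∀ k, μH[n] X ≤ μH[n] (frontier (G k) ∩ ball x r) + (b k + b k) := by
    intro k
    have hGm := (hS.am k).1.measurableSet
    have hu := lip_inner he x
    obtain ⟨s₁, hs₁, h1⟩ := hT (fun _ => 1) measurable_const (fun _ => one_pos) _ hu (ball x r \ G k) (isOpen_ball.measurableSet.diff hGm) (-(2 * (ε * r))) (-(ε * r)) (by linarith)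
    obtain ⟨s₂, hs₂, h2⟩ := hT (fun _ => 1) measurable_const (fun _ => one_pos) _ hu (ball x r ∩ G k) (isOpen_ball.measurableSet.inter hGm) (ε * r) (2 * (ε * r)) (by linarith)
    rw [mp_one, mv_one] at h1 h2
    rw [show -(ε * r) - -(2 * (ε * r)) = ε * r by ring] at h1
    rw [show 2 * (ε * r) - ε * r = ε * r by ring] at h2
    have h3 : volume ((ball x r \ G k) ∩ (fun z => inner ℝ e (z - x)) ⁻¹' Ioo (-(2 * (ε * r))) (-(ε * r))) ≤ v k := by
      rw [← zero_add (v k), ← RG_null E]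
      refine (measure_mono ?_).trans (measure_union_le _ _)
      rintro z ⟨⟨hz1, hz2⟩, hz3⟩
      by_cases hzE : z ∈ E
      · exact Or.inr ⟨Or.inr ⟨hzE, hz2⟩, hz1⟩
      · exact Or.inl ⟨hF.2.1 z hz1 hz3.2, hzE⟩
    have h4 : volume ((ball x r ∩ G k) ∩ (fun z => inner ℝ e (z - x)) ⁻¹' Ioo (ε * r) (2 * (ε * r))) ≤ v k := by
      rw [← zero_add (v k), ← RG_null Eᶜ]
      refine (measure_mono ?_).trans (measure_union_le _ _)
      rintro z ⟨⟨hz1, hz2⟩, hz3⟩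
      by_cases hzE : z ∈ E
      · exact Or.inl ⟨hF.2.2 z hz1 hz3.1, fun h => h hzE⟩
      · exact Or.inr ⟨Or.inl ⟨hz2, hzE⟩, hz1⟩
    have h1' := h1.trans (ENNReal.div_le_div_right (mul_le_mul_right h3 (C : ℝ≥0∞)) _)
    have h2' := h2.trans (ENNReal.div_le_div_right (mul_le_mul_right h4 (C : ℝ≥0∞)) _)
    set S₁ := (ball x r \ G k) ∩ (fun z => inner ℝ e (z - x)) ⁻¹' {s₁} with hS₁
    set S₂ := (ball x r ∩ G k) ∩ (fun z => inner ℝ e (z - x)) ⁻¹' {s₂} with hS₂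
    have hcov : X ⊆ π '' (frontier (G k) ∩ ball x r ∪ (S₁ ∪ S₂)) := by
      intro y hy
      by_cases ha : y + s₁ • e ∈ G k
      · by_cases hb' : y + s₂ • e ∈ G k
        · exact ⟨_, Or.inr (Or.inr ⟨⟨hXb y hy s₂ (by rw [abs_lt]; constructor <;> linarith [hs₂.1, hs₂.2]), hb'⟩, (hπs y hy s₂).1⟩), (hπs y hy s₂).2⟩
        · have hp : IsPreconnected ((fun s : ℝ => y + s • e) '' Icc s₁ s₂) := isPreconnected_Icc.image _ (by fun_prop)
          have hle : s₁ ≤ s₂ := by linarith [hs₁.2, hs₂.1]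
          obtain ⟨_, ⟨s, hs, rfl⟩, hsf⟩ := preconn_frontier hp (G k) ⟨s₁, left_mem_Icc.2 hle, rfl⟩ ⟨s₂, right_mem_Icc.2 hle, rfl⟩ ha hb'
          exact ⟨_, Or.inl ⟨hsf, hXb y hy s (by rw [abs_lt]; constructor <;> linarith [hs.1, hs.2, hs₁.1, hs₂.2])⟩, (hπs y hy s).2⟩
      · exact ⟨_, Or.inr (Or.inl ⟨⟨hXb y hy s₁ (by rw [abs_lt]; constructor <;> linarith [hs₁.1, hs₁.2]), ha⟩, (hπs y hy s₁).1⟩), (hπs y hy s₁).2⟩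
    calc μH[n] X ≤ μH[n] (π '' (frontier (G k) ∩ ball x r ∪ (S₁ ∪ S₂))) := measure_mono hcov
      _ ≤ μH[n] (frontier (G k) ∩ ball x r ∪ (S₁ ∪ S₂)) := by
        have := hπl.hausdorffMeasure_image_le n.cast_nonneg (frontier (G k) ∩ ball x r ∪ (S₁ ∪ S₂))
        simpa using this
      _ ≤ _ := (measure_union_le _ _).trans (by gcongr; exact (measure_union_le _ _).trans (add_le_add h1' h2'))
  have hlim : Tendsto (fun k => μH[n] X - (b k + b k)) atTop (𝓝 (μH[n] X)) := by
    have := ENNReal.Tendsto.sub (tendsto_const_nhds (x := μH[n] X) (f := atTop)) hb0 (Or.inl hXt)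
    simpa using this
  rw [← hlim.liminf_eq]
  exact liminf_le_liminf (Eventually.of_forall fun k => tsub_le_iff_right.2 (key k))

theorem COMPA {n : ℕ} (hn : 1 ≤ n) {f : EX n → ℝ} {G : ℕ → Set (EX n)} {E : Set (EX n)} {εs : ℕ → ℝ≥0∞} (hS : SEQ f G E εs) {x e : EX n} (he : ‖e‖ = 1)
    (hFL : ∀ ε : ℝ, 0 < ε → ε ≤ 1 / 4 → ∃ ρ, 0 < ρ ∧ ∀ r, 0 < r → r < ρ → FLT E x e ε r) {τ : ℝ} (hτ : 0 < τ) {δ : ℝ≥0∞} (hδ : 0 < δ) :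
    ∃ ρ, 0 < ρ ∧ ∀ r, 0 < r → r < ρ → PR n δ (SG E ∩ closedBall x r) ≤
      ofReal (1 + τ) * liminf (fun k => μH[n] (frontier (G k) ∩ ball x r)) atTop := by
  set θ := μH[n] (DS e) with hθ
  have hη : θ * ofReal (τ / 2) ≠ 0 := mul_ne_zero (DS_pos he) (ENNReal.ofReal_pos.2 (by positivity)).ne'
  obtain ⟨ε₀, hε₀, hU⟩ := UPB hn he hη
  have hc : Tendsto (fun ε : ℝ => (1 - 3 * ε) ^ n * (1 + τ)) (𝓝[>] 0) (𝓝 (1 + τ)) := by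
    have h1 : Continuous fun ε : ℝ => (1 - 3 * ε) ^ n * (1 + τ) := by fun_prop
    have := h1.tendsto 0
    simp only [mul_zero, sub_zero, one_pow, one_mul] at this
    exact this.mono_left nhdsWithin_le_nhds
  have hev := (hc.eventually (lt_mem_nhds (by linarith : 1 + τ / 2 < 1 + τ))).and
    (Ioo_mem_nhdsGT (show (0 : ℝ) < min (1 / 4) (ε₀ / 2) by positivity))
  obtain ⟨ε, hε1, hε, hε2⟩ := hev.exists
  have hε4 : ε ≤ 1 / 4 := hε2.le.trans (min_le_left _ _)
  have hεε : 2 * ε < ε₀ := by linarith [hε2.trans_le (min_le_right (1 / 4) (ε₀ / 2))]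
  obtain ⟨ρ, hρ, hFr⟩ := hFL ε hε hε4
  have hm : min δ 1 ≠ ⊤ := ne_top_of_le_ne_top ENNReal.one_ne_top (min_le_right _ _)
  have hd : 0 < (min δ 1).toReal := ENNReal.toReal_pos (lt_min hδ one_pos).ne' hm
  refine ⟨min (ρ / 2) ((min δ 1).toReal / 3), by positivity, fun r hr hrr => ?_⟩
  have hr1 : 2 * r < ρ := by linarith [hrr.trans_le (min_le_left _ _)]
  have hr2 : 3 * r ≤ (min δ 1).toReal := by linarith [hrr.trans_le (min_le_right _ _)]
  have hδr : 3 * ofReal r ≤ δ := by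
    rw [← ENNReal.ofReal_ofNat 3, ← ENNReal.ofReal_mul (by norm_num)]
    exact (ENNReal.ofReal_le_ofReal hr2).trans ((ENNReal.ofReal_toReal hm).le.trans (min_le_left _ _))
  have hup := hU x r δ (SG E ∩ closedBall x r) hr hδr fun z hz => by
    refine ⟨mem_closedBall_iff_norm.1 hz.2, ((hFr (2 * r) (by positivity) hr1).1 z hz.1 (Metric.closedBall_subset_ball (by linarith) hz.2)).trans_lt ?_⟩
    nlinarith
  have hlo := LOWB hn hS he hr hε (by linarith) (hFr r hr (by linarith))
  refine hup.trans (le_trans ?_ (mul_le_mul_right hlo _))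
  have h3 : θ + θ * ofReal (τ / 2) = ofReal (1 + τ / 2) * θ := by
    rw [ENNReal.ofReal_add zero_le_one (by positivity), ENNReal.ofReal_one]; ring
  have h0 : (0 : ℝ) ≤ 1 - 3 * ε := by linarith
  rw [← hθ, h3, ← mul_assoc, ← mul_assoc, ← ENNReal.ofReal_mul (by positivity), ← ENNReal.ofReal_mul (by positivity)]
  refine mul_le_mul_left (ENNReal.ofReal_le_ofReal ?_) θ
  rw [mul_pow]
  nlinarith [pow_pos hr n]

theorem LSC {n : ℕ} (hn : 1 ≤ n) {f : EX n → ℝ} {G : ℕ → Set (EX n)} {E : Set (EX n)} {εs : ℕ → ℝ≥0∞} (hS : SEQ f G E εs) (h : AHP E)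
    {U : Set (EX n)} (hU : IsOpen U) : μH[n] (SG E ∩ U) ≤ liminf (fun k => μH[n] (frontier (G k) ∩ U)) atTop := by
  set L := liminf (fun k => μH[n] (frontier (G k) ∩ U)) atTop with hL
  refine muH_le_of_PR fun δ hδ => ?_
  have hτ : ∀ τ : ℝ, 0 < τ → PR n δ (SG E ∩ U) ≤ ofReal (1 + τ) * L := by
    intro τ hτ
    have := SG_lf h
    have hSm := (isClosed_SG E).measurableSet
    set good : Set (EX n) := {x | x ∈ SG E ∧ ∃ e : EX n, ‖e‖ = 1 ∧ ∀ ε : ℝ, 0 < ε → ε ≤ 1 / 4 → ∃ ρ, 0 < ρ ∧ ∀ r, 0 < r → r < ρ → FLT E x e ε r} with hgood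
    have hg : (μH[n] : Measure (EX n)).restrict (SG E) goodᶜ = 0 := FLATAE h
    set F : EX n → Set ℝ := fun x => {r | closedBall x r ⊆ U ∧ PR n δ (SG E ∩ closedBall x r) ≤
      ofReal (1 + τ) * liminf (fun k => μH[n] (frontier (G k) ∩ ball x r)) atTop} with hFd
    obtain ⟨t, ρ, htc, hts, htr, hcov, hdj⟩ := Besicovitch.exists_disjoint_closedBall_covering_ae ((μH[n] : Measure (EX n)).restrict (SG E)) F (good ∩ U)
      (fun x hx d hd => by
        obtain ⟨⟨_, e, he, hFL⟩, hxU⟩ := hx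
        obtain ⟨r₁, hr₁, h1⟩ := COMPA hn hS he hFL hτ hδ
        obtain ⟨r₂, hr₂, h2⟩ := Metric.isOpen_iff.1 hU x hxU
        have h0 : 0 < min d (min r₁ r₂) / 2 := by positivity
        have hd1 : min d (min r₁ r₂) / 2 < min d (min r₁ r₂) := by linarith
        refine ⟨min d (min r₁ r₂) / 2, ⟨(Metric.closedBall_subset_ball (hd1.trans_le ((min_le_right _ _).trans (min_le_right _ _)))).trans h2,
          h1 _ h0 (hd1.trans_le ((min_le_right _ _).trans (min_le_left _ _)))⟩, h0, hd1.trans_le (min_le_left _ _)⟩) (fun _ => 1) fun _ _ => one_pos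
    rw [Measure.restrict_apply' hSm] at hg hcov
    have hct : Countable t := htc.to_subtype
    have hsub : SG E ∩ U ⊆ (⋃ x : t, SG E ∩ closedBall x (ρ x)) ∪ (goodᶜ ∩ SG E ∪ ((good ∩ U) \ ⋃ x ∈ t, closedBall x (ρ x)) ∩ SG E) := by
      rintro z ⟨hz1, hz2⟩
      by_cases hzg : z ∈ good
      · by_cases hzt : z ∈ ⋃ x ∈ t, closedBall x (ρ x)
        · obtain ⟨x, hx, hzx⟩ := mem_iUnion₂.1 hzt
          exact Or.inl (mem_iUnion.2 ⟨⟨x, hx⟩, hz1, hzx⟩)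
        · exact Or.inr (Or.inr ⟨⟨⟨hzg, hz2⟩, hzt⟩, hz1⟩)
      · exact Or.inr (Or.inl ⟨hzg, hz1⟩)
    have hnull : PR n δ (goodᶜ ∩ SG E ∪ ((good ∩ U) \ ⋃ x ∈ t, closedBall x (ρ x)) ∩ SG E) ≤ 0 :=
      (PR_le δ hδ _).trans ((measure_union_le _ _).trans (by rw [hg, hcov, add_zero]))
    calc PR n δ (SG E ∩ U) ≤ PR n δ (⋃ x : t, SG E ∩ closedBall x (ρ x)) + 0 := (measure_mono hsub).trans ((measure_union_le _ _).trans (by gcongr))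
      _ ≤ ∑' x : t, PR n δ (SG E ∩ closedBall x (ρ x)) := by rw [add_zero]; exact measure_iUnion_le _
      _ ≤ ∑' x : t, ofReal (1 + τ) * liminf (fun k => μH[n] (frontier (G k) ∩ ball (x : EX n) (ρ x))) atTop :=
        ENNReal.tsum_le_tsum fun x => (htr x x.2).1.2
      _ = ofReal (1 + τ) * ∫⁻ x : t, liminf (fun k => μH[n] (frontier (G k) ∩ ball (x : EX n) (ρ x))) atTop ∂Measure.count := by
        rw [ENNReal.tsum_mul_left, lintegral_count]
      _ ≤ ofReal (1 + τ) * L := by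
        gcongr
        refine (lintegral_liminf_le fun k => measurable_of_countable _).trans (liminf_le_liminf (Eventually.of_forall fun k => ?_))
        simp only [lintegral_count]
        rw [← measure_iUnion]
        · refine measure_mono (iUnion_subset fun x => inter_subset_inter_right _ ?_)
          exact ball_subset_closedBall.trans (htr x x.2).1.1
        · intro x y hxy
          have := hdj x.2 y.2 (fun hh => hxy (Subtype.ext hh))
          exact this.mono (inter_subset_right.trans ball_subset_closedBall) (inter_subset_right.trans ball_subset_closedBall)
        · intro x
          exact isClosed_frontier.measurableSet.inter isOpen_ball.measurableSet
  have hlim : Tendsto (fun τ : ℝ => ofReal (1 + τ) * L) (𝓝[>] 0) (𝓝 L) := by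
    have h1 : Tendsto (fun τ : ℝ => ofReal (1 + τ)) (𝓝[>] 0) (𝓝 1) := by
      have h2 : Continuous fun τ : ℝ => ofReal (1 + τ) := ENNReal.continuous_ofReal.comp (by fun_prop)
      have := h2.tendsto 0
      rw [add_zero, ENNReal.ofReal_one] at this
      exact this.mono_left nhdsWithin_le_nhds
    simpa using ENNReal.Tendsto.mul_const (b := L) h1 (Or.inl one_ne_zero)
  exact ge_of_tendsto hlim (eventually_nhdsWithin_of_forall fun τ h => hτ τ h)

theorem EXIST {n : ℕ} (hn : 1 ≤ n) {f : EX n → ℝ} (hf : Continuous f) (hpos : ∀ x, 0 < f x)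
    (hinf : Tendsto f (Bornology.cobounded (EX n)) atTop) (hZ : ZT f) {V : ℝ} (hV : 0 < V) : ∃ Ω, IsIsopRegion f Ω (ofReal V) := by
  obtain ⟨σ, G, E, ε, hE, hEV, hS, hS', hσ, hmin⟩ := MINSEQ hn hf hpos hinf hZ hV
  have h1 : volume E ≠ 0 := fun h0 => (ENNReal.ofReal_pos.2 hV).ne' (hEV ▸ mv_ac f h0)
  have h2 : volume Eᶜ ≠ 0 := by
    intro h0
    obtain ⟨i, hi, hif⟩ := LOW hf hpos hinf
    have h3 := le_wd (f := f) volume hE (c := i) fun z _ => hif z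
    have h4 : volume E = ⊤ := by
      have := measure_add_measure_compl (μ := volume) hE
      rw [h0, add_zero, measure_univ_of_isAddLeftInvariant] at this
      exact this
    rw [h4, ENNReal.mul_top (ENNReal.ofReal_pos.2 hi).ne', top_le_iff] at h3
    rw [show volume.withDensity (fun x => ofReal (f x)) E = mv f E from rfl, hEV] at h3
    exact ENNReal.ofReal_ne_top h3
  have hA := AHL hn hf hpos hS hS' h1 h2
  have hSn := SG_null hA
  have hvol : mv f (RG E) = ofReal V := by
    rw [← hEV]
    refine measure_congr ((mv_ac f).ae_eq ?_)
    rw [ae_eq_set]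
    refine ⟨RG_null E, measure_mono_null (t := SG E ∪ (RG Eᶜ \ Eᶜ)) (fun z hz => ?_) (measure_union_null hSn (RG_null Eᶜ))⟩
    rcases mem_cases E z with h | h | h
    · exact Or.inl h
    · exact absurd h hz.2
    · exact Or.inr ⟨h, fun hc => hc hz.1⟩
  refine ⟨RG E, isOpen_RG E, by rw [wvol_eq, hvol], fun U hU hUV => ?_⟩
  rw [wper_eq, wper_eq]
  rw [wvol_eq] at hUV
  refine le_trans ?_ (hmin U hU hUV)
  have hl := lintegral_le_liminf_lintegral_of_forall_isOpen_measure_le_liminf_measure (μ := (μH[n] : Measure (EX n)).restrict (SG E))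
    (μs := fun k => (μH[n] : Measure (EX n)).restrict (frontier (G k))) hf (fun x => (hpos x).le) fun W hW => by
      simp only [Measure.restrict_apply hW.measurableSet, inter_comm W]
      exact LSC hn hS hA hW
  calc mp f (frontier (RG E)) ≤ mp f (SG E) := measure_mono (frontier_RG E)
    _ = ∫⁻ x in SG E, ofReal (f x) ∂μH[n] := by rw [mp, withDensity_apply _ (isClosed_SG E).measurableSet]
    _ ≤ _ := hl
    _ = liminf (fun k => mp f (frontier (G k))) atTop := by
      congr 1; ext k
      rw [mp, withDensity_apply _ isClosed_frontier.measurableSet]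
    _ ≤ liminf (fun k => σ + ε k) atTop := liminf_le_liminf (Eventually.of_forall hσ)
    _ = σ := by
      have : Tendsto (fun k => σ + ε k) atTop (𝓝 (σ + 0)) := hS.eps.const_add σ
      rw [this.liminf_eq, add_zero]


/-- Existence and boundedness of isoperimetric regions in `ℝ^{n+1}`
for a continuous positive density `f` tending to `+∞` at infinity, assuming the sequence
`ζ(m) = min{f : m ≤ |x| ≤ m+2} / max{f^{n/(n+1)} : m ≤ |x| ≤ m+2}` tends to `+∞`. -/
theorem exists_bounded_isoperimetric_region_of_zeta_tendsto
    (n : ℕ) (hn : 1 ≤ n) (f : EuclideanSpace ℝ (Fin (n + 1)) → ℝ)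
    (hcont : Continuous f) (hpos : ∀ x, 0 < f x)
    (hinf : Tendsto f (Bornology.cobounded (EuclideanSpace ℝ (Fin (n + 1)))) atTop)
    (hζ : Tendsto (fun m : ℕ =>
        sInf (f '' {x : EuclideanSpace ℝ (Fin (n + 1)) | (m : ℝ) ≤ ‖x‖ ∧ ‖x‖ ≤ m + 2}) /
        sSup ((fun x => f x ^ ((n : ℝ) / (n + 1))) ''
          {x : EuclideanSpace ℝ (Fin (n + 1)) | (m : ℝ) ≤ ‖x‖ ∧ ‖x‖ ≤ m + 2}))
      atTop atTop)
    (V : ℝ) (hV : 0 < V) :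
    (∃ Ω : Set (EuclideanSpace ℝ (Fin (n + 1))),
        Bornology.IsBounded Ω ∧ IsIsopRegion f Ω (ENNReal.ofReal V)) ∧
    ∀ Ω : Set (EuclideanSpace ℝ (Fin (n + 1))),
        IsIsopRegion f Ω (ENNReal.ofReal V) → Bornology.IsBounded Ω := by
  have hZ := ZETA hn hcont hpos hζ
  refine ⟨?_, fun Ω hΩ => PART2 hn hcont hpos hinf hZ hV hΩ⟩
  obtain ⟨Ω, hΩ⟩ := EXIST hn hcont hpos hinf hZ hV
  exact ⟨Ω, PART2 hn hcont hpos hinf hZ hV hΩ, hΩ⟩
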